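/- arXiv:1011.0356 — 3 statements merged into one kernel-verified Lean document; each statement's English description precedes it below -/
import Mathlib

section
/- Let V be a finite dimensional Z₂-graded vector space with two anticommuting odd exact endomorphisms v and h. Let ξ and η denote the induced odd isomorphisms Ker(vh)/(Ker(v)+Ker(h)) → (Ker(v)∩Ker(h))/Im(vh) coming from v and h respectively. Then the comparison number T(h)⁻¹ ∘ T(v) ∈ F* of the two torsion isomorphisms equals det(η_+⁻¹ ξ_+) · det(η_- ξ_-⁻¹), where the subscripts denote the restrictions to the even and odd graded pieces of the quotient spaces. -/
open Module Submodule

section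

variable (F : Type) [Field F] (Vp Vm : Type) [AddCommGroup Vp] [Module F Vp]
  [AddCommGroup Vm] [Module F Vm]

/-- `g` is a pseudo-inverse of the linear map `β`. -/
def IsPseudoInverse {M N : Type} [AddCommGroup M] [Module F M]
    [AddCommGroup N] [Module F N] (β : M →ₗ[F] N) (g : N →ₗ[F] M) : Prop :=
  β ∘ₗ g ∘ₗ β = β ∧ g ∘ₗ β ∘ₗ g = g

/-- The even part of the quotient `Ker(vh)/(Ker v + Ker h)`. -/
abbrev Qplus (vp hp : Vp →ₗ[F] Vm) (vm hm : Vm →ₗ[F] Vp) :=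
  ↥(LinearMap.ker (vm ∘ₗ hp)) ⧸
  ((LinearMap.ker vp ⊔ LinearMap.ker hp).comap (LinearMap.ker (vm ∘ₗ hp)).subtype)

/-- The odd part of the quotient `Ker(vh)/(Ker v + Ker h)`. -/
abbrev Qminus (vp hp : Vp →ₗ[F] Vm) (vm hm : Vm →ₗ[F] Vp) :=
  ↥(LinearMap.ker (vp ∘ₗ hm)) ⧸
  ((LinearMap.ker vm ⊔ LinearMap.ker hm).comap (LinearMap.ker (vp ∘ₗ hm)).subtype)

/-- The even part of the quotient `(Ker v ∩ Ker h)/Im(vh)`. -/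
abbrev Rplus (vp hp : Vp →ₗ[F] Vm) (vm hm : Vm →ₗ[F] Vp) :=
  ↥(LinearMap.ker vp ⊓ LinearMap.ker hp) ⧸
  ((LinearMap.range (vm ∘ₗ hp)).comap (LinearMap.ker vp ⊓ LinearMap.ker hp).subtype)

/-- The odd part of the quotient `(Ker v ∩ Ker h)/Im(vh)`. -/
abbrev Rminus (vp hp : Vp →ₗ[F] Vm) (vm hm : Vm →ₗ[F] Vp) :=
  ↥(LinearMap.ker vm ⊓ LinearMap.ker hm) ⧸
  ((LinearMap.range (vp ∘ₗ hm)).comap (LinearMap.ker vm ⊓ LinearMap.ker hm).subtype)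

variable {F Vp Vm}
variable {vp hp : Vp →ₗ[F] Vm} {vm hm : Vm →ₗ[F] Vp}

theorem aux_det_unip {M : Type} [AddCommGroup M] [Module F M] [FiniteDimensional F M]
    (N : M →ₗ[F] M) (hN : ∀ x, N (N x) = 0) : LinearMap.det (LinearMap.id + N) = 1 := by
  have he : LinearMap.ker N ≤ (LinearMap.ker N).comap (LinearMap.id + N) := by
    intro x hx
    simp only [LinearMap.mem_ker, Submodule.mem_comap] at *
    simp [hx]
  rw [LinearMap.det_eq_det_mul_det (LinearMap.ker N) _ he]
  have h1 : (LinearMap.id + N).restrict he = LinearMap.id := by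
    ext x
    have := x.2
    simp only [LinearMap.mem_ker] at this
    simp [LinearMap.restrict_apply, this]
  have h2 : (LinearMap.ker N).mapQ (LinearMap.ker N) (LinearMap.id + N) he = LinearMap.id := by
    apply Submodule.linearMap_qext
    ext x
    simp only [LinearMap.comp_apply, Submodule.mkQ_apply, Submodule.mapQ_apply, LinearMap.id_apply]
    rw [Submodule.Quotient.eq]
    simp [hN]
  rw [h1, h2, LinearMap.det_id, LinearMap.det_id, one_mul]

theorem aux_det_block {M N : Type} [AddCommGroup M] [Module F M] [FiniteDimensional F M]
    [AddCommGroup N] [Module F N] [FiniteDimensional F N]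
    (T : M × N →ₗ[F] M × N) (f : M →ₗ[F] M) (g : N →ₗ[F] M) (k : N →ₗ[F] N)
    (hT : ∀ x y, T (x, y) = (f x + g y, k y)) :
    LinearMap.det T = LinearMap.det f * LinearMap.det k := by
  have h : T = (LinearMap.prodMap LinearMap.id k) ∘ₗ
      (LinearMap.id + (LinearMap.inl F M N ∘ₗ g ∘ₗ LinearMap.snd F M N)) ∘ₗ
      (LinearMap.prodMap f LinearMap.id) := by
    apply LinearMap.ext
    rintro ⟨x, y⟩
    rw [hT]
    simp
  rw [h, LinearMap.det_comp, LinearMap.det_comp, LinearMap.det_prodMap, LinearMap.det_prodMap,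
    aux_det_unip _ (by intro x; simp)]
  simp [mul_comm]

theorem aux_det_J {M : Type} [AddCommGroup M] [Module F M] [FiniteDimensional F M]
    (T : M × M →ₗ[F] M × M) (hT : ∀ x y, T (x, y) = (y, -x)) : LinearMap.det T = 1 := by
  have h : T = (LinearMap.id + (LinearMap.inl F M M ∘ₗ LinearMap.snd F M M)) ∘ₗ
      (LinearMap.id + (LinearMap.inr F M M ∘ₗ (-LinearMap.fst F M M))) ∘ₗ
      (LinearMap.id + (LinearMap.inl F M M ∘ₗ LinearMap.snd F M M)) := by
    apply LinearMap.ext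
    rintro ⟨x, y⟩
    rw [hT]
    simp
  rw [h, LinearMap.det_comp, LinearMap.det_comp, aux_det_unip _ (by intro x; simp),
    aux_det_unip _ (by intro x; simp)]
  simp

theorem aux_det_J' {M : Type} [AddCommGroup M] [Module F M] [FiniteDimensional F M]
    (T : M × M →ₗ[F] M × M) (hT : ∀ x y, T (x, y) = (-y, x)) : LinearMap.det T = 1 := by
  have h : LinearMap.id = (-T) ∘ₗ T := by
    apply LinearMap.ext
    rintro ⟨x, y⟩
    simp [hT]
  have h1 := aux_det_J (-T) (by intro x y; simp [hT])
  have h2 := congrArg LinearMap.det h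
  rw [LinearMap.det_comp, h1, LinearMap.det_id, one_mul] at h2
  exact h2.symm

/-- Independence of the pseudo-inverse. -/
theorem aux_indep [FiniteDimensional F Vp] [FiniteDimensional F Vm]
    (hvv : ∀ x, vm (vp x) = 0) (hvv' : ∀ x, vp (vm x) = 0) (g g' : Vp →ₗ[F] Vm)
    (hg : IsPseudoInverse F vm g) (hg' : IsPseudoInverse F vm g') (e : Vp ≃ₗ[F] Vm) :
    LinearMap.det ((e.symm : Vm →ₗ[F] Vp) ∘ₗ (vp + g)) =
      LinearMap.det ((e.symm : Vm →ₗ[F] Vp) ∘ₗ (vp + g')) := by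
  have a1 : ∀ x, vm (g (vm x)) = vm x := fun x => LinearMap.congr_fun hg.1 x
  have a2 : ∀ x, g (vm (g x)) = g x := fun x => LinearMap.congr_fun hg.2 x
  have b1 : ∀ x, vm (g' (vm x)) = vm x := fun x => LinearMap.congr_fun hg'.1 x
  have b2 : ∀ x, g' (vm (g' x)) = g' x := fun x => LinearMap.congr_fun hg'.2 x
  set g2 : Vp →ₗ[F] Vm := g' ∘ₗ vm ∘ₗ g with hg2
  have s1 : LinearMap.det ((e.symm : Vm →ₗ[F] Vp) ∘ₗ (vp + g2)) =
      LinearMap.det ((e.symm : Vm →ₗ[F] Vp) ∘ₗ (vp + g)) := by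
    have : (e.symm : Vm →ₗ[F] Vp) ∘ₗ (vp + g2) =
        ((e.symm : Vm →ₗ[F] Vp) ∘ₗ (LinearMap.id + (g2 - g) ∘ₗ vm) ∘ₗ (e.symm.symm : Vp →ₗ[F] Vm))
          ∘ₗ ((e.symm : Vm →ₗ[F] Vp) ∘ₗ (vp + g)) := by
      ext x
      simp [hg2, hvv, a1, a2]
    rw [this, LinearMap.det_comp, LinearMap.det_conj, aux_det_unip, one_mul]
    intro x
    simp [hg2, a1, a2, b1]
  have s2 : LinearMap.det ((e.symm : Vm →ₗ[F] Vp) ∘ₗ (vp + g')) =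
      LinearMap.det ((e.symm : Vm →ₗ[F] Vp) ∘ₗ (vp + g2)) := by
    have : (e.symm : Vm →ₗ[F] Vp) ∘ₗ (vp + g') =
        ((e.symm : Vm →ₗ[F] Vp) ∘ₗ (vp + g2)) ∘ₗ (LinearMap.id + vm ∘ₗ (g' - g2)) := by
      ext x
      simp [hg2, hvv', a1, a2, b1, b2]
    rw [this, LinearMap.det_comp, aux_det_unip, mul_one]
    intro x
    simp [hg2, a1, a2, b1]
  rw [← s1, s2]

/-- The coordinate map. -/
def auxPhi (vm hm : Vm →ₗ[F] Vp) (hp : Vp →ₗ[F] Vm) (CA QA : Submodule F Vp)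
    (CB QB : Submodule F Vm) :
    ((CA × CA) × ((CB × CB) × (QA × QB))) →ₗ[F] Vp :=
  (CA.subtype.coprod (vm ∘ₗ hp ∘ₗ CA.subtype)).coprod
    (((vm ∘ₗ CB.subtype).coprod (hm ∘ₗ CB.subtype)).coprod
      (QA.subtype.coprod (vm ∘ₗ QB.subtype)))

theorem auxPhi_apply (vm hm : Vm →ₗ[F] Vp) (hp : Vp →ₗ[F] Vm) (CA QA : Submodule F Vp)
    (CB QB : Submodule F Vm) (c1 c2 : CA) (c3 c4 : CB) (q : QA) (r : QB) :
    auxPhi vm hm hp CA QA CB QB ((c1, c2), ((c3, c4), (q, r))) =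
      ((c1 : Vp) + vm (hp c2)) + ((vm c3 + hm c4) + ((q : Vp) + vm r)) := by
  simp [auxPhi]

/-- Hypotheses on the complements: `C` is a complement of `Ker(vh)`, and `Q` a complement of
`Ker v + Ker h` inside `Ker(vh)`, stated elementwise. -/
structure AuxCompl (wh : Vp →ₗ[F] Vp) (a b : Vp →ₗ[F] Vm) (C Q : Submodule F Vp) : Prop where
  inj : ∀ c ∈ C, wh c = 0 → c = 0
  split : ∀ x, ∃ c ∈ C, ∃ k, wh k = 0 ∧ x = c + k
  qker : ∀ q ∈ Q, wh q = 0
  qinj : ∀ q ∈ Q, ∀ x y, a x = 0 → b y = 0 → q = x + y → q = 0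
  qsplit : ∀ k, wh k = 0 → ∃ q ∈ Q, ∃ x y, a x = 0 ∧ b y = 0 ∧ k = q + (x + y)

theorem AuxCompl.exists (wh : Vp →ₗ[F] Vp) (a b : Vp →ₗ[F] Vm)
    (ha : ∀ x, a x = 0 → wh x = 0) (hb : ∀ x, b x = 0 → wh x = 0) :
    ∃ C Q, AuxCompl wh a b C Q := by
  obtain ⟨C, hC⟩ := Submodule.exists_isCompl (LinearMap.ker wh)
  obtain ⟨Q', hQ'⟩ := Submodule.exists_isCompl (LinearMap.ker a ⊔ LinearMap.ker b)
  refine ⟨C, Q' ⊓ LinearMap.ker wh, ?_, ?_, ?_, ?_, ?_⟩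
  · intro c hc h0
    exact (Submodule.disjoint_def.1 hC.disjoint) c h0 hc
  · intro x
    have : x ∈ LinearMap.ker wh ⊔ C := by rw [hC.sup_eq_top]; trivial
    obtain ⟨k, hk, c, hc, rfl⟩ := Submodule.mem_sup.1 this
    exact ⟨c, hc, k, hk, add_comm _ _⟩
  · intro q hq
    exact hq.2
  · intro q hq x y hx hy h
    refine (Submodule.disjoint_def.1 hQ'.disjoint) q ?_ hq.1
    rw [h]
    exact Submodule.add_mem_sup hx hy
  · intro k hk
    have : k ∈ (LinearMap.ker a ⊔ LinearMap.ker b) ⊔ Q' := by rw [hQ'.sup_eq_top]; trivial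
    obtain ⟨s, hs, q, hq, rfl⟩ := Submodule.mem_sup.1 this
    obtain ⟨x, hx, y, hy, rfl⟩ := Submodule.mem_sup.1 hs
    refine ⟨q, ⟨hq, ?_⟩, x, y, hx, hy, add_comm _ _⟩
    simp only [map_add, ha x hx, hb y hy] at hk
    simpa using hk

theorem AuxCompl.symm {wh wh' : Vp →ₗ[F] Vp} {a b : Vp →ₗ[F] Vm} {C Q : Submodule F Vp}
    (h : AuxCompl wh a b C Q) (hw : ∀ x, wh' x = - wh x) : AuxCompl wh' b a C Q where
  inj c hc h0 := h.inj c hc (by simpa [hw] using h0)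
  split x := by
    obtain ⟨c, hc, k, hk, e⟩ := h.split x
    exact ⟨c, hc, k, by simp [hw, hk], e⟩
  qker q hq := by simp [hw, h.qker q hq]
  qinj q hq x y hx hy e := h.qinj q hq y x hy hx (by rw [e, add_comm])
  qsplit k hk := by
    obtain ⟨q, hq, x, y, hx, hy, e⟩ := h.qsplit k (by simpa [hw] using hk)
    exact ⟨q, hq, y, x, hy, hx, by rw [e, add_comm x y]⟩

theorem auxPhi_bij
    (an1 : ∀ x, hm (vp x) = - vm (hp x)) (an2 : ∀ x, hp (vm x) = - vp (hm x))
    (hv1 : LinearMap.ker vp = LinearMap.range vm)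
    (hv2 : LinearMap.ker vm = LinearMap.range vp)
    (hh1 : LinearMap.ker hp = LinearMap.range hm)
    (hh2 : LinearMap.ker hm = LinearMap.range hp)
    {CA QA : Submodule F Vp} {CB QB : Submodule F Vm}
    (HA : AuxCompl (vm ∘ₗ hp) vp hp CA QA) (HB : AuxCompl (vp ∘ₗ hm) vm hm CB QB) :
    Function.Bijective (auxPhi vm hm hp CA QA CB QB) := by
  have v1 : ∀ x, vp (vm x) = 0 := fun x => by
    rw [← LinearMap.mem_ker, hv1]; exact ⟨x, rfl⟩
  have v2 : ∀ x, vm (vp x) = 0 := fun x => by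
    rw [← LinearMap.mem_ker, hv2]; exact ⟨x, rfl⟩
  have h1 : ∀ x, hp (hm x) = 0 := fun x => by
    rw [← LinearMap.mem_ker, hh1]; exact ⟨x, rfl⟩
  have h2 : ∀ x, hm (hp x) = 0 := fun x => by
    rw [← LinearMap.mem_ker, hh2]; exact ⟨x, rfl⟩
  constructor
  · rw [← LinearMap.ker_eq_bot, LinearMap.ker_eq_bot']
    rintro ⟨⟨c1, c2⟩, ⟨⟨c3, c4⟩, ⟨q, r⟩⟩⟩ h
    rw [auxPhi_apply] at h
    have kq := HA.qker q q.2
    have kr := HB.qker r r.2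
    simp only [LinearMap.comp_apply] at kq kr
    have e1 : (c1 : Vp) = 0 := by
      apply HA.inj _ c1.2
      have := congrArg (fun x => vm (hp x)) h
      simpa [an2, v2, h1, kq, kr, v1] using this
    rw [e1] at h
    have e2 : (q : Vp) = 0 := by
      refine HA.qinj _ q.2 (-(vm (hp c2) + vm c3 + vm r)) (-hm c4) (by simp [v1]) (by simp [h1]) ?_
      rw [← sub_eq_zero, ← h]; abel
    rw [e2] at h
    have e3 : (c4 : Vm) = 0 := by
      apply HB.inj _ c4.2
      have := congrArg vp h
      simpa [v1] using this
    rw [e3] at h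
    have e4 : (c3 : Vm) = 0 := by
      apply HB.inj _ c3.2
      have := congrArg hp h
      simpa [an2, h2, kr] using this
    rw [e4] at h
    have e5 : (r : Vm) = 0 := by
      refine HB.qinj _ r.2 (hp c2 + r) (-hp c2) ?_ (by simp [h2]) (by abel)
      simpa using h
    rw [e5] at h
    have e6 : (c2 : Vp) = 0 := by
      apply HA.inj _ c2.2
      simpa using h
    ext <;> simp [e1, e2, e3, e4, e5, e6]
  · intro x
    obtain ⟨c1, hc1, k, hk, rfl⟩ := HA.split x
    obtain ⟨q, hq, a, b, ha, hb, rfl⟩ := HA.qsplit k hk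
    rw [← LinearMap.mem_ker, hh1] at hb
    obtain ⟨b', rfl⟩ := hb
    obtain ⟨c4, hc4, k', hk', rfl⟩ := HB.split b'
    have ha2 : a + hm k' ∈ LinearMap.ker vp := by
      rw [LinearMap.mem_ker, map_add, ha, zero_add]; exact hk'
    rw [hv1] at ha2
    obtain ⟨a', ha'⟩ := ha2
    obtain ⟨c3, hc3, k2, hk2, rfl⟩ := HB.split a'
    obtain ⟨r, hr, y, z, hy, hz, rfl⟩ := HB.qsplit k2 hk2
    rw [← LinearMap.mem_ker, hh2] at hz
    obtain ⟨z', rfl⟩ := hz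
    obtain ⟨c2, hc2, k3, hk3, rfl⟩ := HA.split z'
    refine ⟨((⟨c1, hc1⟩, ⟨c2, hc2⟩), ((⟨c3, hc3⟩, ⟨c4, hc4⟩), (⟨q, hq⟩, ⟨r, hr⟩))), ?_⟩
    rw [auxPhi_apply]
    simp only [LinearMap.comp_apply] at hk3
    simp only [map_add, hy, hk3] at ha' ⊢
    have : a = vm c3 + (vm r + (0 + (vm (hp c2) + 0))) - hm k' := by rw [ha']; abel
    rw [this]
    abel

set_option maxHeartbeats 1600000 in
/-- The adapted pseudo-inverse. -/
theorem aux_pseudo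
    (an1 : ∀ x, hm (vp x) = - vm (hp x)) (an2 : ∀ x, hp (vm x) = - vp (hm x))
    (hv1 : LinearMap.ker vp = LinearMap.range vm)
    (hv2 : LinearMap.ker vm = LinearMap.range vp)
    (hh1 : LinearMap.ker hp = LinearMap.range hm)
    (hh2 : LinearMap.ker hm = LinearMap.range hp)
    {CA QA : Submodule F Vp} {CB QB : Submodule F Vm}
    (HA : AuxCompl (vm ∘ₗ hp) vp hp CA QA) (HB : AuxCompl (vp ∘ₗ hm) vm hm CB QB) :
    ∃ g : Vp →ₗ[F] Vm, IsPseudoInverse F vm g ∧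
      ∀ (c1 c2 : CA) (c3 c4 : CB) (q : QA) (r : QB),
        g (((c1 : Vp) + vm (hp c2)) + ((vm c3 + hm c4) + ((q : Vp) + vm r))) =
          hp c2 + (c3 + r) := by
  have bij := auxPhi_bij an1 an2 hv1 hv2 hh1 hh2 HA HB
  have bijB := auxPhi_bij an2 an1 hv2 hv1 hh2 hh1 HB HA
  have v2 : ∀ x, vm (vp x) = 0 := fun x => by
    rw [← LinearMap.mem_ker, hv2]; exact ⟨x, rfl⟩
  let E := LinearEquiv.ofBijective _ bij
  let P : ((CA × CA) × ((CB × CB) × (QA × QB))) →ₗ[F] Vm :=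
    ((0 : CA →ₗ[F] Vm).coprod (hp ∘ₗ CA.subtype)).coprod
      ((CB.subtype.coprod (0 : CB →ₗ[F] Vm)).coprod ((0 : QA →ₗ[F] Vm).coprod QB.subtype))
  have hP : ∀ (c1 c2 : CA) (c3 c4 : CB) (q : QA) (r : QB),
      (P ∘ₗ (E.symm : Vp →ₗ[F] _))
        (((c1 : Vp) + vm (hp c2)) + ((vm c3 + hm c4) + ((q : Vp) + vm r))) =
          hp c2 + (c3 + r) := by
    intro c1 c2 c3 c4 q r
    have : E.symm (((c1 : Vp) + vm (hp c2)) + ((vm c3 + hm c4) + ((q : Vp) + vm r))) =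
        ((c1, c2), ((c3, c4), (q, r))) := by
      rw [LinearEquiv.symm_apply_eq]
      exact (auxPhi_apply vm hm hp CA QA CB QB c1 c2 c3 c4 q r).symm
    rw [LinearMap.comp_apply, LinearEquiv.coe_coe, this]
    simp [P]
  generalize (P ∘ₗ (E.symm : Vp →ₗ[F] _)) = g at hP
  refine ⟨g, ⟨?_, ?_⟩, hP⟩
  · apply LinearMap.ext
    intro y
    obtain ⟨⟨⟨d1, d2⟩, ⟨⟨d3, d4⟩, ⟨q, r⟩⟩⟩, rfl⟩ := bijB.2 y
    rw [auxPhi_apply]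
    have : vm (((d1 : Vm) + vp (hm d2)) + ((vp d3 + hp d4) + ((q : Vm) + vp r))) =
        ((((0 : CA) : Vp) + vm (hp d4)) + ((vm d1 + hm (0 : CB)) + (((0 : QA) : Vp) + vm q))) := by
      simp [v2]; abel
    rw [LinearMap.comp_apply, LinearMap.comp_apply, this, hP]
    simp
  · apply LinearMap.ext
    intro y
    obtain ⟨⟨⟨c1, c2⟩, ⟨⟨c3, c4⟩, ⟨q, r⟩⟩⟩, rfl⟩ := bij.2 y
    rw [auxPhi_apply]
    rw [LinearMap.comp_apply, LinearMap.comp_apply, hP]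
    have : vm (hp c2 + ((c3 : Vm) + r)) =
        ((((0 : CA) : Vp) + vm (hp c2)) + ((vm c3 + hm (0 : CB)) + (((0 : QA) : Vp) + vm r))) := by
      simp
    rw [this, hP]

/-- Transporting the quotient endomorphism to the complement `Q`. -/
theorem aux_transport {A B : Type} [AddCommGroup A] [Module F A] [AddCommGroup B] [Module F B]
    [FiniteDimensional F A]
    (α β : A →ₗ[F] B) (K S Q : Submodule F A) (L : Submodule F B) (w : B →ₗ[F] B)
    (C : Submodule F B)
    (hQK : Q ≤ K) (hQS : ∀ q ∈ Q, q ∈ S → q = 0) (hK : ∀ k ∈ K, ∃ q ∈ Q, k - q ∈ S)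
    (hCi : ∀ c ∈ C, w c = 0 → c = 0) (hCs : ∀ x, ∃ c ∈ C, w x = w c)
    (hα : ∀ x ∈ K, α x ∈ L) (hβ : ∀ x ∈ K, β x ∈ L)
    (xi : (K ⧸ S.comap K.subtype) →ₗ[F] (L ⧸ (LinearMap.range w).comap L.subtype))
    (eta : (K ⧸ S.comap K.subtype) ≃ₗ[F] (L ⧸ (LinearMap.range w).comap L.subtype))
    (hxi : ∀ (x : A) (hx : x ∈ K) (hy : α x ∈ L),
      xi (Submodule.Quotient.mk ⟨x, hx⟩) = Submodule.Quotient.mk ⟨α x, hy⟩)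
    (heta : ∀ (x : A) (hx : x ∈ K) (hy : β x ∈ L),
      eta (Submodule.Quotient.mk ⟨x, hx⟩) = Submodule.Quotient.mk ⟨β x, hy⟩) :
    ∃ (X : Q →ₗ[F] Q) (s : Q →ₗ[F] C), (∀ q : Q, α q = β (X q) + w (s q)) ∧
      LinearMap.det X = LinearMap.det ((eta.symm : _ →ₗ[F] _) ∘ₗ xi) := by
  let j : Q →ₗ[F] (K ⧸ S.comap K.subtype) := (S.comap K.subtype).mkQ ∘ₗ Submodule.inclusion hQK
  have hj : Function.Bijective j := by
    constructor
    · rw [← LinearMap.ker_eq_bot, LinearMap.ker_eq_bot']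
      intro q hq
      have : (Submodule.inclusion hQK q) ∈ S.comap K.subtype :=
        (Submodule.Quotient.mk_eq_zero _).1 hq
      exact Subtype.ext (hQS q q.2 this)
    · intro y
      obtain ⟨⟨k, hk⟩, rfl⟩ := Submodule.Quotient.mk_surjective _ y
      obtain ⟨q, hq, hs⟩ := hK k hk
      refine ⟨⟨q, hq⟩, ?_⟩
      symm
      refine (Submodule.Quotient.eq _).2 ?_
      exact hs
  let e := LinearEquiv.ofBijective j hj
  let Z : (K ⧸ S.comap K.subtype) →ₗ[F] (K ⧸ S.comap K.subtype) := eta.symm.toLinearMap ∘ₗ xi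
  let X : Q →ₗ[F] Q := e.symm.toLinearMap ∘ₗ Z ∘ₗ e.symm.symm.toLinearMap
  have hkerw : LinearMap.ker (w ∘ₗ C.subtype) = ⊥ := by
    rw [LinearMap.ker_eq_bot']
    intro c hc
    exact Subtype.ext (hCi c c.2 hc)
  obtain ⟨G, hG⟩ := LinearMap.exists_leftInverse_of_injective _ hkerw
  refine ⟨X, G ∘ₗ (α ∘ₗ Q.subtype - β ∘ₗ Q.subtype ∘ₗ X), ?_, ?_⟩
  · intro q
    have h1 : eta (e (X q)) = xi (e q) := by
      simp [X, Z]
    have e1 : e q = Submodule.Quotient.mk ⟨q, hQK q.2⟩ := rfl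
    have e2 : e (X q) = Submodule.Quotient.mk ⟨X q, hQK (X q).2⟩ := rfl
    rw [e1, e2, hxi _ _ (hα _ (hQK q.2)), heta _ _ (hβ _ (hQK (X q).2))] at h1
    have h2 := (Submodule.Quotient.eq _).1 h1.symm
    obtain ⟨b, hb⟩ : α q - β (X q) ∈ LinearMap.range w := h2
    obtain ⟨c, hc, hbc⟩ := hCs b
    have h3 : G (w c) = ⟨c, hc⟩ := LinearMap.congr_fun hG ⟨c, hc⟩
    simp only [LinearMap.comp_apply, LinearMap.sub_apply, Submodule.subtype_apply]
    rw [← hb, hbc, h3]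
    simp only
    rw [← hbc, hb]
    abel
  · exact LinearMap.det_conj Z e.symm

/-- For two anticommuting odd exact endomorphisms `v, h` of a finite
dimensional `ℤ₂`-graded vector space `V`, the comparison number `T(h)⁻¹ ∘ T(v)`
of the two torsion isomorphisms equals `det(η₊⁻¹ ξ₊) · det(η₋ ξ₋⁻¹)`, where
`ξ, η : Ker(vh)/(Ker v + Ker h) → (Ker v ∩ Ker h)/Im(vh)` are the odd
isomorphisms induced by `v` and `h`. -/
theorem comparison_number_eq_det_quotients
    [FiniteDimensional F Vp] [FiniteDimensional F Vm]
    (hanti1 : vm ∘ₗ hp + hm ∘ₗ vp = 0) (hanti2 : vp ∘ₗ hm + hp ∘ₗ vm = 0)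
    (hv1 : LinearMap.ker vp = LinearMap.range vm)
    (hv2 : LinearMap.ker vm = LinearMap.range vp)
    (hh1 : LinearMap.ker hp = LinearMap.range hm)
    (hh2 : LinearMap.ker hm = LinearMap.range hp)
    -- pseudo-inverses defining the torsion isomorphisms
    (gv gh : Vp →ₗ[F] Vm)
    (hgv : IsPseudoInverse F vm gv) (hgh : IsPseudoInverse F hm gh)
    (eh : Vp ≃ₗ[F] Vm) (heh : (eh : Vp →ₗ[F] Vm) = hp + gh)
    -- the odd isomorphisms ξ (induced by v) and η (induced by h)
    (xip : Qplus F Vp Vm vp hp vm hm →ₗ[F] Rminus F Vp Vm vp hp vm hm)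
    (hxip : ∀ (x : Vp) (hx : x ∈ LinearMap.ker (vm ∘ₗ hp))
      (hy : vp x ∈ LinearMap.ker vm ⊓ LinearMap.ker hm),
      xip (Submodule.Quotient.mk ⟨x, hx⟩) = Submodule.Quotient.mk ⟨vp x, hy⟩)
    (etapE : Qplus F Vp Vm vp hp vm hm ≃ₗ[F] Rminus F Vp Vm vp hp vm hm)
    (hetap : ∀ (x : Vp) (hx : x ∈ LinearMap.ker (vm ∘ₗ hp))
      (hy : hp x ∈ LinearMap.ker vm ⊓ LinearMap.ker hm),
      etapE (Submodule.Quotient.mk ⟨x, hx⟩) = Submodule.Quotient.mk ⟨hp x, hy⟩)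
    (ximE : Qminus F Vp Vm vp hp vm hm ≃ₗ[F] Rplus F Vp Vm vp hp vm hm)
    (hxim : ∀ (x : Vm) (hx : x ∈ LinearMap.ker (vp ∘ₗ hm))
      (hy : vm x ∈ LinearMap.ker vp ⊓ LinearMap.ker hp),
      ximE (Submodule.Quotient.mk ⟨x, hx⟩) = Submodule.Quotient.mk ⟨vm x, hy⟩)
    (etam : Qminus F Vp Vm vp hp vm hm →ₗ[F] Rplus F Vp Vm vp hp vm hm)
    (hetam : ∀ (x : Vm) (hx : x ∈ LinearMap.ker (vp ∘ₗ hm))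
      (hy : hm x ∈ LinearMap.ker vp ⊓ LinearMap.ker hp),
      etam (Submodule.Quotient.mk ⟨x, hx⟩) = Submodule.Quotient.mk ⟨hm x, hy⟩) :
    LinearMap.det ((eh.symm : Vm →ₗ[F] Vp) ∘ₗ (vp + gv)) =
      LinearMap.det ((etapE.symm : _ →ₗ[F] _) ∘ₗ xip) *
        LinearMap.det (etam ∘ₗ (ximE.symm : _ →ₗ[F] _)) := by
  have an1 : ∀ x, hm (vp x) = - vm (hp x) := fun x =>
    eq_neg_of_add_eq_zero_right (LinearMap.congr_fun hanti1 x)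
  have an2 : ∀ x, hp (vm x) = - vp (hm x) := fun x =>
    eq_neg_of_add_eq_zero_right (LinearMap.congr_fun hanti2 x)
  have an1' : ∀ x, vm (hp x) = - hm (vp x) := fun x => by rw [an1, neg_neg]
  have an2' : ∀ x, vp (hm x) = - hp (vm x) := fun x => by rw [an2, neg_neg]
  have v1 : ∀ x, vp (vm x) = 0 := fun x => by
    rw [← LinearMap.mem_ker, hv1]; exact ⟨x, rfl⟩
  have v2 : ∀ x, vm (vp x) = 0 := fun x => by
    rw [← LinearMap.mem_ker, hv2]; exact ⟨x, rfl⟩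
  have h1 : ∀ x, hp (hm x) = 0 := fun x => by
    rw [← LinearMap.mem_ker, hh1]; exact ⟨x, rfl⟩
  have h2 : ∀ x, hm (hp x) = 0 := fun x => by
    rw [← LinearMap.mem_ker, hh2]; exact ⟨x, rfl⟩
  obtain ⟨CA, QA, HA⟩ := AuxCompl.exists (vm ∘ₗ hp) vp hp
    (fun x hx => by simp [an1', hx]) (fun x hx => by simp [hx])
  obtain ⟨CB, QB, HB⟩ := AuxCompl.exists (vp ∘ₗ hm) vm hm
    (fun x hx => by simp [an2', hx]) (fun x hx => by simp [hx])
  have HA' : AuxCompl (hm ∘ₗ vp) hp vp CA QA := HA.symm (fun x => by simp [an1])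
  have HB' : AuxCompl (hp ∘ₗ vm) hm vm CB QB := HB.symm (fun x => by simp [an2])
  have bij := auxPhi_bij an1 an2 hv1 hv2 hh1 hh2 HA HB
  obtain ⟨gv', hgv', kv⟩ := aux_pseudo an1 an2 hv1 hv2 hh1 hh2 HA HB
  obtain ⟨gh', hgh', kh⟩ := aux_pseudo an1' an2' hh1 hh2 hv1 hv2 HA' HB'
  obtain ⟨X, s, hX, dX⟩ := aux_transport vp hp (LinearMap.ker (vm ∘ₗ hp))
    (LinearMap.ker vp ⊔ LinearMap.ker hp) QA (LinearMap.ker vm ⊓ LinearMap.ker hm) (vp ∘ₗ hm) CB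
    (fun q hq => HA.qker q hq)
    (fun q hq hs => by
      obtain ⟨x, hx, y, hy, rfl⟩ := Submodule.mem_sup.1 hs
      exact HA.qinj _ hq x y hx hy rfl)
    (fun k hk => by
      obtain ⟨q, hq, x, y, hx, hy, rfl⟩ := HA.qsplit k hk
      exact ⟨q, hq, by rw [add_sub_cancel_left]; exact Submodule.add_mem_sup hx hy⟩)
    HB.inj
    (fun x => by
      obtain ⟨c, hc, k, hk, rfl⟩ := HB.split x
      exact ⟨c, hc, by rw [map_add, hk, add_zero]⟩)
    (fun x hx => ⟨v2 x, by
      have : vm (hp x) = 0 := hx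
      change hm (vp x) = 0
      rw [an1, this, neg_zero]⟩)
    (fun x hx => ⟨hx, h2 x⟩) xip etapE hxip hetap
  obtain ⟨Y, t, hY, dY⟩ := aux_transport hm vm (LinearMap.ker (vp ∘ₗ hm))
    (LinearMap.ker vm ⊔ LinearMap.ker hm) QB (LinearMap.ker vp ⊓ LinearMap.ker hp) (vm ∘ₗ hp) CA
    (fun q hq => HB.qker q hq)
    (fun q hq hs => by
      obtain ⟨x, hx, y, hy, rfl⟩ := Submodule.mem_sup.1 hs
      exact HB.qinj _ hq x y hx hy rfl)
    (fun k hk => by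
      obtain ⟨q, hq, x, y, hx, hy, rfl⟩ := HB.qsplit k hk
      exact ⟨q, hq, by rw [add_sub_cancel_left]; exact Submodule.add_mem_sup hx hy⟩)
    HA.inj
    (fun x => by
      obtain ⟨c, hc, k, hk, rfl⟩ := HA.split x
      exact ⟨c, hc, by rw [map_add, hk, add_zero]⟩)
    (fun x hx => ⟨hx, h1 x⟩)
    (fun x hx => ⟨v1 x, by
      have : vp (hm x) = 0 := hx
      change hp (vm x) = 0
      rw [an2, this, neg_zero]⟩) etam ximE hetam hxim
  have dY' : LinearMap.det (etam ∘ₗ (ximE.symm : _ →ₗ[F] _)) = LinearMap.det Y := by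
    rw [dY, ← LinearMap.det_conj _ ximE]
    congr 1
    apply LinearMap.ext
    intro x
    simp
  -- the coordinate endomorphism
  let J1 : (CA × CA) →ₗ[F] (CA × CA) :=
    (LinearMap.snd F CA CA).prod (-LinearMap.fst F CA CA)
  let J2 : (CB × CB) →ₗ[F] (CB × CB) :=
    (-LinearMap.snd F CB CB).prod (LinearMap.fst F CB CB)
  let XY : (QA × QB) →ₗ[F] (QA × QB) := X.prodMap Y
  let U2 : (QA × QB) →ₗ[F] (CB × CB) := LinearMap.inl F CB CB ∘ₗ (-s) ∘ₗ LinearMap.fst F QA QB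
  let T2 : ((CB × CB) × (QA × QB)) →ₗ[F] ((CB × CB) × (QA × QB)) :=
    (J2 ∘ₗ LinearMap.fst F _ _ + U2 ∘ₗ LinearMap.snd F _ _).prod (XY ∘ₗ LinearMap.snd F _ _)
  let U1 : ((CB × CB) × (QA × QB)) →ₗ[F] (CA × CA) :=
    LinearMap.inr F CA CA ∘ₗ t ∘ₗ LinearMap.snd F QA QB ∘ₗ LinearMap.snd F _ _
  let T1 : ((CA × CA) × ((CB × CB) × (QA × QB))) →ₗ[F] ((CA × CA) × ((CB × CB) × (QA × QB))) :=
    (J1 ∘ₗ LinearMap.fst F _ _ + U1 ∘ₗ LinearMap.snd F _ _).prod (T2 ∘ₗ LinearMap.snd F _ _)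
  have dT : LinearMap.det T1 = LinearMap.det X * LinearMap.det Y := by
    rw [aux_det_block T1 J1 U1 T2 (fun x y => rfl), aux_det_block T2 J2 U2 XY (fun x y => rfl),
      aux_det_J J1 (fun x y => rfl), aux_det_J' J2 (fun x y => rfl), one_mul, one_mul,
      LinearMap.det_prodMap]
  let E := LinearEquiv.ofBijective _ bij
  let M : Vp →ₗ[F] Vp := (E : _ →ₗ[F] _) ∘ₗ T1 ∘ₗ (E.symm : _ →ₗ[F] _)
  have dM : LinearMap.det M = LinearMap.det T1 := LinearMap.det_conj T1 E
  have key : vp + gv' = (hp + gh') ∘ₗ M := by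
    apply LinearMap.ext
    intro x
    obtain ⟨⟨⟨c1, c2⟩, ⟨⟨c3, c4⟩, ⟨q, r⟩⟩⟩, rfl⟩ := bij.2 x
    have hM : M (auxPhi vm hm hp CA QA CB QB ((c1, c2), ((c3, c4), (q, r)))) =
        ((c2 : Vp) + hm (vp c1)) + ((hm c3 + vm ((-c4 - s q : CB) : Vm)) +
          ((X q : Vp) + hm r)) := by
      have a1 : E.symm (auxPhi vm hm hp CA QA CB QB ((c1, c2), ((c3, c4), (q, r)))) =
          ((c1, c2), ((c3, c4), (q, r))) := E.symm_apply_apply _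
      have a2 : T1 ((c1, c2), ((c3, c4), (q, r))) =
          ((c2, -c1 + t r), ((-c4 - s q, c3), (X q, Y r))) := by
        simp [T1, T2, J1, J2, U1, U2, XY, sub_eq_add_neg]
      change E (T1 (E.symm _)) = _
      rw [a1, a2]
      change auxPhi vm hm hp CA QA CB QB _ = _
      rw [auxPhi_apply, hY r, an1]
      simp only [LinearMap.comp_apply, Submodule.coe_add, Submodule.coe_neg, map_add, map_neg]
      abel
    rw [LinearMap.comp_apply, hM, LinearMap.add_apply, LinearMap.add_apply, kh, auxPhi_apply, kv]
    have hXq := hX q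
    simp only [LinearMap.comp_apply] at hXq
    simp only [map_add, h1, v1, an2, hXq, Submodule.coe_sub, Submodule.coe_neg, map_sub, map_neg]
    have z1 : hp (hm (vp c1)) = 0 := h1 _
    abel
  rw [aux_indep v2 v1 gv gv' hgv hgv' eh, key, ← LinearMap.comp_assoc, LinearMap.det_comp,
    ← aux_indep h2 h1 gh gh' hgh hgh' eh, ← heh, dM, dT, dY', dX]
  have : (eh.symm : Vm →ₗ[F] Vp) ∘ₗ (eh : Vp →ₗ[F] Vm) = LinearMap.id := by ext; simp
  rw [this, LinearMap.det_id, one_mul]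


end
end

section
/- Consider an odd bitriangle (X, v, h) of Z₂-graded chain complexes whose rows and columns are homotopy exact (with homotopies t for columns, r for rows, and squares anti-commuting up to homotopies s) and which is homotopy exact in the sense that vs + sv + th + ht and hs + sh + rv + vr vanish on homology. Assume the homology H(X) of the bitriangle (the direct sum of the homologies of the three diagonal complexes D₁ = X₃₁⊕X₂₂⊕X₁₃, D₂ = X₁₁⊕X₃₂⊕X₂₃, D₃ = X₂₁⊕X₁₂⊕X₃₃) is finite dimensional. Then the vertical and horizontal torsion isomorphisms T(v), T(h) : det(H_+(X)) → det(H_-(X)) agree. -/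
open Module Submodule

section Bitriangle

variable (F : Type) [Field F]

/-- Homology of a two-periodic pair of differentials. -/
abbrev Hgen {M N : Type} [AddCommGroup M] [Module F M] [AddCommGroup N] [Module F N]
    (d1 : M →ₗ[F] N) (d2 : N →ₗ[F] M) :=
  ↥(LinearMap.ker d1) ⧸ ((LinearMap.range d2).comap (LinearMap.ker d1).subtype)

/-- The class of a cycle in `Hgen`. -/
def mkHgen {M N : Type} [AddCommGroup M] [Module F M] [AddCommGroup N] [Module F N]
    (d1 : M →ₗ[F] N) (d2 : N →ₗ[F] M) (x : M) (hx : d1 x = 0) : Hgen F d1 d2 :=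
  Submodule.Quotient.mk ⟨x, LinearMap.mem_ker.mpr hx⟩

variable (Xp Xm : Fin 3 → Fin 3 → Type)
  [∀ i j, AddCommGroup (Xp i j)] [∀ i j, Module F (Xp i j)]
  [∀ i j, AddCommGroup (Xm i j)] [∀ i j, Module F (Xm i j)]
variable (dp : ∀ i j, Xp i j →ₗ[F] Xm i j) (dm : ∀ i j, Xm i j →ₗ[F] Xp i j)

/-- The even part of the homology of the bitriangle. -/
abbrev P9p := ∀ p : Fin 3 × Fin 3, Hgen F (dp p.1 p.2) (dm p.1 p.2)
/-- The odd part of the homology of the bitriangle. -/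
abbrev P9m := ∀ p : Fin 3 × Fin 3, Hgen F (dm p.1 p.2) (dp p.1 p.2)

/-- Assembly of the vertical induced maps (even part). -/
def alphaVp (vHp : ∀ i j, Hgen F (dp (i + 2) j) (dm (i + 2) j) →ₗ[F]
    Hgen F (dm i j) (dp i j)) : P9p F Xp Xm dp dm →ₗ[F] P9m F Xp Xm dp dm :=
  LinearMap.pi fun p => vHp p.1 p.2 ∘ₗ LinearMap.proj (p.1 + 2, p.2)

/-- Assembly of the vertical induced maps (odd part). -/
def alphaVm (vHm : ∀ i j, Hgen F (dm (i + 2) j) (dp (i + 2) j) →ₗ[F]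
    Hgen F (dp i j) (dm i j)) : P9m F Xp Xm dp dm →ₗ[F] P9p F Xp Xm dp dm :=
  LinearMap.pi fun p => vHm p.1 p.2 ∘ₗ LinearMap.proj (p.1 + 2, p.2)

/-- Assembly of the horizontal induced maps (even part). -/
def alphaHp (hHp : ∀ i j, Hgen F (dp i (j + 2)) (dm i (j + 2)) →ₗ[F]
    Hgen F (dm i j) (dp i j)) : P9p F Xp Xm dp dm →ₗ[F] P9m F Xp Xm dp dm :=
  LinearMap.pi fun p => hHp p.1 p.2 ∘ₗ LinearMap.proj (p.1, p.2 + 2)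

/-- Assembly of the horizontal induced maps (odd part). -/
def alphaHm (hHm : ∀ i j, Hgen F (dm i (j + 2)) (dp i (j + 2)) →ₗ[F]
    Hgen F (dp i j) (dm i j)) : P9m F Xp Xm dp dm →ₗ[F] P9p F Xp Xm dp dm :=
  LinearMap.pi fun p => hHm p.1 p.2 ∘ₗ LinearMap.proj (p.1, p.2 + 2)

/-- The total (ungraded) odd endomorphism built from the two graded parts. -/
def totOdd (f : P9p F Xp Xm dp dm →ₗ[F] P9m F Xp Xm dp dm)
    (g : P9m F Xp Xm dp dm →ₗ[F] P9p F Xp Xm dp dm) :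
    (P9p F Xp Xm dp dm × P9m F Xp Xm dp dm) →ₗ[F]
      (P9p F Xp Xm dp dm × P9m F Xp Xm dp dm) :=
  LinearMap.prod (g ∘ₗ LinearMap.snd F _ _) (f ∘ₗ LinearMap.fst F _ _)

/-- The `k`-th diagonal of the homology of the bitriangle. -/
abbrev Dtot (k : Fin 3) := ∀ p : {p : Fin 3 × Fin 3 // p.1 + p.2 = k},
  (Hgen F (dp p.1.1 p.1.2) (dm p.1.1 p.1.2) × Hgen F (dm p.1.1 p.1.2) (dp p.1.1 p.1.2))

/-! Linear algebra of anticommuting exact odd endomorphisms. -/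

lemma bt_det_nil {K M : Type} [Field K] [AddCommGroup M] [Module K M] [FiniteDimensional K M]
    (f : M →ₗ[K] M) (hf : f ∘ₗ f = 0) : LinearMap.det (LinearMap.id + f) = 1 := by
  have hn : IsNilpotent (-f : Module.End K M) := by
    refine ⟨2, ?_⟩
    rw [neg_sq, pow_two]
    exact hf
  have h1 := hn.charpoly_eq_X_pow_finrank
  have h2 := LinearMap.eval_charpoly (-f : Module.End K M) 1
  rw [h1] at h2
  simp at h2
  rw [← Module.End.one_eq_id, h2]

/-- Independence of the pseudo-inverse. -/
lemma bt_indep {K A B : Type} [Field K] [AddCommGroup A] [Module K A] [FiniteDimensional K A]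
    [AddCommGroup B] [Module K B] [FiniteDimensional K B]
    (vA : A →ₗ[K] B) (vB : B →ₗ[K] A) (g g' : A →ₗ[K] B) (J : A ≃ₗ[K] B)
    (h0 : ∀ x, vB (vA x) = 0) (h0' : ∀ x, vA (vB x) = 0)
    (h1 : ∀ x, vB (g (vB x)) = vB x) (h2 : ∀ x, g (vB (g x)) = g x)
    (h1' : ∀ x, vB (g' (vB x)) = vB x) (h2' : ∀ x, g' (vB (g' x)) = g' x) :
    LinearMap.det ((J.symm : B →ₗ[K] A) ∘ₗ (vA + g')) =
      LinearMap.det ((J.symm : B →ₗ[K] A) ∘ₗ (vA + g)) := by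
  have e : (J.symm : B →ₗ[K] A) ∘ₗ (vA + g') =
      ((J.symm : B →ₗ[K] A) ∘ₗ (LinearMap.id + (g' ∘ₗ vB - g ∘ₗ vB)) ∘ₗ (J : A →ₗ[K] B)) *
      ((J.symm : B →ₗ[K] A) ∘ₗ (vA + g)) * (LinearMap.id + (vB ∘ₗ g' - vB ∘ₗ g)) := by
    ext x
    simp [h0, h0', h1, h2, h1', h2']
  rw [e, map_mul, map_mul, bt_det_nil _ (by ext x; simp [h1, h1', h2, h2'])]
  have := LinearMap.det_conj (LinearMap.id + (g' ∘ₗ vB - g ∘ₗ vB)) J.symm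
  simp only [LinearEquiv.symm_symm] at this
  rw [this, bt_det_nil _ (by ext x; simp [h1, h1', h2, h2'])]
  simp

/-- A degree one automorphism of order three of a graded space has determinant one. -/
lemma bt_det_cyc {K V : Type} [Field K] [AddCommGroup V] [Module K V] [FiniteDimensional K V]
    (ρ : V →ₗ[K] V) (π : Fin 3 → V →ₗ[K] V)
    (h3 : ∀ x, ρ (ρ (ρ x)) = x) (hs : ∀ x, π 0 x + π 1 x + π 2 x = x)
    (hπ : ∀ i x, π i (π i x) = π i x) (hπ' : ∀ i j x, i ≠ j → π i (π j x) = 0)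
    (hρ : ∀ k x, ρ (π (k + 1) x) = π k (ρ x)) : LinearMap.det ρ = 1 := by
  have r0 : ∀ x, π 0 (ρ x) = ρ (π 1 x) := fun x => (hρ 0 x).symm
  have r1 : ∀ x, π 1 (ρ x) = ρ (π 2 x) := fun x => (hρ 1 x).symm
  have r2 : ∀ x, π 2 (ρ x) = ρ (π 0 x) := fun x => (hρ 2 x).symm
  have n01 : ∀ x, π 0 (π 1 x) = 0 := fun x => hπ' 0 1 x (by decide)
  have n02 : ∀ x, π 0 (π 2 x) = 0 := fun x => hπ' 0 2 x (by decide)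
  have n10 : ∀ x, π 1 (π 0 x) = 0 := fun x => hπ' 1 0 x (by decide)
  have n12 : ∀ x, π 1 (π 2 x) = 0 := fun x => hπ' 1 2 x (by decide)
  have n20 : ∀ x, π 2 (π 0 x) = 0 := fun x => hπ' 2 0 x (by decide)
  have n21 : ∀ x, π 2 (π 1 x) = 0 := fun x => hπ' 2 1 x (by decide)
  set τ : V →ₗ[K] V := ρ ∘ₗ π 1 + ρ ∘ₗ ρ ∘ₗ π 0 + π 2 with hτ
  have e1 : τ * τ = 1 := by
    ext x
    simp [hτ, r0, r1, r2, hπ, n01, n02, n10, n12, n20, n21, h3]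
    rw [← hs x]; simp [hπ, n01, n02, n10, n12, n20, n21]
  have e2 : ρ * τ * ρ * ρ * τ = ρ * ρ := by
    ext x
    have hx : ρ (ρ x) = ρ (ρ (π 0 x)) + ρ (ρ (π 1 x)) + ρ (ρ (π 2 x)) := by
      rw [← map_add, ← map_add, ← map_add, ← map_add, hs]
    simp only [Module.End.mul_apply]
    rw [hx]
    simp [hτ, r0, r1, r2, hπ, n01, n02, n10, n12, n20, n21, h3]
    abel
  have d1 := congrArg LinearMap.det e1
  have d2 := congrArg LinearMap.det e2
  have d3 : LinearMap.det (ρ * ρ * ρ) = 1 := by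
    rw [show ρ * ρ * ρ = 1 from by ext x; simp [h3]]; simp
  simp only [map_mul, map_one] at d1 d2 d3
  linear_combination LinearMap.det ρ * d2 - (LinearMap.det ρ) ^ 4 * d1 -
    (LinearMap.det ρ - 1) * d3

/-- The basic data: two anticommuting exact odd endomorphisms. -/
structure BtData (K A B : Type) [Field K] [AddCommGroup A] [Module K A]
    [AddCommGroup B] [Module K B]
    (vA hA : A →ₗ[K] B) (vB hB : B →ₗ[K] A) : Prop where
  vv : ∀ x, vB (vA x) = 0
  hh : ∀ x, hB (hA x) = 0
  vx : ∀ x, vA x = 0 → ∃ y, x = vB y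
  hx : ∀ x, hA x = 0 → ∃ y, x = hB y
  ac : ∀ x, hB (vA x) = - vB (hA x)
  star : ∀ w, vA w = 0 → hA w = 0 → ∃ x y z, w = vB x ∧ w = hB y ∧
    hB x = - vB z ∧ vB y = - hB z

section
variable {K A B : Type} [Field K] [AddCommGroup A] [Module K A]
    [AddCommGroup B] [Module K B] {vA hA : A →ₗ[K] B} {vB hB : B →ₗ[K] A}

/-- Changing the `v`-preimage changes the `h`-image only by the image of `vh`. -/
lemma bt_L (DA : BtData K A B vA hA vB hB) (DB : BtData K B A vB hB vA hA)
    (x x' : A) (h : ∃ z, vA x = vA x' + vA (hB z)) : ∃ z, hA x = hA x' + vA (hB z) := by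
  obtain ⟨z, hz⟩ := h
  obtain ⟨y, hy⟩ := DA.vx (x - x' - hB z) (by simp [hz])
  refine ⟨-y, ?_⟩
  have : x = x' + hB z + vB y := by rw [← hy]; abel
  rw [this]; simp [DB.ac, DB.hh]

/-- Existence of an adapted decomposition. -/
lemma bt_exists (DA : BtData K A B vA hA vB hB) (DB : BtData K B A vB hB vA hA) :
    ∃ (P V : Submodule K A) (ρ : V ≃ₗ[K] V) (pr : B →ₗ[K] V),
      (∀ p ∈ P, vB (hA p) = 0 → p = 0) ∧ (∀ x, ∃ p ∈ P, vB (hA x) = vB (hA p)) ∧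
      (∀ x : V, hA x = vA (ρ x)) ∧
      (∀ x : V, vB (hA x) = 0) ∧
      (∀ x : V, pr (vA x) = x) ∧ (∀ z, pr (vA (hB z)) = 0) ∧
      (∀ w, vB w = 0 → hB w = 0 → ∃ z, w = vA (pr w) + vA (hB z)) := by
  set I : Submodule K B := LinearMap.range (vA ∘ₗ hB) with hI
  set KB : Submodule K B := LinearMap.ker vB ⊓ LinearMap.ker hB with hKB
  set KA : Submodule K A := LinearMap.ker vA ⊓ LinearMap.ker hA with hKA
  obtain ⟨P, hP⟩ := (LinearMap.ker (vB ∘ₗ hA)).exists_isCompl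
  obtain ⟨W', hW'⟩ := I.exists_isCompl
  obtain ⟨C, hC⟩ := KA.exists_isCompl
  have dec : ∀ b, vB b = 0 → hB b = 0 → ∃ w ∈ W' ⊓ KB, ∃ z, b = w + vA (hB z) := by
    intro b h1 h2
    have hb : b ∈ I ⊔ W' := by rw [hW'.sup_eq_top]; trivial
    obtain ⟨i, hi, w, hw, rfl⟩ := Submodule.mem_sup.1 hb
    obtain ⟨z, rfl⟩ := hi
    simp only [LinearMap.comp_apply, map_add] at h1 h2
    refine ⟨w, ⟨hw, ?_, ?_⟩, z, by simp [add_comm]⟩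
    · simpa [DA.vv] using h1
    · simpa [DA.ac, DB.hh] using h2
  have triv : ∀ z, vA (hB z) ∈ W' → vA (hB z) = 0 := fun z hz =>
    Submodule.disjoint_def.1 hW'.disjoint _ ⟨z, rfl⟩ hz
  set W := W' ⊓ KB with hW
  set V : Submodule K A := (W.comap vA ⊓ W.comap hA) ⊓ C with hV
  have mV : ∀ x, vA x ∈ W → hA x ∈ W → ∃ c ∈ V, vA c = vA x ∧ hA c = hA x := by
    intro x h1 h2
    have hb : x ∈ KA ⊔ C := by rw [hC.sup_eq_top]; trivial
    obtain ⟨k, hk, c, hc, rfl⟩ := Submodule.mem_sup.1 hb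
    have k1 : vA k = 0 := hk.1
    have k2 : hA k = 0 := hk.2
    simp only [map_add, k1, k2, zero_add] at h1 h2 ⊢
    exact ⟨c, ⟨⟨h1, h2⟩, hc⟩, rfl, rfl⟩
  have inj0 : ∀ x ∈ V, vA x = 0 → hA x = 0 → x = 0 := fun x hx h1 h2 =>
    Submodule.disjoint_def.1 hC.disjoint _ ⟨h1, h2⟩ hx.2
  let fv : V →ₗ[K] W := vA.restrict (fun x hx => hx.1.1)
  let fh : V →ₗ[K] W := hA.restrict (fun x hx => hx.1.2)
  have bv : Function.Bijective fv := by
    constructor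
    · rw [← LinearMap.ker_eq_bot, LinearMap.ker_eq_bot']
      rintro ⟨x, hx⟩ h
      have h1 : vA x = 0 := congrArg Subtype.val h
      obtain ⟨z, rfl⟩ := DA.vx x h1
      have h2 : hA (vB z) = 0 := by
        have := triv z (by simpa [DB.ac] using hx.1.2.1)
        rw [DB.ac, this, neg_zero]
      exact Subtype.ext (inj0 _ hx h1 h2)
    · rintro ⟨w, hw⟩
      obtain ⟨x, rfl⟩ := DB.vx w hw.2.1
      have q1 : hB (vA x) = 0 := hw.2.2
      obtain ⟨w', hw', z, hz⟩ := dec (hA x) (by simpa [DA.ac] using q1) (DA.hh x)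
      obtain ⟨c, hc, c1, c2⟩ := mV (x + vB z) (by simpa [DB.vv] using hw)
        (by simpa [DB.ac, hz] using hw')
      exact ⟨⟨c, hc⟩, Subtype.ext (c1.trans (by simp [DB.vv]))⟩
  have bh : Function.Bijective fh := by
    constructor
    · rw [← LinearMap.ker_eq_bot, LinearMap.ker_eq_bot']
      rintro ⟨x, hx⟩ h
      have h1 : hA x = 0 := congrArg Subtype.val h
      obtain ⟨z, rfl⟩ := DA.hx x h1
      exact Subtype.ext (inj0 _ hx (triv z hx.1.1.1) h1)
    · rintro ⟨w, hw⟩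
      obtain ⟨x, rfl⟩ := DB.hx w hw.2.2
      have q1 : vB (hA x) = 0 := hw.2.1
      obtain ⟨w', hw', z, hz⟩ := dec (vA x) (DA.vv x) (by simp [DA.ac, q1])
      obtain ⟨c, hc, c1, c2⟩ := mV (x - hB z) (by simpa [hz] using hw')
        (by simpa [DB.hh] using hw)
      exact ⟨⟨c, hc⟩, Subtype.ext (c2.trans (by simp [DB.hh]))⟩
  let eV := LinearEquiv.ofBijective fv bv
  let eH := LinearEquiv.ofBijective fh bh
  obtain ⟨l, hl⟩ := W.subtype.exists_leftInverse_of_injective (by simp)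
  obtain ⟨q, hq1, hq2⟩ : ∃ q : B →ₗ[K] B, (∀ w ∈ W', q w = w) ∧ ∀ i ∈ I, q i = 0 := by
    refine ⟨W'.subtype ∘ₗ W'.projectionOnto I hW'.symm, ?_, ?_⟩
    · intro w hw
      rw [LinearMap.comp_apply, Submodule.projectionOnto_apply_of_mem_left hW'.symm hw]
      rfl
    · intro i hi
      rw [LinearMap.comp_apply, Submodule.projectionOnto_apply_of_mem_right hW'.symm hi]
      simp
  have hl' : ∀ w : W, l w = w := fun w => congrArg (fun f => f w) hl
  have evs : ∀ w : W, vA (eV.symm w) = w := fun w =>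
    congrArg Subtype.val (eV.apply_symm_apply w)
  refine ⟨P, V, eH.trans eV.symm, eV.symm.toLinearMap ∘ₗ l ∘ₗ q, ?_, ?_, ?_, ?_, ?_, ?_, ?_⟩
  · intro p hp h
    exact Submodule.disjoint_def.1 hP.disjoint p h hp
  · intro x
    have hb : x ∈ LinearMap.ker (vB ∘ₗ hA) ⊔ P := by rw [hP.sup_eq_top]; trivial
    obtain ⟨k, hk, c, hc, rfl⟩ := Submodule.mem_sup.1 hb
    have hk' : vB (hA k) = 0 := hk
    exact ⟨c, hc, by simp [hk']⟩
  · intro x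
    exact (evs (eH x)).symm
  · rintro ⟨x, hx⟩
    exact hx.1.2.2.1
  · intro x
    have h1 : q (vA x) = ((eV x : W) : B) := hq1 _ x.2.1.1.1
    simp [h1, hl']
  · intro z
    have h1 : q (vA (hB z)) = 0 := hq2 _ ⟨z, rfl⟩
    simp [h1]
  · intro w h1 h2
    obtain ⟨u, hu, z, rfl⟩ := dec w h1 h2
    refine ⟨z, ?_⟩
    have e1 : q (vA (hB z)) = 0 := hq2 _ ⟨z, rfl⟩
    have e2 : q u = ((⟨u, hu⟩ : W) : B) := hq1 _ hu.1
    have e3 : l u = ⟨u, hu⟩ := hl' ⟨u, hu⟩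
    simp only [LinearMap.comp_apply, map_add, e1, e2, e3, map_zero, add_zero]
    rw [LinearEquiv.coe_coe, evs]
end

section
variable {K A B : Type} [Field K] [AddCommGroup A] [Module K A]
    [AddCommGroup B] [Module K B] {vA hA : A →ₗ[K] B} {vB hB : B →ₗ[K] A}

/-- The graded structure forces the monodromy to have determinant one. -/
lemma bt_rho_det [FiniteDimensional K A]
    (DA : BtData K A B vA hA vB hB) (DB : BtData K B A vB hB vA hA)
    (πA : Fin 3 → A →ₗ[K] A) (πB : Fin 3 → B →ₗ[K] B)
    (hs : ∀ x, πB 0 x + πB 1 x + πB 2 x = x)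
    (hπ : ∀ i x, πB i (πB i x) = πB i x) (hπ' : ∀ i j x, i ≠ j → πB i (πB j x) = 0)
    (hvA : ∀ k x, vA (πA k x) = πB (k + 1) (vA x))
    (hvB : ∀ k x, vB (πB k x) = πA (k + 1) (vB x))
    (hhA : ∀ k x, hA (πA k x) = πB k (hA x))
    (hhB : ∀ k x, hB (πB k x) = πA k (hB x))
    (V : Submodule K A) (ρ : V ≃ₗ[K] V) (pr : B →ₗ[K] V)
    (e1 : ∀ x : V, hA x = vA (ρ x)) (e2 : ∀ x : V, vB (hA x) = 0)
    (e3 : ∀ x : V, pr (vA x) = x) (e4 : ∀ z, pr (vA (hB z)) = 0)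
    (e5 : ∀ w, vB w = 0 → hB w = 0 → ∃ z, w = vA (pr w) + vA (hB z)) :
    LinearMap.det (ρ : V →ₗ[K] V) = 1 := by
  have hvh : ∀ k z, πB k (vA (hB z)) = vA (hB (πB (k + 2) z)) := by
    intro k z
    rw [hhB, hvA]
    congr 2
    revert k; decide
  have key : ∀ k (x : V), ∃ z, vA (pr (πB k (vA x))) = πB k (vA x) + vA (hB z) := by
    intro k x
    obtain ⟨z, hz⟩ := e5 (πB k (vA x)) (by rw [hvB, DA.vv, map_zero])
      (by rw [hhB, DA.ac, e2, neg_zero, map_zero])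
    exact ⟨-z, by rw [eq_comm, map_neg, map_neg, ← sub_eq_add_neg, sub_eq_iff_eq_add]; exact hz⟩
  refine bt_det_cyc (ρ : V →ₗ[K] V) (fun k => pr ∘ₗ πB k ∘ₗ vA ∘ₗ V.subtype) ?_ ?_ ?_ ?_ ?_
  · intro x
    obtain ⟨x1, y, z, h1, h2, h3, h4⟩ := DB.star (vA x) (DA.vv x)
      (by rw [DA.ac, e2, neg_zero])
    obtain ⟨z1, hz1⟩ := bt_L DA DB x x1 ⟨0, by simp [← h1]⟩
    obtain ⟨z2, hz2⟩ := bt_L DA DB (ρ x) (-z) ⟨z1, by rw [← e1, hz1, h3, map_neg]⟩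
    obtain ⟨z3, hz3⟩ := bt_L DA DB (ρ (ρ x)) y ⟨z2, by rw [← e1, hz2, map_neg, h4]⟩
    rw [← h2, e1] at hz3
    have := congrArg pr hz3
    rw [map_add, e3, e3, e4, add_zero] at this
    exact this
  · intro x
    simp only [LinearMap.comp_apply, ← map_add, hs]
    exact e3 x
  · intro k x
    obtain ⟨z, hz⟩ := key k x
    simp only [LinearMap.comp_apply, Submodule.subtype_apply, hz, map_add, hπ, hvh, e4, add_zero]
  · intro j k x hjk
    obtain ⟨z, hz⟩ := key k x
    simp only [LinearMap.comp_apply, Submodule.subtype_apply, hz, map_add, hπ' _ _ _ hjk, hvh, e4,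
      add_zero, map_zero]
  · intro k x
    obtain ⟨z, hz⟩ := key (k + 1) x
    obtain ⟨z1, hz1⟩ := bt_L DA DB (pr (πB (k + 1) (vA x))) (πA k x) ⟨z, by rw [hz, hvA]⟩
    rw [e1, hhA, e1] at hz1
    have := congrArg pr hz1
    rw [map_add, e3, e4, add_zero] at this
    exact this

/-- The parametrization of the even part. -/
def btTheta (hA : A →ₗ[K] B) (vB hB : B →ₗ[K] A) (P V : Submodule K A)
    (Q U : Submodule K B) :
    ((P × P) × (Q × Q) × (V × U)) →ₗ[K] A where
  toFun s := s.1.1 + vB (hA s.1.2) + vB s.2.1.1 + hB s.2.1.2 + s.2.2.1 + vB s.2.2.2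
  map_add' := by intro s t; simp; abel
  map_smul' := by intro c s; simp

lemma btTheta_bij (DA : BtData K A B vA hA vB hB) (DB : BtData K B A vB hB vA hA)
    (P V : Submodule K A) (Q U : Submodule K B) (pr : B →ₗ[K] V) (qr : A →ₗ[K] U)
    (p1 : ∀ p ∈ P, vB (hA p) = 0 → p = 0) (p2 : ∀ x, ∃ p ∈ P, vB (hA x) = vB (hA p))
    (q1 : ∀ p ∈ Q, vA (hB p) = 0 → p = 0) (q2 : ∀ x, ∃ p ∈ Q, vA (hB x) = vA (hB p))
    (e2 : ∀ x : V, vB (hA x) = 0)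
    (e3 : ∀ x : V, pr (vA x) = x) (e4 : ∀ z, pr (vA (hB z)) = 0)
    (e5 : ∀ w, vB w = 0 → hB w = 0 → ∃ z, w = vA (pr w) + vA (hB z))
    (f2 : ∀ x : U, vA (hB x) = 0)
    (f3 : ∀ x : U, qr (vB x) = x) (f4 : ∀ z, qr (vB (hA z)) = 0)
    (f5 : ∀ w, vA w = 0 → hA w = 0 → ∃ z, w = vB (qr w) + vB (hA z)) :
    Function.Bijective (btTheta hA vB hB P V Q U) := by
  constructor
  · rw [← LinearMap.ker_eq_bot, LinearMap.ker_eq_bot']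
    rintro ⟨⟨p, p'⟩, ⟨q, q'⟩, ⟨x, y⟩⟩ h
    replace h : (p : A) + vB (hA p') + vB q + hB q' + x + vB y = 0 := h
    have hp : p = 0 := by
      have := congrArg (fun u => vB (hA u)) h
      simp [DB.ac, DB.hh, DA.vv, e2] at this
      exact Subtype.ext (p1 _ p.2 this)
    subst hp
    have h1 := congrArg vA h
    simp [DB.vv] at h1
    have hx : x = 0 := by
      have := congrArg pr h1
      simpa [e3, e4] using this
    subst hx
    have hq' : q' = 0 := Subtype.ext (q1 _ q'.2 (by simpa using h1))
    subst hq'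
    have hq : q = 0 := by
      have := congrArg hA h
      simp [DB.ac, f2, DA.hh, DB.vv] at this
      exact Subtype.ext (q1 _ q.2 this)
    subst hq
    have hy : y = 0 := by
      have := congrArg qr h
      simpa [f3, f4] using this
    subst hy
    have hp' : p' = 0 := Subtype.ext (p1 _ p'.2 (by simpa using h))
    subst hp'
    rfl
  · intro u
    obtain ⟨p, hp, hp1⟩ := p2 u
    obtain ⟨z, hz⟩ := e5 (vA (u - p)) (DA.vv _) (by rw [DA.ac]; simp [hp1])
    obtain ⟨q', hq', hq'1⟩ := q2 z
    set x := pr (vA (u - p)) with hx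
    obtain ⟨y0, hy0⟩ := DA.vx (u - p - x - hB q') (by
      rw [map_sub, map_sub, hz, hq'1]; abel)
    obtain ⟨q, hq, hq1⟩ := q2 y0
    obtain ⟨z1, hz1⟩ := f5 (vB y0 - vB q) (by simp [DB.vv]) (by simp [DB.ac, hq1])
    obtain ⟨p', hp', hp'1⟩ := p2 z1
    refine ⟨⟨⟨⟨p, hp⟩, ⟨p', hp'⟩⟩, ⟨⟨q, hq⟩, ⟨q', hq'⟩⟩, ⟨x, qr (vB y0 - vB q)⟩⟩, ?_⟩
    change p + vB (hA p') + vB q + hB q' + x + vB (qr (vB y0 - vB q)) = u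
    rw [← hp'1]
    have : u = vB y0 + p + x + hB q' := by rw [← hy0]; abel
    rw [this]
    have : vB y0 = vB (qr (vB y0 - vB q)) + vB (hA z1) + vB q := by
      rw [← hz1]; abel
    nth_rw 2 [this]
    abel

end

lemma bt_det_rot (K P : Type) [Field K] [AddCommGroup P] [Module K P] [FiniteDimensional K P]
    (R : (P × P) →ₗ[K] (P × P)) (hR : ∀ a b, R (a, b) = (-b, a)) : LinearMap.det R = 1 := by
  let n1 : (P × P) →ₗ[K] (P × P) := LinearMap.prod (-LinearMap.snd K P P) 0
  let n2 : (P × P) →ₗ[K] (P × P) := LinearMap.prod 0 (LinearMap.fst K P P)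
  have e : R = (LinearMap.id + n1) * (LinearMap.id + n2) * (LinearMap.id + n1) := by
    apply LinearMap.ext
    rintro ⟨a, b⟩
    rw [hR]
    simp [n1, n2]
  have d1 : LinearMap.det (LinearMap.id + n1) = 1 :=
    bt_det_nil n1 (LinearMap.ext fun x => by simp [n1])
  have d2 : LinearMap.det (LinearMap.id + n2) = 1 :=
    bt_det_nil n2 (LinearMap.ext fun x => by simp [n2])
  rw [e, map_mul, map_mul, d1, d2]; simp

lemma bt_det_symm (K P : Type) [Field K] [AddCommGroup P] [Module K P]
    (e : P ≃ₗ[K] P) (h : LinearMap.det (e : P →ₗ[K] P) = 1) :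
    LinearMap.det (e.symm : P →ₗ[K] P) = 1 := by
  have : LinearMap.det ((e.symm : P →ₗ[K] P) * (e : P →ₗ[K] P)) = 1 := by
    rw [show (e.symm : P →ₗ[K] P) * (e : P →ₗ[K] P) = 1 from by ext x; simp]
    simp
  rw [map_mul, h, mul_one] at this
  exact this

/-- The comparison of torsions for two anticommuting exact odd endomorphisms. -/
lemma bt_main {K A B : Type} [Field K] [AddCommGroup A] [Module K A]
    [AddCommGroup B] [Module K B] {vA hA : A →ₗ[K] B} {vB hB : B →ₗ[K] A}
    [FiniteDimensional K A] [FiniteDimensional K B]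
    (DA : BtData K A B vA hA vB hB) (DB : BtData K B A vB hB vA hA)
    (πA : Fin 3 → A →ₗ[K] A) (πB : Fin 3 → B →ₗ[K] B)
    (hsA : ∀ x, πA 0 x + πA 1 x + πA 2 x = x)
    (hπA : ∀ i x, πA i (πA i x) = πA i x) (hπA' : ∀ i j x, i ≠ j → πA i (πA j x) = 0)
    (hs : ∀ x, πB 0 x + πB 1 x + πB 2 x = x)
    (hπ : ∀ i x, πB i (πB i x) = πB i x) (hπ' : ∀ i j x, i ≠ j → πB i (πB j x) = 0)
    (hvA : ∀ k x, vA (πA k x) = πB (k + 1) (vA x))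
    (hvB : ∀ k x, vB (πB k x) = πA (k + 1) (vB x))
    (hhA : ∀ k x, hA (πA k x) = πB k (hA x))
    (hhB : ∀ k x, hB (πB k x) = πA k (hB x))
    (gv gh : A →ₗ[K] B)
    (gv1 : ∀ x, vB (gv (vB x)) = vB x) (gv2 : ∀ x, gv (vB (gv x)) = gv x)
    (gh1 : ∀ x, hB (gh (hB x)) = hB x) (gh2 : ∀ x, gh (hB (gh x)) = gh x)
    (eh : A ≃ₗ[K] B) (heh : (eh : A →ₗ[K] B) = hA + gh) :
    LinearMap.det ((eh.symm : B →ₗ[K] A) ∘ₗ (vA + gv)) = 1 := by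
  obtain ⟨P, V, ρ, pr, p1, p2, e1, e2, e3, e4, e5⟩ := bt_exists DA DB
  obtain ⟨Q, U, σ, qr, q1, q2, f1, f2, f3, f4, f5⟩ := bt_exists DB DA
  have dρ := bt_rho_det DA DB πA πB hs hπ hπ' hvA hvB hhA hhB V ρ pr e1 e2 e3 e4 e5
  have dσ := bt_det_symm _ _ σ
    (bt_rho_det DB DA πB πA hsA hπA hπA' hvB hvA hhB hhA U σ qr f1 f2 f3 f4 f5)
  let Θ := LinearEquiv.ofBijective _
    (btTheta_bij DA DB P V Q U pr qr p1 p2 q1 q2 e2 e3 e4 e5 f2 f3 f4 f5)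
  let Θ1 := LinearEquiv.ofBijective _
    (btTheta_bij DB DA Q U P V qr pr q1 q2 p1 p2 f2 f3 f4 f5 e2 e3 e4 e5)
  let sw : ((P × P) × (Q × Q) × (V × U)) ≃ₗ[K] ((Q × Q) × (P × P) × (U × V)) :=
    { toFun := fun s => (s.2.1, s.1, (s.2.2.2, s.2.2.1))
      invFun := fun s => (s.2.1, s.1, (s.2.2.2, s.2.2.1))
      map_add' := fun _ _ => rfl
      map_smul' := fun _ _ => rfl
      left_inv := fun _ => rfl
      right_inv := fun _ => rfl }
  let Θ' := sw.trans Θ1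
  have hΘ : ∀ p p' q q' x y, Θ ((p, p'), (q, q'), (x, y)) =
    (p : A) + vB (hA p') + vB q + hB q' + x + vB y := fun _ _ _ _ _ _ => rfl
  have hΘ' : ∀ p p' q q' x y, Θ' ((p, p'), (q, q'), (x, y)) =
    (q : B) + vA (hB q') + vA p + hA p' + y + vA x := fun _ _ _ _ _ _ => rfl
  let J : A ≃ₗ[K] B := Θ.symm.trans Θ'
  have hJ : ∀ s, J (Θ s) = Θ' s := fun s => by simp [J]
  let R1 : (P × P) →ₗ[K] (P × P) := LinearMap.prod (-LinearMap.snd K P P) (LinearMap.fst K P P)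
  let R2 : (Q × Q) →ₗ[K] (Q × Q) := LinearMap.prod (LinearMap.snd K Q Q) (-LinearMap.fst K Q Q)
  let R := LinearMap.prodMap R1 (LinearMap.prodMap R2
    (LinearMap.prodMap (ρ : V →ₗ[K] V) (σ.symm : U →ₗ[K] U)))
  have hR : ∀ p p' q q' x y, R ((p, p'), (q, q'), (x, y)) =
    ((-p', p), (q', -q), (ρ x, σ.symm y)) := fun _ _ _ _ _ _ => rfl
  have dR1 : LinearMap.det R1 = 1 := bt_det_rot K P R1 fun _ _ => rfl
  have dR2 : LinearMap.det R2 = 1 := by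
    have e : LinearMap.det (R2 * LinearMap.prod (-LinearMap.snd K Q Q) (LinearMap.fst K Q Q)) = 1 := by
      rw [show R2 * LinearMap.prod (-LinearMap.snd K Q Q) (LinearMap.fst K Q Q) = 1 from
        LinearMap.ext fun x => by simp [R2]]
      simp
    rwa [map_mul, bt_det_rot K Q (LinearMap.prod (-LinearMap.snd K Q Q) (LinearMap.fst K Q Q))
      (fun _ _ => rfl), mul_one] at e
  have dR : LinearMap.det R = 1 := by
    simp only [R, LinearMap.det_prodMap, dR1, dR2, dρ, dσ, mul_one]
  -- vertical
  let gv0 : A →ₗ[K] B := (J : A →ₗ[K] B) - vA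
  have hgv0 : ∀ p p' q q' x y, gv0 (Θ ((p, p'), (q, q'), (x, y))) = (q : B) + hA p' + y := by
    intro p p' q q' x y
    have : gv0 (Θ ((p, p'), (q, q'), (x, y))) = Θ' ((p, p'), (q, q'), (x, y)) -
      vA (Θ ((p, p'), (q, q'), (x, y))) := by
      simp only [gv0, LinearMap.sub_apply, LinearEquiv.coe_coe, hJ]
    rw [this, hΘ, hΘ']
    simp only [map_add, DB.vv]
    abel
  have v1 : ∀ (q : Q) (p' : P) (y : U), vB ((q : B) + hA p' + y) =
      Θ ((0, p'), (q, 0), (0, y)) := by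
    intro q p' y
    simp [hΘ]; abel
  have sA : ∀ a, ∃ p p' q q' x y, a = Θ ((p, p'), (q, q'), (x, y)) := by
    intro a
    obtain ⟨⟨⟨p, p'⟩, ⟨q, q'⟩, ⟨x, y⟩⟩, h⟩ := Θ.surjective a
    exact ⟨p, p', q, q', x, y, h.symm⟩
  have sB : ∀ a, ∃ p p' q q' x y, a = Θ' ((p, p'), (q, q'), (x, y)) := by
    intro a
    obtain ⟨⟨⟨p, p'⟩, ⟨q, q'⟩, ⟨x, y⟩⟩, h⟩ := Θ'.surjective a
    exact ⟨p, p', q, q', x, y, h.symm⟩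
  have dv : LinearMap.det ((J.symm : B →ₗ[K] A) ∘ₗ (vA + gv)) = 1 := by
    rw [bt_indep vA vB gv0 gv J DA.vv DB.vv ?_ ?_ gv1 gv2]
    · rw [show (J.symm : B →ₗ[K] A) ∘ₗ (vA + gv0) = LinearMap.id from
        LinearMap.ext fun x => by simp [gv0]]
      simp
    · intro b
      obtain ⟨p, p', q, q', x, y, rfl⟩ := sB b
      have : vB (Θ' ((p, p'), (q, q'), (x, y))) = vB ((q : B) + hA p' + y) := by
        simp [hΘ', DA.vv]
      rw [this, v1, hgv0, v1]
    · intro a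
      obtain ⟨p, p', q, q', x, y, rfl⟩ := sA a
      rw [hgv0, v1, hgv0]
  -- horizontal
  let gh0 : A →ₗ[K] B := (Θ' : _ →ₗ[K] B) ∘ₗ R ∘ₗ (Θ.symm : A →ₗ[K] _) - hA
  have hgh0 : ∀ p p' q q' x y, gh0 (Θ ((p, p'), (q, q'), (x, y))) =
      (q' : B) - vA p' + σ.symm y := by
    intro p p' q q' x y
    have : gh0 (Θ ((p, p'), (q, q'), (x, y))) = Θ' (R ((p, p'), (q, q'), (x, y))) -
      hA (Θ ((p, p'), (q, q'), (x, y))) := by simp [gh0]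
    rw [this, hR, hΘ, hΘ']
    simp [DB.ac, DB.hh, DA.hh, f2, e1]
    abel
  have h1 : ∀ (q : Q) (p : P) (y : U), hB ((q : B) - vA p + σ.symm y) =
      Θ ((0, p), (0, q), (0, y)) := by
    intro q p y
    simp [hΘ, DA.ac, f1]; abel
  have dh : LinearMap.det ((J.symm : B →ₗ[K] A) ∘ₗ (hA + gh)) = 1 := by
    rw [bt_indep hA hB gh0 gh J DA.hh DB.hh ?_ ?_ gh1 gh2]
    · rw [show (J.symm : B →ₗ[K] A) ∘ₗ (hA + gh0) =
        (Θ : _ →ₗ[K] A) ∘ₗ R ∘ₗ (Θ.symm : A →ₗ[K] _) from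
        LinearMap.ext fun x => by simp [gh0, J]]
      rw [LinearMap.det_conj, dR]
    · intro b
      obtain ⟨p, p', q, q', x, y, rfl⟩ := sB b
      have : hB (Θ' ((p, p'), (q, q'), (x, y))) =
          hB ((q : B) - vA ((-p : P) : A) + σ.symm (σ y)) := by
        simp [hΘ', DA.ac, DB.hh, DA.hh, e2]
      rw [this, h1, hgh0, h1]
    · intro a
      obtain ⟨p, p', q, q', x, y, rfl⟩ := sA a
      rw [hgh0, h1, hgh0]
  have e : (J.symm : B →ₗ[K] A) ∘ₗ (vA + gv) = ((J.symm : B →ₗ[K] A) ∘ₗ (hA + gh)) *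
      ((eh.symm : B →ₗ[K] A) ∘ₗ (vA + gv)) := by
    rw [← heh]; ext x; simp
  rw [e, map_mul, dh, one_mul] at dv
  exact dv

/-- One half of the chain level data of a homotopy exact odd bitriangle (total form). -/
structure BtChain (K A B : Type) [Field K] [AddCommGroup A] [Module K A]
    [AddCommGroup B] [Module K B]
    (dA vA hA sA tA rA : A →ₗ[K] B) (dB vB hB sB tB rB : B →ₗ[K] A) : Prop where
  dv : ∀ x, dB (vA x) + vB (dA x) = 0
  dh : ∀ x, dB (hA x) + hB (dA x) = 0
  ds : ∀ x, dB (sA x) + sB (dA x) = hB (vA x) + vB (hA x)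
  dt : ∀ x, dB (tA x) + tB (dA x) = vB (vA x)
  dr : ∀ x, dB (rA x) + rB (dA x) = hB (hA x)
  ct : ∀ x, dA x = 0 → ∃ y, vB (tA x) + tB (vA x) - x = dB y
  cr : ∀ x, dA x = 0 → ∃ y, hB (rA x) + rB (hA x) - x = dB y
  b1 : ∀ x, dA x = 0 → ∃ y, vB (sA x) + sB (vA x) + tB (hA x) + hB (tA x) = dB y
  b2 : ∀ x, dA x = 0 → ∃ y, hB (sA x) + sB (hA x) + rB (vA x) + vB (rA x) = dB y

lemma bt_chain {K A B HA HB : Type} [Field K] [AddCommGroup A] [Module K A]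
    [AddCommGroup B] [Module K B] [AddCommGroup HA] [Module K HA]
    [AddCommGroup HB] [Module K HB]
    {dA vA hA sA tA rA : A →ₗ[K] B} {dB vB hB sB tB rB : B →ₗ[K] A}
    (C : BtChain K A B dA vA hA sA tA rA dB vB hB sB tB rB)
    (cA : ∀ x, dA x = 0 → HA) (cB : ∀ x, dB x = 0 → HB)
    (surA : ∀ w, ∃ x hx, w = cA x hx)
    (eqA : ∀ x y hx hy, (∃ b, x - y = dB b) → cA x hx = cA y hy)
    (negA : ∀ x hx, cA (-x) (by rw [map_neg, hx, neg_zero]) = - cA x hx)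
    (zeroA : cA 0 (map_zero _) = 0)
    (eqB : ∀ x hx, cB x hx = 0 → ∃ b, x = dA b)
    {vHA hHA : HA →ₗ[K] HB} {vHB hHB : HB →ₗ[K] HA}
    (hvA : ∀ x hx hy, vHA (cA x hx) = cB (vA x) hy)
    (hhA : ∀ x hx hy, hHA (cA x hx) = cB (hA x) hy)
    (hvB : ∀ x hx hy, vHB (cB x hx) = cA (vB x) hy)
    (hhB : ∀ x hx hy, hHB (cB x hx) = cA (hB x) hy)
    (dvB : ∀ x, dA (vB x) + vA (dB x) = 0) (dhB : ∀ x, dA (hB x) + hA (dB x) = 0) :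
    BtData K HA HB vHA hHA vHB hHB := by
  have zvA : ∀ x, dA x = 0 → dB (vA x) = 0 := fun x hx => by
    have := C.dv x; rwa [hx, map_zero, add_zero] at this
  have zhA : ∀ x, dA x = 0 → dB (hA x) = 0 := fun x hx => by
    have := C.dh x; rwa [hx, map_zero, add_zero] at this
  have zvB : ∀ x, dB x = 0 → dA (vB x) = 0 := fun x hx => by
    have := dvB x; rwa [hx, map_zero, add_zero] at this
  have zhB : ∀ x, dB x = 0 → dA (hB x) = 0 := fun x hx => by
    have := dhB x; rwa [hx, map_zero, add_zero] at this
  have boundA : ∀ x hx, (∃ b, x = dB b) → cA x hx = 0 := by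
    intro x hx ⟨b, hb⟩
    rw [← zeroA]
    exact eqA _ _ _ _ ⟨b, by rw [sub_zero, hb]⟩
  have cyc1 : ∀ w a, dA w = 0 → vA w = dA a → dB (tA w + vA a) = 0 := by
    intro w a hw ha
    have h1 := C.dt w
    have h2 := C.dv a
    rw [hw, map_zero, add_zero, ha] at h1
    rw [map_add, h1, add_comm, h2]
  have cyc2 : ∀ w b, dA w = 0 → hA w = dA b → dB (rA w + hA b) = 0 := by
    intro w b hw hb
    have h1 := C.dr w
    have h2 := C.dh b
    rw [hw, map_zero, add_zero, hb] at h1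
    rw [map_add, h1, add_comm, h2]
  have bd1 : ∀ w a, dA w = 0 → vA w = dA a → ∃ y, w - vB (tA w + vA a) = dB y := by
    intro w a hw ha
    obtain ⟨y, hy⟩ := C.ct w hw
    have h1 := C.dt a
    rw [ha] at hy
    refine ⟨-y - tA a, ?_⟩
    rw [map_sub, map_neg, ← hy, map_add, ← h1]
    abel
  have bd2 : ∀ w b, dA w = 0 → hA w = dA b → ∃ y, w - hB (rA w + hA b) = dB y := by
    intro w a hw ha
    obtain ⟨y, hy⟩ := C.cr w hw
    have h1 := C.dr a
    rw [ha] at hy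
    refine ⟨-y - rA a, ?_⟩
    rw [map_sub, map_neg, ← hy, map_add, ← h1]
    abel
  refine ⟨?_, ?_, ?_, ?_, ?_, ?_⟩
  · intro w
    obtain ⟨x, hx, rfl⟩ := surA w
    rw [hvA x hx (zvA x hx), hvB _ _ (zvB _ (zvA x hx))]
    exact boundA _ _ ⟨tA x, by rw [← C.dt, hx, map_zero, add_zero]⟩
  · intro w
    obtain ⟨x, hx, rfl⟩ := surA w
    rw [hhA x hx (zhA x hx), hhB _ _ (zhB _ (zhA x hx))]
    exact boundA _ _ ⟨rA x, by rw [← C.dr, hx, map_zero, add_zero]⟩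
  · intro w h
    obtain ⟨x, hx, rfl⟩ := surA w
    rw [hvA x hx (zvA x hx)] at h
    obtain ⟨a, ha⟩ := eqB _ _ h
    refine ⟨cB (tA x + vA a) (cyc1 x a hx ha), ?_⟩
    rw [hvB _ _ (zvB _ (cyc1 x a hx ha))]
    exact eqA _ _ _ _ (bd1 x a hx ha)
  · intro w h
    obtain ⟨x, hx, rfl⟩ := surA w
    rw [hhA x hx (zhA x hx)] at h
    obtain ⟨a, ha⟩ := eqB _ _ h
    refine ⟨cB (rA x + hA a) (cyc2 x a hx ha), ?_⟩
    rw [hhB _ _ (zhB _ (cyc2 x a hx ha))]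
    exact eqA _ _ _ _ (bd2 x a hx ha)
  · intro w
    obtain ⟨x, hx, rfl⟩ := surA w
    rw [hvA x hx (zvA x hx), hhB _ _ (zhB _ (zvA x hx)), hhA x hx (zhA x hx),
      hvB _ _ (zvB _ (zhA x hx)), ← negA]
    refine eqA _ _ _ _ ⟨sA x, ?_⟩
    have := C.ds x
    rw [hx, map_zero, add_zero] at this
    rw [this]; abel
  · intro w h1 h2
    obtain ⟨x, hx, rfl⟩ := surA w
    rw [hvA x hx (zvA x hx)] at h1
    rw [hhA x hx (zhA x hx)] at h2
    obtain ⟨a, ha⟩ := eqB _ _ h1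
    obtain ⟨b, hb⟩ := eqB _ _ h2
    have hz : dB (sA x + hA a + vA b) = 0 := by
      have e1 := C.ds x
      rw [hx, map_zero, add_zero, ha, hb] at e1
      rw [map_add, map_add, e1]
      have e2 := C.dh a
      have e3 := C.dv b
      have e4 : hB (dA a) + vB (dA b) + dB (hA a) + dB (vA b) =
        (dB (hA a) + hB (dA a)) + (dB (vA b) + vB (dA b)) := by abel
      rw [e4, e2, e3, add_zero]
    have x1 := cyc1 x a hx ha
    have y1 := cyc2 x b hx hb
    refine ⟨cB _ x1, cB _ y1, cB _ hz, ?_, ?_, ?_, ?_⟩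
    · rw [hvB _ _ (zvB _ x1)]
      exact eqA _ _ _ _ (bd1 x a hx ha)
    · rw [hhB _ _ (zhB _ y1)]
      exact eqA _ _ _ _ (bd2 x b hx hb)
    · rw [hhB _ _ (zhB _ x1), hvB _ _ (zvB _ hz), ← negA]
      refine eqA _ _ _ _ ?_
      obtain ⟨y, hy⟩ := C.b1 x hx
      refine ⟨y + sA a + tA b, ?_⟩
      have e1 := C.ds a
      have e2 := C.dt b
      rw [ha, hb] at hy
      rw [map_add dB, map_add dB, ← hy, sub_neg_eq_add]
      simp only [map_add]
      rw [← e2, show hB (tA x) + hB (vA a) + (vB (sA x) + vB (hA a) + (dB (tA b) + tB (dA b))) =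
        hB (tA x) + (hB (vA a) + vB (hA a)) + (vB (sA x) + (dB (tA b) + tB (dA b))) by abel, ← e1]
      abel
    · rw [hvB _ _ (zvB _ y1), hhB _ _ (zhB _ hz), ← negA]
      refine eqA _ _ _ _ ?_
      obtain ⟨y, hy⟩ := C.b2 x hx
      refine ⟨y + sA b + rA a, ?_⟩
      have e1 := C.ds b
      have e2 := C.dr a
      rw [ha, hb] at hy
      rw [map_add dB, map_add dB, ← hy, sub_neg_eq_add]
      simp only [map_add]
      rw [← e2, show vB (rA x) + vB (hA b) + (hB (sA x) + (dB (rA a) + rB (dA a)) + hB (vA b)) =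
        vB (rA x) + (hB (vA b) + vB (hA b)) + (hB (sA x) + (dB (rA a) + rB (dA a))) by abel, ← e1]
      abel

section
variable {K : Type} [Field K] {Y Z : Fin 3 → Fin 3 → Type}
  [∀ i j, AddCommGroup (Y i j)] [∀ i j, Module K (Y i j)]
  [∀ i j, AddCommGroup (Z i j)] [∀ i j, Module K (Z i j)]

/-- Total differential. -/
def btD (f : ∀ i j, Y i j →ₗ[K] Z i j) :
    (∀ p : Fin 3 × Fin 3, Y p.1 p.2) →ₗ[K] (∀ p : Fin 3 × Fin 3, Z p.1 p.2) :=
  LinearMap.pi fun p => f p.1 p.2 ∘ₗ LinearMap.proj p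

/-- Total vertical map. -/
def btV (f : ∀ i j, Y i j →ₗ[K] Z (i + 1) j) :
    (∀ p : Fin 3 × Fin 3, Y p.1 p.2) →ₗ[K] (∀ p : Fin 3 × Fin 3, Z p.1 p.2) :=
  LinearMap.pi fun p => match p with
    | (0, j) => f 2 j ∘ₗ LinearMap.proj ((2, j) : Fin 3 × Fin 3)
    | (1, j) => f 0 j ∘ₗ LinearMap.proj ((0, j) : Fin 3 × Fin 3)
    | (2, j) => f 1 j ∘ₗ LinearMap.proj ((1, j) : Fin 3 × Fin 3)

/-- Total horizontal map. -/
def btH (f : ∀ i j, Y i j →ₗ[K] Z i (j + 1)) :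
    (∀ p : Fin 3 × Fin 3, Y p.1 p.2) →ₗ[K] (∀ p : Fin 3 × Fin 3, Z p.1 p.2) :=
  LinearMap.pi fun p => match p with
    | (i, 0) => f i 2 ∘ₗ LinearMap.proj ((i, 2) : Fin 3 × Fin 3)
    | (i, 1) => f i 0 ∘ₗ LinearMap.proj ((i, 0) : Fin 3 × Fin 3)
    | (i, 2) => f i 1 ∘ₗ LinearMap.proj ((i, 1) : Fin 3 × Fin 3)

/-- Total diagonal homotopy. -/
def btS (f : ∀ i j, Y i j →ₗ[K] Z (i + 1) (j + 1)) :
    (∀ p : Fin 3 × Fin 3, Y p.1 p.2) →ₗ[K] (∀ p : Fin 3 × Fin 3, Z p.1 p.2) :=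
  LinearMap.pi fun p => match p with
    | (0, 0) => f 2 2 ∘ₗ LinearMap.proj ((2, 2) : Fin 3 × Fin 3)
    | (0, 1) => f 2 0 ∘ₗ LinearMap.proj ((2, 0) : Fin 3 × Fin 3)
    | (0, 2) => f 2 1 ∘ₗ LinearMap.proj ((2, 1) : Fin 3 × Fin 3)
    | (1, 0) => f 0 2 ∘ₗ LinearMap.proj ((0, 2) : Fin 3 × Fin 3)
    | (1, 1) => f 0 0 ∘ₗ LinearMap.proj ((0, 0) : Fin 3 × Fin 3)
    | (1, 2) => f 0 1 ∘ₗ LinearMap.proj ((0, 1) : Fin 3 × Fin 3)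
    | (2, 0) => f 1 2 ∘ₗ LinearMap.proj ((1, 2) : Fin 3 × Fin 3)
    | (2, 1) => f 1 0 ∘ₗ LinearMap.proj ((1, 0) : Fin 3 × Fin 3)
    | (2, 2) => f 1 1 ∘ₗ LinearMap.proj ((1, 1) : Fin 3 × Fin 3)

/-- Total vertical homotopy. -/
def btT (f : ∀ i j, Y (i + 1) j →ₗ[K] Z i j) :
    (∀ p : Fin 3 × Fin 3, Y p.1 p.2) →ₗ[K] (∀ p : Fin 3 × Fin 3, Z p.1 p.2) :=
  LinearMap.pi fun p => f p.1 p.2 ∘ₗ LinearMap.proj ((p.1 + 1, p.2) : Fin 3 × Fin 3)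

/-- Total horizontal homotopy. -/
def btR (f : ∀ i j, Y i (j + 1) →ₗ[K] Z i j) :
    (∀ p : Fin 3 × Fin 3, Y p.1 p.2) →ₗ[K] (∀ p : Fin 3 × Fin 3, Z p.1 p.2) :=
  LinearMap.pi fun p => f p.1 p.2 ∘ₗ LinearMap.proj ((p.1, p.2 + 1) : Fin 3 × Fin 3)

lemma bt_exists_d (f : ∀ i j, Y i j →ₗ[K] Z i j) (c : ∀ p : Fin 3 × Fin 3, Z p.1 p.2)
    (h : ∀ i j, ∃ y, c (i, j) = f i j y) : ∃ y, c = btD f y := by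
  choose y hy using fun p : Fin 3 × Fin 3 => h p.1 p.2
  exact ⟨y, funext hy⟩

lemma bt_fin3 {Q : Fin 3 → Prop} (h0 : Q 0) (h1 : Q 1) (h2 : Q 2) : ∀ i, Q i := by
  intro i; fin_cases i <;> assumption

/-- Projection to the rows of index `k`. -/
def btProj {M : Fin 3 × Fin 3 → Type} [∀ p, AddCommGroup (M p)] [∀ p, Module K (M p)]
    (k : Fin 3) : (∀ p, M p) →ₗ[K] (∀ p, M p) :=
  LinearMap.pi fun p => if p.1 = k then LinearMap.proj p else 0

lemma btProj_apply {M : Fin 3 × Fin 3 → Type} [∀ p, AddCommGroup (M p)] [∀ p, Module K (M p)]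
    (k : Fin 3) (x : ∀ p, M p) (p : Fin 3 × Fin 3) :
    btProj (K := K) k x p = if p.1 = k then x p else 0 := by
  simp only [btProj, LinearMap.pi_apply]
  split_ifs <;> rfl

lemma btProj_sum {M : Fin 3 × Fin 3 → Type} [∀ p, AddCommGroup (M p)] [∀ p, Module K (M p)]
    (x : ∀ p, M p) : btProj (K := K) 0 x + btProj (K := K) 1 x + btProj (K := K) 2 x = x := by
  funext ⟨i, j⟩
  simp only [Pi.add_apply, btProj_apply]
  revert i
  refine bt_fin3 ?_ ?_ ?_ <;> simp

lemma btProj_idem {M : Fin 3 × Fin 3 → Type} [∀ p, AddCommGroup (M p)] [∀ p, Module K (M p)]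
    (k : Fin 3) (x : ∀ p, M p) : btProj (K := K) k (btProj (K := K) k x) = btProj (K := K) k x := by
  funext p
  simp only [btProj_apply]
  split_ifs <;> rfl

lemma btProj_orth {M : Fin 3 × Fin 3 → Type} [∀ p, AddCommGroup (M p)] [∀ p, Module K (M p)]
    (k l : Fin 3) (x : ∀ p, M p) (h : k ≠ l) : btProj (K := K) k (btProj (K := K) l x) = 0 := by
  funext p
  simp only [btProj_apply]
  split_ifs with h1 h2
  · exact absurd (h1.symm.trans h2) h
  · rfl
  · rfl

lemma btProj_v {M N : Fin 3 → Fin 3 → Type} [∀ i j, AddCommGroup (M i j)] [∀ i j, Module K (M i j)]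
    [∀ i j, AddCommGroup (N i j)] [∀ i j, Module K (N i j)]
    (f : ∀ i j, M (i + 2) j →ₗ[K] N i j) (k : Fin 3) (x : ∀ p : Fin 3 × Fin 3, M p.1 p.2) :
    (fun p : Fin 3 × Fin 3 => f p.1 p.2 (btProj (K := K) (M := fun p => M p.1 p.2) k x
      (p.1 + 2, p.2))) =
    btProj (K := K) (M := fun p => N p.1 p.2) (k + 1)
      (fun p : Fin 3 × Fin 3 => f p.1 p.2 (x (p.1 + 2, p.2))) := by
  funext p
  simp only [btProj_apply]
  have : p.1 + 2 = k ↔ p.1 = k + 1 := by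
    generalize p.1 = i
    revert i k; decide
  by_cases h : p.1 = k + 1
  · rw [if_pos (this.2 h), if_pos h]
  · rw [if_neg (fun h' => h (this.1 h')), if_neg h, map_zero]

lemma btProj_h {M N : Fin 3 → Fin 3 → Type} [∀ i j, AddCommGroup (M i j)] [∀ i j, Module K (M i j)]
    [∀ i j, AddCommGroup (N i j)] [∀ i j, Module K (N i j)]
    (f : ∀ i j, M i (j + 2) →ₗ[K] N i j) (k : Fin 3) (x : ∀ p : Fin 3 × Fin 3, M p.1 p.2) :
    (fun p : Fin 3 × Fin 3 => f p.1 p.2 (btProj (K := K) (M := fun p => M p.1 p.2) k x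
      (p.1, p.2 + 2))) =
    btProj (K := K) (M := fun p => N p.1 p.2) k
      (fun p : Fin 3 × Fin 3 => f p.1 p.2 (x (p.1, p.2 + 2))) := by
  funext p
  simp only [btProj_apply]
  by_cases h : p.1 = k
  · rw [if_pos h, if_pos h]
  · rw [if_neg h, if_neg h, map_zero]

/-- The class of a total cycle. -/
def btCls (f : ∀ i j, Y i j →ₗ[K] Z i j) (g : ∀ i j, Z i j →ₗ[K] Y i j)
    (x : ∀ p : Fin 3 × Fin 3, Y p.1 p.2) (hx : btD f x = 0) :
    ∀ p : Fin 3 × Fin 3, Hgen K (f p.1 p.2) (g p.1 p.2) :=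
  fun p => mkHgen K (f p.1 p.2) (g p.1 p.2) (x p) (congrFun hx p)

lemma btCls_surj (f : ∀ i j, Y i j →ₗ[K] Z i j) (g : ∀ i j, Z i j →ₗ[K] Y i j)
    (w : ∀ p : Fin 3 × Fin 3, Hgen K (f p.1 p.2) (g p.1 p.2)) :
    ∃ x hx, w = btCls f g x hx := by
  choose y hy using fun p => Submodule.Quotient.mk_surjective _ (w p)
  refine ⟨fun p => (y p).1, funext fun p => (y p).2, ?_⟩
  funext p
  exact (hy p).symm

lemma btCls_eq (f : ∀ i j, Y i j →ₗ[K] Z i j) (g : ∀ i j, Z i j →ₗ[K] Y i j)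
    (x y : ∀ p : Fin 3 × Fin 3, Y p.1 p.2) (hx : btD f x = 0) (hy : btD f y = 0)
    (h : ∃ b, x - y = btD g b) : btCls f g x hx = btCls f g y hy := by
  obtain ⟨b, hb⟩ := h
  funext p
  refine (Submodule.Quotient.eq _).2 ?_
  exact ⟨b p, (congrFun hb p).symm⟩

lemma btCls_zero (f : ∀ i j, Y i j →ₗ[K] Z i j) (g : ∀ i j, Z i j →ₗ[K] Y i j)
    (x : ∀ p : Fin 3 × Fin 3, Y p.1 p.2) (hx : btD f x = 0)
    (h : btCls f g x hx = 0) : ∃ b, x = btD g b := by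
  refine bt_exists_d g x fun i j => ?_
  obtain ⟨b, hb⟩ := (Submodule.Quotient.mk_eq_zero _).1 (congrFun h (i, j))
  exact ⟨b, hb.symm⟩

end

set_option maxHeartbeats 2000000 in
/-- For an odd homotopy exact bitriangle `(X, v, h)` of `ℤ₂`-graded
chain complexes with finite dimensional homology, the vertical and horizontal
torsion isomorphisms `T(v), T(h) : det H₊(X) → det H₋(X)` agree.  This is
expressed via the comparison number: for any pseudo-inverses `gv, gh` of the
induced odd exact endomorphisms, the determinant of `(h₊ + gh)⁻¹ ∘ (v₊ + gv)`
is `1`. -/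
theorem bitriangle_torsion_comparison
    (vp : ∀ i j, Xp i j →ₗ[F] Xm (i + 1) j) (vm : ∀ i j, Xm i j →ₗ[F] Xp (i + 1) j)
    (hp : ∀ i j, Xp i j →ₗ[F] Xm i (j + 1)) (hm : ∀ i j, Xm i j →ₗ[F] Xp i (j + 1))
    (sp : ∀ i j, Xp i j →ₗ[F] Xm (i + 1) (j + 1)) (sm : ∀ i j, Xm i j →ₗ[F] Xp (i + 1) (j + 1))
    (tp : ∀ i j, Xp (i + 1) j →ₗ[F] Xm i j) (tm : ∀ i j, Xm (i + 1) j →ₗ[F] Xp i j)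
    (rp : ∀ i j, Xp i (j + 1) →ₗ[F] Xm i j) (rm : ∀ i j, Xm i (j + 1) →ₗ[F] Xp i j)
    (hd : ∀ i j, dm i j ∘ₗ dp i j = 0 ∧ dp i j ∘ₗ dm i j = 0)
    (hvchain : ∀ i j, dm (i + 1) j ∘ₗ vp i j + vm i j ∘ₗ dp i j = 0 ∧ dp (i + 1) j ∘ₗ vm i j + vp i j ∘ₗ dm i j = 0)
    (hhchain : ∀ i j, dm i (j + 1) ∘ₗ hp i j + hm i j ∘ₗ dp i j = 0 ∧ dp i (j + 1) ∘ₗ hm i j + hp i j ∘ₗ dm i j = 0)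
    (hsq : ∀ i j, dm (i + 1) (j + 1) ∘ₗ sp i j + sm i j ∘ₗ dp i j =
      hm (i + 1) j ∘ₗ vp i j + vm i (j + 1) ∘ₗ hp i j ∧
      dp (i + 1) (j + 1) ∘ₗ sm i j + sp i j ∘ₗ dm i j =
      hp (i + 1) j ∘ₗ vm i j + vp i (j + 1) ∘ₗ hm i j)
    (hcol0 : ∀ j, dm 0 j ∘ₗ tp 0 j + tm 0 j ∘ₗ dp (0 + 1) j =
      (vm (0 + 2) j ∘ₗ vp (0 + 1) j : Xp (0 + 1) j →ₗ[F] Xp 0 j) ∧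
      dp 0 j ∘ₗ tm 0 j + tp 0 j ∘ₗ dm (0 + 1) j =
      (vp (0 + 2) j ∘ₗ vm (0 + 1) j : Xm (0 + 1) j →ₗ[F] Xm 0 j))
    (hcol1 : ∀ j, dm 1 j ∘ₗ tp 1 j + tm 1 j ∘ₗ dp (1 + 1) j =
      (vm (1 + 2) j ∘ₗ vp (1 + 1) j : Xp (1 + 1) j →ₗ[F] Xp 1 j) ∧
      dp 1 j ∘ₗ tm 1 j + tp 1 j ∘ₗ dm (1 + 1) j =
      (vp (1 + 2) j ∘ₗ vm (1 + 1) j : Xm (1 + 1) j →ₗ[F] Xm 1 j))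
    (hcol2 : ∀ j, dm 2 j ∘ₗ tp 2 j + tm 2 j ∘ₗ dp (2 + 1) j =
      (vm (2 + 2) j ∘ₗ vp (2 + 1) j : Xp (2 + 1) j →ₗ[F] Xp 2 j) ∧
      dp 2 j ∘ₗ tm 2 j + tp 2 j ∘ₗ dm (2 + 1) j =
      (vp (2 + 2) j ∘ₗ vm (2 + 1) j : Xm (2 + 1) j →ₗ[F] Xm 2 j))
    (hcolid0 : ∀ j, (∀ x : Xp 0 j, dp 0 j x = 0 →
      ∃ y, ((id (α := Xp 0 j) (vm (0 + 2) j (tp (0 + 2) j x))) + tm 0 j (vp 0 j x)) - x = dm 0 j y) ∧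
      (∀ x : Xm 0 j, dm 0 j x = 0 →
      ∃ y, ((id (α := Xm 0 j) (vp (0 + 2) j (tm (0 + 2) j x))) + tp 0 j (vm 0 j x)) - x = dp 0 j y))
    (hcolid1 : ∀ j, (∀ x : Xp 1 j, dp 1 j x = 0 →
      ∃ y, ((id (α := Xp 1 j) (vm (1 + 2) j (tp (1 + 2) j x))) + tm 1 j (vp 1 j x)) - x = dm 1 j y) ∧
      (∀ x : Xm 1 j, dm 1 j x = 0 →
      ∃ y, ((id (α := Xm 1 j) (vp (1 + 2) j (tm (1 + 2) j x))) + tp 1 j (vm 1 j x)) - x = dp 1 j y))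
    (hcolid2 : ∀ j, (∀ x : Xp 2 j, dp 2 j x = 0 →
      ∃ y, ((id (α := Xp 2 j) (vm (2 + 2) j (tp (2 + 2) j x))) + tm 2 j (vp 2 j x)) - x = dm 2 j y) ∧
      (∀ x : Xm 2 j, dm 2 j x = 0 →
      ∃ y, ((id (α := Xm 2 j) (vp (2 + 2) j (tm (2 + 2) j x))) + tp 2 j (vm 2 j x)) - x = dp 2 j y))
    (hrow0 : ∀ i, dm i 0 ∘ₗ rp i 0 + rm i 0 ∘ₗ dp i (0 + 1) =
      (hm i (0 + 2) ∘ₗ hp i (0 + 1) : Xp i (0 + 1) →ₗ[F] Xp i 0) ∧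
      dp i 0 ∘ₗ rm i 0 + rp i 0 ∘ₗ dm i (0 + 1) =
      (hp i (0 + 2) ∘ₗ hm i (0 + 1) : Xm i (0 + 1) →ₗ[F] Xm i 0))
    (hrow1 : ∀ i, dm i 1 ∘ₗ rp i 1 + rm i 1 ∘ₗ dp i (1 + 1) =
      (hm i (1 + 2) ∘ₗ hp i (1 + 1) : Xp i (1 + 1) →ₗ[F] Xp i 1) ∧
      dp i 1 ∘ₗ rm i 1 + rp i 1 ∘ₗ dm i (1 + 1) =
      (hp i (1 + 2) ∘ₗ hm i (1 + 1) : Xm i (1 + 1) →ₗ[F] Xm i 1))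
    (hrow2 : ∀ i, dm i 2 ∘ₗ rp i 2 + rm i 2 ∘ₗ dp i (2 + 1) =
      (hm i (2 + 2) ∘ₗ hp i (2 + 1) : Xp i (2 + 1) →ₗ[F] Xp i 2) ∧
      dp i 2 ∘ₗ rm i 2 + rp i 2 ∘ₗ dm i (2 + 1) =
      (hp i (2 + 2) ∘ₗ hm i (2 + 1) : Xm i (2 + 1) →ₗ[F] Xm i 2))
    (hrowid0 : ∀ i, (∀ x : Xp i 0, dp i 0 x = 0 →
      ∃ y, ((id (α := Xp i 0) (hm i (0 + 2) (rp i (0 + 2) x))) + rm i 0 (hp i 0 x)) - x = dm i 0 y) ∧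
      (∀ x : Xm i 0, dm i 0 x = 0 →
      ∃ y, ((id (α := Xm i 0) (hp i (0 + 2) (rm i (0 + 2) x))) + rp i 0 (hm i 0 x)) - x = dp i 0 y))
    (hrowid1 : ∀ i, (∀ x : Xp i 1, dp i 1 x = 0 →
      ∃ y, ((id (α := Xp i 1) (hm i (1 + 2) (rp i (1 + 2) x))) + rm i 1 (hp i 1 x)) - x = dm i 1 y) ∧
      (∀ x : Xm i 1, dm i 1 x = 0 →
      ∃ y, ((id (α := Xm i 1) (hp i (1 + 2) (rm i (1 + 2) x))) + rp i 1 (hm i 1 x)) - x = dp i 1 y))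
    (hrowid2 : ∀ i, (∀ x : Xp i 2, dp i 2 x = 0 →
      ∃ y, ((id (α := Xp i 2) (hm i (2 + 2) (rp i (2 + 2) x))) + rm i 2 (hp i 2 x)) - x = dm i 2 y) ∧
      (∀ x : Xm i 2, dm i 2 x = 0 →
      ∃ y, ((id (α := Xm i 2) (hp i (2 + 2) (rm i (2 + 2) x))) + rp i 2 (hm i 2 x)) - x = dp i 2 y))
    (hbit10 : ∀ j, (∀ x : Xp 0 j, dp 0 j x = 0 →
      ∃ y, (id (α := Xp (0 + 2) (j + 1)) (vm (0 + 1) (j + 1) (sp 0 j x))) +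
        (id (α := Xp (0 + 2) (j + 1)) (sm (0 + 1) j (vp 0 j x))) +
        tm (0 + 2) (j + 1) (hp 0 j x) + hm (0 + 2) j (tp (0 + 2) j x) =
        dm (0 + 2) (j + 1) y) ∧
      (∀ x : Xm 0 j, dm 0 j x = 0 →
      ∃ y, (id (α := Xm (0 + 2) (j + 1)) (vp (0 + 1) (j + 1) (sm 0 j x))) +
        (id (α := Xm (0 + 2) (j + 1)) (sp (0 + 1) j (vm 0 j x))) +
        tp (0 + 2) (j + 1) (hm 0 j x) + hp (0 + 2) j (tm (0 + 2) j x) =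
        dp (0 + 2) (j + 1) y))
    (hbit11 : ∀ j, (∀ x : Xp 1 j, dp 1 j x = 0 →
      ∃ y, (id (α := Xp (1 + 2) (j + 1)) (vm (1 + 1) (j + 1) (sp 1 j x))) +
        (id (α := Xp (1 + 2) (j + 1)) (sm (1 + 1) j (vp 1 j x))) +
        tm (1 + 2) (j + 1) (hp 1 j x) + hm (1 + 2) j (tp (1 + 2) j x) =
        dm (1 + 2) (j + 1) y) ∧
      (∀ x : Xm 1 j, dm 1 j x = 0 →
      ∃ y, (id (α := Xm (1 + 2) (j + 1)) (vp (1 + 1) (j + 1) (sm 1 j x))) +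
        (id (α := Xm (1 + 2) (j + 1)) (sp (1 + 1) j (vm 1 j x))) +
        tp (1 + 2) (j + 1) (hm 1 j x) + hp (1 + 2) j (tm (1 + 2) j x) =
        dp (1 + 2) (j + 1) y))
    (hbit12 : ∀ j, (∀ x : Xp 2 j, dp 2 j x = 0 →
      ∃ y, (id (α := Xp (2 + 2) (j + 1)) (vm (2 + 1) (j + 1) (sp 2 j x))) +
        (id (α := Xp (2 + 2) (j + 1)) (sm (2 + 1) j (vp 2 j x))) +
        tm (2 + 2) (j + 1) (hp 2 j x) + hm (2 + 2) j (tp (2 + 2) j x) =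
        dm (2 + 2) (j + 1) y) ∧
      (∀ x : Xm 2 j, dm 2 j x = 0 →
      ∃ y, (id (α := Xm (2 + 2) (j + 1)) (vp (2 + 1) (j + 1) (sm 2 j x))) +
        (id (α := Xm (2 + 2) (j + 1)) (sp (2 + 1) j (vm 2 j x))) +
        tp (2 + 2) (j + 1) (hm 2 j x) + hp (2 + 2) j (tm (2 + 2) j x) =
        dp (2 + 2) (j + 1) y))
    (hbit20 : ∀ i, (∀ x : Xp i 0, dp i 0 x = 0 →
      ∃ y, (id (α := Xp (i + 1) (0 + 2)) (hm (i + 1) (0 + 1) (sp i 0 x))) +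
        (id (α := Xp (i + 1) (0 + 2)) (sm i (0 + 1) (hp i 0 x))) +
        rm (i + 1) (0 + 2) (vp i 0 x) + vm i (0 + 2) (rp i (0 + 2) x) =
        dm (i + 1) (0 + 2) y) ∧
      (∀ x : Xm i 0, dm i 0 x = 0 →
      ∃ y, (id (α := Xm (i + 1) (0 + 2)) (hp (i + 1) (0 + 1) (sm i 0 x))) +
        (id (α := Xm (i + 1) (0 + 2)) (sp i (0 + 1) (hm i 0 x))) +
        rp (i + 1) (0 + 2) (vm i 0 x) + vp i (0 + 2) (rm i (0 + 2) x) =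
        dp (i + 1) (0 + 2) y))
    (hbit21 : ∀ i, (∀ x : Xp i 1, dp i 1 x = 0 →
      ∃ y, (id (α := Xp (i + 1) (1 + 2)) (hm (i + 1) (1 + 1) (sp i 1 x))) +
        (id (α := Xp (i + 1) (1 + 2)) (sm i (1 + 1) (hp i 1 x))) +
        rm (i + 1) (1 + 2) (vp i 1 x) + vm i (1 + 2) (rp i (1 + 2) x) =
        dm (i + 1) (1 + 2) y) ∧
      (∀ x : Xm i 1, dm i 1 x = 0 →
      ∃ y, (id (α := Xm (i + 1) (1 + 2)) (hp (i + 1) (1 + 1) (sm i 1 x))) +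
        (id (α := Xm (i + 1) (1 + 2)) (sp i (1 + 1) (hm i 1 x))) +
        rp (i + 1) (1 + 2) (vm i 1 x) + vp i (1 + 2) (rm i (1 + 2) x) =
        dp (i + 1) (1 + 2) y))
    (hbit22 : ∀ i, (∀ x : Xp i 2, dp i 2 x = 0 →
      ∃ y, (id (α := Xp (i + 1) (2 + 2)) (hm (i + 1) (2 + 1) (sp i 2 x))) +
        (id (α := Xp (i + 1) (2 + 2)) (sm i (2 + 1) (hp i 2 x))) +
        rm (i + 1) (2 + 2) (vp i 2 x) + vm i (2 + 2) (rp i (2 + 2) x) =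
        dm (i + 1) (2 + 2) y) ∧
      (∀ x : Xm i 2, dm i 2 x = 0 →
      ∃ y, (id (α := Xm (i + 1) (2 + 2)) (hp (i + 1) (2 + 1) (sm i 2 x))) +
        (id (α := Xm (i + 1) (2 + 2)) (sp i (2 + 1) (hm i 2 x))) +
        rp (i + 1) (2 + 2) (vm i 2 x) + vp i (2 + 2) (rm i (2 + 2) x) =
        dp (i + 1) (2 + 2) y))
    (hfin : ∀ i j, FiniteDimensional F (Hgen F (dp i j) (dm i j)) ∧
      FiniteDimensional F (Hgen F (dm i j) (dp i j))) :
    ∀ (vHp : ∀ i j, Hgen F (dp (i + 2) j) (dm (i + 2) j) →ₗ[F] Hgen F (dm i j) (dp i j))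
      (vHm : ∀ i j, Hgen F (dm (i + 2) j) (dp (i + 2) j) →ₗ[F] Hgen F (dp i j) (dm i j))
      (hHp : ∀ i j, Hgen F (dp i (j + 2)) (dm i (j + 2)) →ₗ[F] Hgen F (dm i j) (dp i j))
      (hHm : ∀ i j, Hgen F (dm i (j + 2)) (dp i (j + 2)) →ₗ[F] Hgen F (dp i j) (dm i j)),
      (∀ j x hx hy, vHp 0 j (mkHgen F (dp (0 + 2) j) (dm (0 + 2) j) x hx) =
        mkHgen F (dm 0 j) (dp 0 j) (vp (0 + 2) j x) hy) →
      (∀ j x hx hy, vHm 0 j (mkHgen F (dm (0 + 2) j) (dp (0 + 2) j) x hx) =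
        mkHgen F (dp 0 j) (dm 0 j) (vm (0 + 2) j x) hy) →
      (∀ j x hx hy, vHp 1 j (mkHgen F (dp (1 + 2) j) (dm (1 + 2) j) x hx) =
        mkHgen F (dm 1 j) (dp 1 j) (vp (1 + 2) j x) hy) →
      (∀ j x hx hy, vHm 1 j (mkHgen F (dm (1 + 2) j) (dp (1 + 2) j) x hx) =
        mkHgen F (dp 1 j) (dm 1 j) (vm (1 + 2) j x) hy) →
      (∀ j x hx hy, vHp 2 j (mkHgen F (dp (2 + 2) j) (dm (2 + 2) j) x hx) =
        mkHgen F (dm 2 j) (dp 2 j) (vp (2 + 2) j x) hy) →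
      (∀ j x hx hy, vHm 2 j (mkHgen F (dm (2 + 2) j) (dp (2 + 2) j) x hx) =
        mkHgen F (dp 2 j) (dm 2 j) (vm (2 + 2) j x) hy) →
      (∀ i x hx hy, hHp i 0 (mkHgen F (dp i (0 + 2)) (dm i (0 + 2)) x hx) =
        mkHgen F (dm i 0) (dp i 0) (hp i (0 + 2) x) hy) →
      (∀ i x hx hy, hHm i 0 (mkHgen F (dm i (0 + 2)) (dp i (0 + 2)) x hx) =
        mkHgen F (dp i 0) (dm i 0) (hm i (0 + 2) x) hy) →
      (∀ i x hx hy, hHp i 1 (mkHgen F (dp i (1 + 2)) (dm i (1 + 2)) x hx) =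
        mkHgen F (dm i 1) (dp i 1) (hp i (1 + 2) x) hy) →
      (∀ i x hx hy, hHm i 1 (mkHgen F (dm i (1 + 2)) (dp i (1 + 2)) x hx) =
        mkHgen F (dp i 1) (dm i 1) (hm i (1 + 2) x) hy) →
      (∀ i x hx hy, hHp i 2 (mkHgen F (dp i (2 + 2)) (dm i (2 + 2)) x hx) =
        mkHgen F (dm i 2) (dp i 2) (hp i (2 + 2) x) hy) →
      (∀ i x hx hy, hHm i 2 (mkHgen F (dm i (2 + 2)) (dp i (2 + 2)) x hx) =
        mkHgen F (dp i 2) (dm i 2) (hm i (2 + 2) x) hy) →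
      ∀ (gv : P9p F Xp Xm dp dm →ₗ[F] P9m F Xp Xm dp dm)
      (gh : P9p F Xp Xm dp dm →ₗ[F] P9m F Xp Xm dp dm),
      (alphaVm F Xp Xm dp dm vHm ∘ₗ gv ∘ₗ alphaVm F Xp Xm dp dm vHm =
        alphaVm F Xp Xm dp dm vHm) →
      (gv ∘ₗ alphaVm F Xp Xm dp dm vHm ∘ₗ gv = gv) →
      (alphaHm F Xp Xm dp dm hHm ∘ₗ gh ∘ₗ alphaHm F Xp Xm dp dm hHm =
        alphaHm F Xp Xm dp dm hHm) →
      (gh ∘ₗ alphaHm F Xp Xm dp dm hHm ∘ₗ gh = gh) →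
      ∀ (eh : P9p F Xp Xm dp dm ≃ₗ[F] P9m F Xp Xm dp dm),
        (eh : P9p F Xp Xm dp dm →ₗ[F] P9m F Xp Xm dp dm) =
          alphaHp F Xp Xm dp dm hHp + gh →
        LinearMap.det ((eh.symm : P9m F Xp Xm dp dm →ₗ[F] P9p F Xp Xm dp dm) ∘ₗ
          (alphaVp F Xp Xm dp dm vHp + gv)) = 1 := by
  intro vHp vHm hHp hHm hVp0 hVm0 hVp1 hVm1 hVp2 hVm2 hHp0 hHm0 hHp1 hHm1 hHp2 hHm2
    gv gh gv1 gv2 gh1 gh2 eh heh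
  haveI := fun p : Fin 3 × Fin 3 => (hfin p.1 p.2).1
  haveI := fun p : Fin 3 × Fin 3 => (hfin p.1 p.2).2
  have Cp : BtChain F (∀ p : Fin 3 × Fin 3, Xp p.1 p.2) (∀ p : Fin 3 × Fin 3, Xm p.1 p.2)
      (btD dp) (btV vp) (btH hp) (btS sp) (btT tp) (btR rp)
      (btD dm) (btV vm) (btH hm) (btS sm) (btT tm) (btR rm) := by
    refine ⟨?_, ?_, ?_, ?_, ?_, ?_, ?_, ?_, ?_⟩
    · refine fun x => funext fun ⟨i, j⟩ => ?_
      revert i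
      refine bt_fin3 ?_ ?_ ?_
      · exact LinearMap.congr_fun (hvchain 2 j).1 (x (2, j))
      · exact LinearMap.congr_fun (hvchain 0 j).1 (x (0, j))
      · exact LinearMap.congr_fun (hvchain 1 j).1 (x (1, j))
    · refine fun x => funext fun ⟨i, j⟩ => ?_
      revert j
      refine bt_fin3 ?_ ?_ ?_
      · exact LinearMap.congr_fun (hhchain i 2).1 (x (i, 2))
      · exact LinearMap.congr_fun (hhchain i 0).1 (x (i, 0))
      · exact LinearMap.congr_fun (hhchain i 1).1 (x (i, 1))
    · refine fun x => funext fun ⟨i, j⟩ => ?_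
      revert i j
      refine bt_fin3 (bt_fin3 ?_ ?_ ?_) (bt_fin3 ?_ ?_ ?_) (bt_fin3 ?_ ?_ ?_)
      · exact LinearMap.congr_fun (hsq 2 2).1 (x (2, 2))
      · exact LinearMap.congr_fun (hsq 2 0).1 (x (2, 0))
      · exact LinearMap.congr_fun (hsq 2 1).1 (x (2, 1))
      · exact LinearMap.congr_fun (hsq 0 2).1 (x (0, 2))
      · exact LinearMap.congr_fun (hsq 0 0).1 (x (0, 0))
      · exact LinearMap.congr_fun (hsq 0 1).1 (x (0, 1))
      · exact LinearMap.congr_fun (hsq 1 2).1 (x (1, 2))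
      · exact LinearMap.congr_fun (hsq 1 0).1 (x (1, 0))
      · exact LinearMap.congr_fun (hsq 1 1).1 (x (1, 1))
    · refine fun x => funext fun ⟨i, j⟩ => ?_
      revert i
      refine bt_fin3 ?_ ?_ ?_
      · exact LinearMap.congr_fun (hcol0 j).1 (x (1, j))
      · exact LinearMap.congr_fun (hcol1 j).1 (x (2, j))
      · exact LinearMap.congr_fun (hcol2 j).1 (x (0, j))
    · refine fun x => funext fun ⟨i, j⟩ => ?_
      revert j
      refine bt_fin3 ?_ ?_ ?_
      · exact LinearMap.congr_fun (hrow0 i).1 (x (i, 1))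
      · exact LinearMap.congr_fun (hrow1 i).1 (x (i, 2))
      · exact LinearMap.congr_fun (hrow2 i).1 (x (i, 0))
    · refine fun x hx => bt_exists_d dm _ fun i j => ?_
      revert i
      refine bt_fin3 ?_ ?_ ?_
      · exact (hcolid0 j).1 (x (0, j)) (congrFun hx (0, j))
      · exact (hcolid1 j).1 (x (1, j)) (congrFun hx (1, j))
      · exact (hcolid2 j).1 (x (2, j)) (congrFun hx (2, j))
    · refine fun x hx => bt_exists_d dm _ fun i j => ?_
      revert j
      refine bt_fin3 ?_ ?_ ?_
      · exact (hrowid0 i).1 (x (i, 0)) (congrFun hx (i, 0))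
      · exact (hrowid1 i).1 (x (i, 1)) (congrFun hx (i, 1))
      · exact (hrowid2 i).1 (x (i, 2)) (congrFun hx (i, 2))
    · refine fun x hx => bt_exists_d dm _ fun i j => ?_
      revert i j
      refine bt_fin3 (bt_fin3 ?_ ?_ ?_) (bt_fin3 ?_ ?_ ?_) (bt_fin3 ?_ ?_ ?_)
      · exact (hbit11 2).1 (x (1, 2)) (congrFun hx (1, 2))
      · exact (hbit11 0).1 (x (1, 0)) (congrFun hx (1, 0))
      · exact (hbit11 1).1 (x (1, 1)) (congrFun hx (1, 1))
      · exact (hbit12 2).1 (x (2, 2)) (congrFun hx (2, 2))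
      · exact (hbit12 0).1 (x (2, 0)) (congrFun hx (2, 0))
      · exact (hbit12 1).1 (x (2, 1)) (congrFun hx (2, 1))
      · exact (hbit10 2).1 (x (0, 2)) (congrFun hx (0, 2))
      · exact (hbit10 0).1 (x (0, 0)) (congrFun hx (0, 0))
      · exact (hbit10 1).1 (x (0, 1)) (congrFun hx (0, 1))
    · refine fun x hx => bt_exists_d dm _ fun i j => ?_
      revert i j
      refine bt_fin3 (bt_fin3 ?_ ?_ ?_) (bt_fin3 ?_ ?_ ?_) (bt_fin3 ?_ ?_ ?_)
      · exact (hbit21 2).1 (x (2, 1)) (congrFun hx (2, 1))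
      · exact (hbit22 2).1 (x (2, 2)) (congrFun hx (2, 2))
      · exact (hbit20 2).1 (x (2, 0)) (congrFun hx (2, 0))
      · exact (hbit21 0).1 (x (0, 1)) (congrFun hx (0, 1))
      · exact (hbit22 0).1 (x (0, 2)) (congrFun hx (0, 2))
      · exact (hbit20 0).1 (x (0, 0)) (congrFun hx (0, 0))
      · exact (hbit21 1).1 (x (1, 1)) (congrFun hx (1, 1))
      · exact (hbit22 1).1 (x (1, 2)) (congrFun hx (1, 2))
      · exact (hbit20 1).1 (x (1, 0)) (congrFun hx (1, 0))
  have Cm : BtChain F (∀ p : Fin 3 × Fin 3, Xm p.1 p.2) (∀ p : Fin 3 × Fin 3, Xp p.1 p.2)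
      (btD dm) (btV vm) (btH hm) (btS sm) (btT tm) (btR rm)
      (btD dp) (btV vp) (btH hp) (btS sp) (btT tp) (btR rp) := by
    refine ⟨?_, ?_, ?_, ?_, ?_, ?_, ?_, ?_, ?_⟩
    · refine fun x => funext fun ⟨i, j⟩ => ?_
      revert i
      refine bt_fin3 ?_ ?_ ?_
      · exact LinearMap.congr_fun (hvchain 2 j).2 (x (2, j))
      · exact LinearMap.congr_fun (hvchain 0 j).2 (x (0, j))
      · exact LinearMap.congr_fun (hvchain 1 j).2 (x (1, j))
    · refine fun x => funext fun ⟨i, j⟩ => ?_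
      revert j
      refine bt_fin3 ?_ ?_ ?_
      · exact LinearMap.congr_fun (hhchain i 2).2 (x (i, 2))
      · exact LinearMap.congr_fun (hhchain i 0).2 (x (i, 0))
      · exact LinearMap.congr_fun (hhchain i 1).2 (x (i, 1))
    · refine fun x => funext fun ⟨i, j⟩ => ?_
      revert i j
      refine bt_fin3 (bt_fin3 ?_ ?_ ?_) (bt_fin3 ?_ ?_ ?_) (bt_fin3 ?_ ?_ ?_)
      · exact LinearMap.congr_fun (hsq 2 2).2 (x (2, 2))
      · exact LinearMap.congr_fun (hsq 2 0).2 (x (2, 0))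
      · exact LinearMap.congr_fun (hsq 2 1).2 (x (2, 1))
      · exact LinearMap.congr_fun (hsq 0 2).2 (x (0, 2))
      · exact LinearMap.congr_fun (hsq 0 0).2 (x (0, 0))
      · exact LinearMap.congr_fun (hsq 0 1).2 (x (0, 1))
      · exact LinearMap.congr_fun (hsq 1 2).2 (x (1, 2))
      · exact LinearMap.congr_fun (hsq 1 0).2 (x (1, 0))
      · exact LinearMap.congr_fun (hsq 1 1).2 (x (1, 1))
    · refine fun x => funext fun ⟨i, j⟩ => ?_
      revert i
      refine bt_fin3 ?_ ?_ ?_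
      · exact LinearMap.congr_fun (hcol0 j).2 (x (1, j))
      · exact LinearMap.congr_fun (hcol1 j).2 (x (2, j))
      · exact LinearMap.congr_fun (hcol2 j).2 (x (0, j))
    · refine fun x => funext fun ⟨i, j⟩ => ?_
      revert j
      refine bt_fin3 ?_ ?_ ?_
      · exact LinearMap.congr_fun (hrow0 i).2 (x (i, 1))
      · exact LinearMap.congr_fun (hrow1 i).2 (x (i, 2))
      · exact LinearMap.congr_fun (hrow2 i).2 (x (i, 0))
    · refine fun x hx => bt_exists_d dp _ fun i j => ?_
      revert i
      refine bt_fin3 ?_ ?_ ?_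
      · exact (hcolid0 j).2 (x (0, j)) (congrFun hx (0, j))
      · exact (hcolid1 j).2 (x (1, j)) (congrFun hx (1, j))
      · exact (hcolid2 j).2 (x (2, j)) (congrFun hx (2, j))
    · refine fun x hx => bt_exists_d dp _ fun i j => ?_
      revert j
      refine bt_fin3 ?_ ?_ ?_
      · exact (hrowid0 i).2 (x (i, 0)) (congrFun hx (i, 0))
      · exact (hrowid1 i).2 (x (i, 1)) (congrFun hx (i, 1))
      · exact (hrowid2 i).2 (x (i, 2)) (congrFun hx (i, 2))
    · refine fun x hx => bt_exists_d dp _ fun i j => ?_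
      revert i j
      refine bt_fin3 (bt_fin3 ?_ ?_ ?_) (bt_fin3 ?_ ?_ ?_) (bt_fin3 ?_ ?_ ?_)
      · exact (hbit11 2).2 (x (1, 2)) (congrFun hx (1, 2))
      · exact (hbit11 0).2 (x (1, 0)) (congrFun hx (1, 0))
      · exact (hbit11 1).2 (x (1, 1)) (congrFun hx (1, 1))
      · exact (hbit12 2).2 (x (2, 2)) (congrFun hx (2, 2))
      · exact (hbit12 0).2 (x (2, 0)) (congrFun hx (2, 0))
      · exact (hbit12 1).2 (x (2, 1)) (congrFun hx (2, 1))
      · exact (hbit10 2).2 (x (0, 2)) (congrFun hx (0, 2))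
      · exact (hbit10 0).2 (x (0, 0)) (congrFun hx (0, 0))
      · exact (hbit10 1).2 (x (0, 1)) (congrFun hx (0, 1))
    · refine fun x hx => bt_exists_d dp _ fun i j => ?_
      revert i j
      refine bt_fin3 (bt_fin3 ?_ ?_ ?_) (bt_fin3 ?_ ?_ ?_) (bt_fin3 ?_ ?_ ?_)
      · exact (hbit21 2).2 (x (2, 1)) (congrFun hx (2, 1))
      · exact (hbit22 2).2 (x (2, 2)) (congrFun hx (2, 2))
      · exact (hbit20 2).2 (x (2, 0)) (congrFun hx (2, 0))
      · exact (hbit21 0).2 (x (0, 1)) (congrFun hx (0, 1))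
      · exact (hbit22 0).2 (x (0, 2)) (congrFun hx (0, 2))
      · exact (hbit20 0).2 (x (0, 0)) (congrFun hx (0, 0))
      · exact (hbit21 1).2 (x (1, 1)) (congrFun hx (1, 1))
      · exact (hbit22 1).2 (x (1, 2)) (congrFun hx (1, 2))
      · exact (hbit20 1).2 (x (1, 0)) (congrFun hx (1, 0))
  have hvp : ∀ x hx hy, alphaVp F Xp Xm dp dm vHp (btCls dp dm x hx) =
      btCls dm dp (btV vp x) hy := by
    refine fun x hx hy => funext fun ⟨i, j⟩ => ?_
    revert i
    refine bt_fin3 ?_ ?_ ?_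
    · exact hVp0 j (x (2, j)) (congrFun hx (2, j)) (congrFun hy (0, j))
    · exact hVp1 j (x (0, j)) (congrFun hx (0, j)) (congrFun hy (1, j))
    · exact hVp2 j (x (1, j)) (congrFun hx (1, j)) (congrFun hy (2, j))
  have hhp : ∀ x hx hy, alphaHp F Xp Xm dp dm hHp (btCls dp dm x hx) =
      btCls dm dp (btH hp x) hy := by
    refine fun x hx hy => funext fun ⟨i, j⟩ => ?_
    revert j
    refine bt_fin3 ?_ ?_ ?_
    · exact hHp0 i (x (i, 2)) (congrFun hx (i, 2)) (congrFun hy (i, 0))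
    · exact hHp1 i (x (i, 0)) (congrFun hx (i, 0)) (congrFun hy (i, 1))
    · exact hHp2 i (x (i, 1)) (congrFun hx (i, 1)) (congrFun hy (i, 2))
  have hvm : ∀ x hx hy, alphaVm F Xp Xm dp dm vHm (btCls dm dp x hx) =
      btCls dp dm (btV vm x) hy := by
    refine fun x hx hy => funext fun ⟨i, j⟩ => ?_
    revert i
    refine bt_fin3 ?_ ?_ ?_
    · exact hVm0 j (x (2, j)) (congrFun hx (2, j)) (congrFun hy (0, j))
    · exact hVm1 j (x (0, j)) (congrFun hx (0, j)) (congrFun hy (1, j))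
    · exact hVm2 j (x (1, j)) (congrFun hx (1, j)) (congrFun hy (2, j))
  have hhm : ∀ x hx hy, alphaHm F Xp Xm dp dm hHm (btCls dm dp x hx) =
      btCls dp dm (btH hm x) hy := by
    refine fun x hx hy => funext fun ⟨i, j⟩ => ?_
    revert j
    refine bt_fin3 ?_ ?_ ?_
    · exact hHm0 i (x (i, 2)) (congrFun hx (i, 2)) (congrFun hy (i, 0))
    · exact hHm1 i (x (i, 0)) (congrFun hx (i, 0)) (congrFun hy (i, 1))
    · exact hHm2 i (x (i, 1)) (congrFun hx (i, 1)) (congrFun hy (i, 2))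
  have Dp := bt_chain Cp (btCls dp dm) (btCls dm dp) (btCls_surj dp dm)
    (btCls_eq dp dm) (fun _ _ => rfl) rfl (btCls_zero dm dp)
    hvp hhp hvm hhm Cm.dv Cm.dh
  have Dm := bt_chain Cm (btCls dm dp) (btCls dp dm) (btCls_surj dm dp)
    (btCls_eq dm dp) (fun _ _ => rfl) rfl (btCls_zero dp dm)
    hvm hhm hvp hhp Cp.dv Cp.dh
  exact bt_main Dp Dm (fun k => btProj k) (fun k => btProj k)
    btProj_sum btProj_idem btProj_orth btProj_sum btProj_idem btProj_orth
    (btProj_v (K := F) (M := fun i j => Hgen F (dp i j) (dm i j)) (N := fun i j => Hgen F (dm i j) (dp i j)) vHp)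
    (btProj_v (K := F) (M := fun i j => Hgen F (dm i j) (dp i j)) (N := fun i j => Hgen F (dp i j) (dm i j)) vHm)
    (btProj_h (K := F) (M := fun i j => Hgen F (dp i j) (dm i j)) (N := fun i j => Hgen F (dm i j) (dp i j)) hHp)
    (btProj_h (K := F) (M := fun i j => Hgen F (dm i j) (dp i j)) (N := fun i j => Hgen F (dp i j) (dm i j)) hHm) gv gh
    (LinearMap.congr_fun gv1) (LinearMap.congr_fun gv2)
    (LinearMap.congr_fun gh1) (LinearMap.congr_fun gh2) eh heh

end Bitriangle
end

section
/- In the setting of a homotopy exact odd bitriangle (X,v,h) with finite dimensional homology H(X) = H(D₁) ⊕ H(D₂) ⊕ H(D₃) and induced anticommuting odd exact endomorphisms v, h on H(X) with δ_k = v − h : H(D_k) → H(D_{k+1}): for indices i,j with i+j ≡ k (mod 3), the projection P_{ij} induces a surjective even linear map from the homology H_δ(H(D_k)) = Ker(δ_k)/Im(δ_{k-1}) onto P_{ij}(Ker(vh)/(Ker(v)+Ker(h))). -/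
open Module Submodule

section Bitriangle

variable (F : Type) [Field F]

variable (Xp Xm : Fin 3 → Fin 3 → Type)
  [∀ i j, AddCommGroup (Xp i j)] [∀ i j, Module F (Xp i j)]
  [∀ i j, AddCommGroup (Xm i j)] [∀ i j, Module F (Xm i j)]
variable (dp : ∀ i j, Xp i j →ₗ[F] Xm i j) (dm : ∀ i j, Xm i j →ₗ[F] Xp i j)

/-- Equality of classes in `Hgen`. -/
theorem mkHgen_eq_of {M N : Type} [AddCommGroup M] [Module F M] [AddCommGroup N] [Module F N]
    (d1 : M →ₗ[F] N) (d2 : N →ₗ[F] M) (x y : M) (hx : d1 x = 0) (hy : d1 y = 0)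
    (z : N) (h : x - y = d2 z) : mkHgen F d1 d2 x hx = mkHgen F d1 d2 y hy := by
  unfold mkHgen
  rw [Submodule.Quotient.eq]
  exact ⟨z, h.symm⟩

theorem mkHgen_eq_zero {M N : Type} [AddCommGroup M] [Module F M] [AddCommGroup N] [Module F N]
    (d1 : M →ₗ[F] N) (d2 : N →ₗ[F] M) (x : M) (hx : d1 x = 0)
    (h : mkHgen F d1 d2 x hx = 0) : ∃ z, x = d2 z := by
  unfold mkHgen at h
  rw [Submodule.Quotient.mk_eq_zero] at h
  obtain ⟨z, hz⟩ := h
  exact ⟨z, hz.symm⟩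

/-- The key diagram chase, at an arbitrary position.

We start from an even cycle `x` at position `(i0, j0)` whose class is killed by `h v`, and look for
classes `η` at `(i1, j2)` and `ω` at `(i2, j1)` which complete it to a `δ`-cycle of the diagonal.
Writing `d` for every differential, choose `p` with `h v x = d p` and set `q = s x - p`, so that the
square relation gives `d q = v h x`.

* Put `y = r (v x) + h p`. The row relation `d r + r d = h h` shows that `y` is a cycle, and the row
  identity `h r + r h ≃ 1`, evaluated on `v x`, shows that `h y` is homologous to `v x`.
* Put `w = t (h x) + v q`. By the column relation `d t + t d = v v` this is a cycle too, and the
  column identity `v t + t v ≃ 1`, evaluated on `h x`, shows that `v w` is homologous to `h x`.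
* It remains to compare `v y` with `h w`. The square relation on `p` turns their difference into
  `v r v x + s h v x - h t h x - h v s x` up to a boundary. The second bitriangle relation on the
  cycle `v x` replaces the first two summands by `- h s v x - r v v x`; applying `h` to the first
  bitriangle relation on `x` replaces the remaining terms by `h h t x`. Finally
  `h h t x = d r t x + r d t x` and `d t x = v v x`, hence everything cancels up to the boundary of
  `y1 + s p + h y2 + r t x`, where `y1` and `y2` are the chains given by those two relations.

Neither finite dimensionality nor the vanishing of `v h x` is used, and no correction of `x` by
elements of the kernels of `v` or `h` is necessary. Only the differentials out of the relevant
positions occur, which is why the maps are passed as parameters instead of being taken from a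
family indexed by `Fin 3`: for closed numerals the sums of indices reduce definitionally. -/
theorem bit_core (i0 i1 i2 j0 j1 j2 : Fin 3)
    (v0p : ∀ j, Xp i0 j →ₗ[F] Xm i1 j) (v0m : ∀ j, Xm i0 j →ₗ[F] Xp i1 j)
    (v1p : ∀ j, Xp i1 j →ₗ[F] Xm i2 j) (v1m : ∀ j, Xm i1 j →ₗ[F] Xp i2 j)
    (v2p : ∀ j, Xp i2 j →ₗ[F] Xm i0 j) (v2m : Xm i2 j1 →ₗ[F] Xp i0 j1)
    (t0p : ∀ j, Xp i1 j →ₗ[F] Xm i0 j) (t0m : ∀ j, Xm i1 j →ₗ[F] Xp i0 j)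
    (t2p : ∀ j, Xp i0 j →ₗ[F] Xm i2 j) (t2m : ∀ j, Xm i0 j →ₗ[F] Xp i2 j)
    (h0p : ∀ i, Xp i j0 →ₗ[F] Xm i j1) (h0m : ∀ i, Xm i j0 →ₗ[F] Xp i j1)
    (h1p : ∀ i, Xp i j1 →ₗ[F] Xm i j2) (h1m : ∀ i, Xm i j1 →ₗ[F] Xp i j2)
    (h2p : ∀ i, Xp i j2 →ₗ[F] Xm i j0) (h2m : Xm i1 j2 →ₗ[F] Xp i1 j0)
    (r0p : ∀ i, Xp i j1 →ₗ[F] Xm i j0) (r0m : ∀ i, Xm i j1 →ₗ[F] Xp i j0)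
    (r2p : ∀ i, Xp i j0 →ₗ[F] Xm i j2) (r2m : ∀ i, Xm i j0 →ₗ[F] Xp i j2)
    (s00p : Xp i0 j0 →ₗ[F] Xm i1 j1) (s00m : Xm i0 j0 →ₗ[F] Xp i1 j1)
    (s10m : Xm i1 j0 →ₗ[F] Xp i2 j1)
    (s11p : Xp i1 j1 →ₗ[F] Xm i2 j2) (s11m : Xm i1 j1 →ₗ[F] Xp i2 j2)
    (cv0 : dm i1 j0 ∘ₗ v0p j0 + v0m j0 ∘ₗ dp i0 j0 = 0)
    (cv1 : dp i2 j1 ∘ₗ v1m j1 + v1p j1 ∘ₗ dm i1 j1 = 0)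
    (cv1' : dm i2 j2 ∘ₗ v1p j2 + v1m j2 ∘ₗ dp i1 j2 = 0)
    (ch0 : dm i0 j1 ∘ₗ h0p i0 + h0m i0 ∘ₗ dp i0 j0 = 0)
    (ch0' : dp i1 j1 ∘ₗ h0m i1 + h0p i1 ∘ₗ dm i1 j0 = 0)
    (ch1 : dp i1 j2 ∘ₗ h1m i1 + h1p i1 ∘ₗ dm i1 j1 = 0)
    (ch1' : dm i2 j2 ∘ₗ h1p i2 + h1m i2 ∘ₗ dp i2 j1 = 0)
    (ch1'' : dp i2 j2 ∘ₗ h1m i2 + h1p i2 ∘ₗ dm i2 j1 = 0)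
    (sq00 : dm i1 j1 ∘ₗ s00p + s00m ∘ₗ dp i0 j0 = h0m i1 ∘ₗ v0p j0 + v0m j1 ∘ₗ h0p i0)
    (sq11 : dp i2 j2 ∘ₗ s11m + s11p ∘ₗ dm i1 j1 = h1p i2 ∘ₗ v1m j1 + v1p j2 ∘ₗ h1m i1)
    (col0 : dp i0 j1 ∘ₗ t0m j1 + t0p j1 ∘ₗ dm i1 j1 = v2p j1 ∘ₗ v1m j1)
    (col2p : dm i2 j0 ∘ₗ t2p j0 + t2m j0 ∘ₗ dp i0 j0 = v1m j0 ∘ₗ v0p j0)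
    (col2m : dp i2 j1 ∘ₗ t2m j1 + t2p j1 ∘ₗ dm i0 j1 = v1p j1 ∘ₗ v0m j1)
    (row0 : dp i1 j0 ∘ₗ r0m i1 + r0p i1 ∘ₗ dm i1 j1 = h2p i1 ∘ₗ h1m i1)
    (row2 : dp i1 j2 ∘ₗ r2m i1 + r2p i1 ∘ₗ dm i1 j0 = h1p i1 ∘ₗ h0m i1)
    (row2' : dp i2 j2 ∘ₗ r2m i2 + r2p i2 ∘ₗ dm i2 j0 = h1p i2 ∘ₗ h0m i2)
    (colid : ∀ x : Xm i0 j1, dm i0 j1 x = 0 →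
      ∃ y, (v2p j1 (t2m j1 x) + t0p j1 (v0m j1 x)) - x = dp i0 j1 y)
    (rowid : ∀ x : Xm i1 j0, dm i1 j0 x = 0 →
      ∃ y, (h2p i1 (r2m i1 x) + r0p i1 (h0m i1 x)) - x = dp i1 j0 y)
    (bit1 : ∀ x : Xp i0 j0, dp i0 j0 x = 0 →
      ∃ y, v1m j1 (s00p x) + s10m (v0p j0 x) + t2m j1 (h0p i0 x) + h0m i2 (t2p j0 x) =
        dm i2 j1 y)
    (bit2 : ∀ x : Xm i1 j0, dm i1 j0 x = 0 →
      ∃ y, h1p i2 (s10m x) + s11p (h0m i1 x) + r2p i2 (v1m j0 x) + v1p j2 (r2m i1 x) =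
        dp i2 j2 y)
    (V00 : Hgen F (dp i0 j0) (dm i0 j0) →ₗ[F] Hgen F (dm i1 j0) (dp i1 j0))
    (V12 : Hgen F (dp i1 j2) (dm i1 j2) →ₗ[F] Hgen F (dm i2 j2) (dp i2 j2))
    (V21 : Hgen F (dp i2 j1) (dm i2 j1) →ₗ[F] Hgen F (dm i0 j1) (dp i0 j1))
    (H00 : Hgen F (dp i0 j0) (dm i0 j0) →ₗ[F] Hgen F (dm i0 j1) (dp i0 j1))
    (H12 : Hgen F (dp i1 j2) (dm i1 j2) →ₗ[F] Hgen F (dm i1 j0) (dp i1 j0))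
    (H21 : Hgen F (dp i2 j1) (dm i2 j1) →ₗ[F] Hgen F (dm i2 j2) (dp i2 j2))
    (H10 : Hgen F (dm i1 j0) (dp i1 j0) →ₗ[F] Hgen F (dp i1 j1) (dm i1 j1))
    (eV00 : ∀ x hx hy, V00 (mkHgen F _ _ x hx) = mkHgen F _ _ (v0p j0 x) hy)
    (eV12 : ∀ x hx hy, V12 (mkHgen F _ _ x hx) = mkHgen F _ _ (v1p j2 x) hy)
    (eV21 : ∀ x hx hy, V21 (mkHgen F _ _ x hx) = mkHgen F _ _ (v2p j1 x) hy)
    (eH00 : ∀ x hx hy, H00 (mkHgen F _ _ x hx) = mkHgen F _ _ (h0p i0 x) hy)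
    (eH12 : ∀ x hx hy, H12 (mkHgen F _ _ x hx) = mkHgen F _ _ (h2p i1 x) hy)
    (eH21 : ∀ x hx hy, H21 (mkHgen F _ _ x hx) = mkHgen F _ _ (h1p i2 x) hy)
    (eH10 : ∀ x hx hy, H10 (mkHgen F _ _ x hx) = mkHgen F _ _ (h0m i1 x) hy)
    (cv2 : dm i0 j1 ∘ₗ v2p j1 + v2m ∘ₗ dp i2 j1 = 0)
    (ch2 : dm i1 j0 ∘ₗ h2p i1 + h2m ∘ₗ dp i1 j2 = 0)
    (ξ : Hgen F (dp i0 j0) (dm i0 j0)) (hξ : H10 (V00 ξ) = 0) :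
    ∃ (η : Hgen F (dp i1 j2) (dm i1 j2)) (ω : Hgen F (dp i2 j1) (dm i2 j1)),
      V00 ξ = H12 η ∧ V21 ω = H00 ξ ∧ V12 η = H21 ω := by
  obtain ⟨⟨x, hx⟩, rfl⟩ := Submodule.Quotient.mk_surjective _ ξ
  have hx0 : dp i0 j0 x = 0 := hx
  have L {M N : Type} [AddCommGroup M] [Module F M] [AddCommGroup N] [Module F N]
      {f g : M →ₗ[F] N} (h : f = g) (a : M) : f a = g a := by rw [h]
  have hvx : dm i1 j0 (v0p j0 x) = 0 := by simpa [hx0] using L cv0 x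
  have hhx : dm i0 j1 (h0p i0 x) = 0 := by simpa [hx0] using L ch0 x
  have hhvx : dp i1 j1 (h0m i1 (v0p j0 x)) = 0 := by simpa [hvx] using L ch0' (v0p j0 x)
  have hξ' : H10 (V00 (mkHgen F _ _ x hx0)) = 0 := hξ
  rw [eV00 x hx0 hvx, eH10 _ hvx hhvx] at hξ'
  obtain ⟨p, hp⟩ := mkHgen_eq_zero F _ _ _ _ hξ'
  have sqx := L sq00 x
  have sqp := L sq11 p
  have e2 := L col2p x
  have e3 := L row2' (t2p j0 x)
  have e4 := L row0 p
  have e5 := L col0 (s00p x - p)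
  have e6 := L col2m (h0p i0 x)
  have e7 := L row2 (v0p j0 x)
  have e8 := L ch1 p
  have e9 := L cv1 (s00p x - p)
  obtain ⟨y2, hy2⟩ := bit1 x hx0
  obtain ⟨y1, hy1⟩ := bit2 _ hvx
  obtain ⟨y3, hy3⟩ := rowid _ hvx
  obtain ⟨y4, hy4⟩ := colid _ hhx
  have e10 := L ch1'' y2
  have e11 := congrArg (h1p i2) hy2
  simp only [LinearMap.add_apply, LinearMap.comp_apply, LinearMap.zero_apply, hx0, map_zero,
    add_zero, map_add] at sqx sqp e2 e3 e4 e6 e7 e8 e10 e11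
  have hq : dm i1 j1 (s00p x - p) = v0m j1 (h0p i0 x) := by
    rw [map_sub, sqx, ← hp]; abel
  simp only [LinearMap.add_apply, LinearMap.comp_apply, LinearMap.zero_apply, hq] at e5 e9
  rw [← hp] at sqp e4 e8
  rw [e2] at e3
  rw [hvx, map_zero, add_zero] at e7
  rw [hhx, map_zero, add_zero] at e6
  have hy : dp i1 j2 (r2m i1 (v0p j0 x) + h1m i1 p) = 0 := by
    rw [map_add, e7, add_comm]; exact e8
  have hw : dp i2 j1 (t2m j1 (h0p i0 x) + v1m j1 (s00p x - p)) = 0 := by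
    rw [map_add, e6, add_comm]; exact e9
  have hhy : dm i1 j0 (h2p i1 (r2m i1 (v0p j0 x) + h1m i1 p)) = 0 := by
    simpa only [LinearMap.add_apply, LinearMap.comp_apply, LinearMap.zero_apply, hy, map_zero,
      add_zero] using L ch2 (r2m i1 (v0p j0 x) + h1m i1 p)
  have hvw : dm i0 j1 (v2p j1 (t2m j1 (h0p i0 x) + v1m j1 (s00p x - p))) = 0 := by
    simpa only [LinearMap.add_apply, LinearMap.comp_apply, LinearMap.zero_apply, hw, map_zero,
      add_zero] using L cv2 (t2m j1 (h0p i0 x) + v1m j1 (s00p x - p))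
  have hvy : dm i2 j2 (v1p j2 (r2m i1 (v0p j0 x) + h1m i1 p)) = 0 := by
    simpa only [LinearMap.add_apply, LinearMap.comp_apply, LinearMap.zero_apply, hy, map_zero,
      add_zero] using L cv1' (r2m i1 (v0p j0 x) + h1m i1 p)
  have hhw : dm i2 j2 (h1p i2 (t2m j1 (h0p i0 x) + v1m j1 (s00p x - p))) = 0 := by
    simpa only [LinearMap.add_apply, LinearMap.comp_apply, LinearMap.zero_apply, hw, map_zero,
      add_zero] using L ch1' (t2m j1 (h0p i0 x) + v1m j1 (s00p x - p))
  refine ⟨mkHgen F _ _ _ hy, mkHgen F _ _ _ hw, ?_, ?_, ?_⟩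
  · refine (eV00 x hx0 hvx).trans (Eq.trans ?_ (eH12 _ hy hhy).symm)
    symm
    apply mkHgen_eq_of F _ _ _ _ _ _ (y3 + r0m i1 p)
    rw [map_add, map_add, ← hy3, ← e4]
    abel
  · refine (eV21 _ hw hvw).trans (Eq.trans ?_ (eH00 x hx0 hhx).symm)
    apply mkHgen_eq_of F _ _ _ _ _ _ (y4 + t0m j1 (s00p x - p))
    rw [map_add, map_add (dp i0 j1), ← hy4, ← e5]
    abel
  · refine (eV12 _ hy hvy).trans (Eq.trans ?_ (eH21 _ hw hhw).symm)
    apply mkHgen_eq_of F _ _ _ _ _ _ (y1 + s11m p + h1m i2 y2 + r2m i2 (t2p j0 x))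
    simp only [map_add, map_sub]
    rw [← hy1]
    have k1 := eq_sub_of_add_eq sqp
    have k2 := eq_sub_of_add_eq e3
    have k3 := eq_neg_of_add_eq_zero_left e10
    rw [k1, k2, k3, ← e11]
    abel

/-- A diagonal is spanned by three positions. -/
theorem diag_exists (i j : Fin 3) (C : {p : Fin 3 × Fin 3 // p.1 + p.2 = i + j} → Type)
    [∀ p, AddCommGroup (C p)] (p0 p1 p2 : {p : Fin 3 × Fin 3 // p.1 + p.2 = i + j})
    (h01 : p0 ≠ p1) (h02 : p0 ≠ p2) (h12 : p1 ≠ p2) (a : C p0) (b : C p1) (c : C p2) :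
    ∃ z : ∀ p, C p, z p0 = a ∧ z p1 = b ∧ z p2 = c := by
  classical
  refine ⟨Function.update (Function.update (Function.update 0 p0 a) p1 b) p2 c, ?_, ?_, ?_⟩
  · rw [Function.update_of_ne h02, Function.update_of_ne h01, Function.update_self]
  · rw [Function.update_of_ne h12, Function.update_self]
  · rw [Function.update_self]

theorem fin3_cases (i : Fin 3) : i = 0 ∨ i = 1 ∨ i = 2 := by
  revert i; decide

set_option maxHeartbeats 2000000 in
/-- One parity of the main statement: a family of classes whose value at `(i, j)` is killed by
`h v` agrees there with some `δ`-closed element of the diagonal through `(i, j)`. The nine positions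
are treated separately so that each application of `bit_core` involves closed indices only; the
other parity follows by exchanging the roles of `Xp` and `Xm`. -/
theorem bit_parity
    (vp : ∀ i j, Xp i j →ₗ[F] Xm (i + 1) j) (vm : ∀ i j, Xm i j →ₗ[F] Xp (i + 1) j)
    (hp : ∀ i j, Xp i j →ₗ[F] Xm i (j + 1)) (hm : ∀ i j, Xm i j →ₗ[F] Xp i (j + 1))
    (sp : ∀ i j, Xp i j →ₗ[F] Xm (i + 1) (j + 1)) (sm : ∀ i j, Xm i j →ₗ[F] Xp (i + 1) (j + 1))
    (tp : ∀ i j, Xp (i + 1) j →ₗ[F] Xm i j) (tm : ∀ i j, Xm (i + 1) j →ₗ[F] Xp i j)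
    (rp : ∀ i j, Xp i (j + 1) →ₗ[F] Xm i j) (rm : ∀ i j, Xm i (j + 1) →ₗ[F] Xp i j)
    (cvp : ∀ i j, dm (i + 1) j ∘ₗ vp i j + vm i j ∘ₗ dp i j = 0)
    (cvm : ∀ i j, dp (i + 1) j ∘ₗ vm i j + vp i j ∘ₗ dm i j = 0)
    (chp : ∀ i j, dm i (j + 1) ∘ₗ hp i j + hm i j ∘ₗ dp i j = 0)
    (chm : ∀ i j, dp i (j + 1) ∘ₗ hm i j + hp i j ∘ₗ dm i j = 0)
    (sqp : ∀ i j, dm (i + 1) (j + 1) ∘ₗ sp i j + sm i j ∘ₗ dp i j =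
      hm (i + 1) j ∘ₗ vp i j + vm i (j + 1) ∘ₗ hp i j)
    (sqm : ∀ i j, dp (i + 1) (j + 1) ∘ₗ sm i j + sp i j ∘ₗ dm i j =
      hp (i + 1) j ∘ₗ vm i j + vp i (j + 1) ∘ₗ hm i j)
    (colp0 : ∀ j, dm 0 j ∘ₗ tp 0 j + tm 0 j ∘ₗ dp (0 + 1) j =
      (vm (0 + 2) j ∘ₗ vp (0 + 1) j : Xp (0 + 1) j →ₗ[F] Xp 0 j))
    (colm0 : ∀ j, dp 0 j ∘ₗ tm 0 j + tp 0 j ∘ₗ dm (0 + 1) j =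
      (vp (0 + 2) j ∘ₗ vm (0 + 1) j : Xm (0 + 1) j →ₗ[F] Xm 0 j))
    (rowm0 : ∀ i, dp i 0 ∘ₗ rm i 0 + rp i 0 ∘ₗ dm i (0 + 1) =
      (hp i (0 + 2) ∘ₗ hm i (0 + 1) : Xm i (0 + 1) →ₗ[F] Xm i 0))
    (colid0 : ∀ j, (∀ x : Xm 0 j, dm 0 j x = 0 →
      ∃ y, ((id (α := Xm 0 j) (vp (0 + 2) j (tm (0 + 2) j x))) + tp 0 j (vm 0 j x)) - x = dp 0 j y))
    (rowid0 : ∀ i, (∀ x : Xm i 0, dm i 0 x = 0 →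
      ∃ y, ((id (α := Xm i 0) (hp i (0 + 2) (rm i (0 + 2) x))) + rp i 0 (hm i 0 x)) - x = dp i 0 y))
    (bit10 : ∀ j, (∀ x : Xp 0 j, dp 0 j x = 0 →
      ∃ y, (id (α := Xp (0 + 2) (j + 1)) (vm (0 + 1) (j + 1) (sp 0 j x))) +
        (id (α := Xp (0 + 2) (j + 1)) (sm (0 + 1) j (vp 0 j x))) +
        tm (0 + 2) (j + 1) (hp 0 j x) + hm (0 + 2) j (tp (0 + 2) j x) =
        dm (0 + 2) (j + 1) y))
    (bit20 : ∀ i, (∀ x : Xm i 0, dm i 0 x = 0 →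
      ∃ y, (id (α := Xm (i + 1) (0 + 2)) (hp (i + 1) (0 + 1) (sm i 0 x))) +
        (id (α := Xm (i + 1) (0 + 2)) (sp i (0 + 1) (hm i 0 x))) +
        rp (i + 1) (0 + 2) (vm i 0 x) + vp i (0 + 2) (rm i (0 + 2) x) =
        dp (i + 1) (0 + 2) y))
    (colp1 : ∀ j, dm 1 j ∘ₗ tp 1 j + tm 1 j ∘ₗ dp (1 + 1) j =
      (vm (1 + 2) j ∘ₗ vp (1 + 1) j : Xp (1 + 1) j →ₗ[F] Xp 1 j))
    (colm1 : ∀ j, dp 1 j ∘ₗ tm 1 j + tp 1 j ∘ₗ dm (1 + 1) j =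
      (vp (1 + 2) j ∘ₗ vm (1 + 1) j : Xm (1 + 1) j →ₗ[F] Xm 1 j))
    (rowm1 : ∀ i, dp i 1 ∘ₗ rm i 1 + rp i 1 ∘ₗ dm i (1 + 1) =
      (hp i (1 + 2) ∘ₗ hm i (1 + 1) : Xm i (1 + 1) →ₗ[F] Xm i 1))
    (colid1 : ∀ j, (∀ x : Xm 1 j, dm 1 j x = 0 →
      ∃ y, ((id (α := Xm 1 j) (vp (1 + 2) j (tm (1 + 2) j x))) + tp 1 j (vm 1 j x)) - x = dp 1 j y))
    (rowid1 : ∀ i, (∀ x : Xm i 1, dm i 1 x = 0 →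
      ∃ y, ((id (α := Xm i 1) (hp i (1 + 2) (rm i (1 + 2) x))) + rp i 1 (hm i 1 x)) - x = dp i 1 y))
    (bit11 : ∀ j, (∀ x : Xp 1 j, dp 1 j x = 0 →
      ∃ y, (id (α := Xp (1 + 2) (j + 1)) (vm (1 + 1) (j + 1) (sp 1 j x))) +
        (id (α := Xp (1 + 2) (j + 1)) (sm (1 + 1) j (vp 1 j x))) +
        tm (1 + 2) (j + 1) (hp 1 j x) + hm (1 + 2) j (tp (1 + 2) j x) =
        dm (1 + 2) (j + 1) y))
    (bit21 : ∀ i, (∀ x : Xm i 1, dm i 1 x = 0 →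
      ∃ y, (id (α := Xm (i + 1) (1 + 2)) (hp (i + 1) (1 + 1) (sm i 1 x))) +
        (id (α := Xm (i + 1) (1 + 2)) (sp i (1 + 1) (hm i 1 x))) +
        rp (i + 1) (1 + 2) (vm i 1 x) + vp i (1 + 2) (rm i (1 + 2) x) =
        dp (i + 1) (1 + 2) y))
    (colp2 : ∀ j, dm 2 j ∘ₗ tp 2 j + tm 2 j ∘ₗ dp (2 + 1) j =
      (vm (2 + 2) j ∘ₗ vp (2 + 1) j : Xp (2 + 1) j →ₗ[F] Xp 2 j))
    (colm2 : ∀ j, dp 2 j ∘ₗ tm 2 j + tp 2 j ∘ₗ dm (2 + 1) j =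
      (vp (2 + 2) j ∘ₗ vm (2 + 1) j : Xm (2 + 1) j →ₗ[F] Xm 2 j))
    (rowm2 : ∀ i, dp i 2 ∘ₗ rm i 2 + rp i 2 ∘ₗ dm i (2 + 1) =
      (hp i (2 + 2) ∘ₗ hm i (2 + 1) : Xm i (2 + 1) →ₗ[F] Xm i 2))
    (colid2 : ∀ j, (∀ x : Xm 2 j, dm 2 j x = 0 →
      ∃ y, ((id (α := Xm 2 j) (vp (2 + 2) j (tm (2 + 2) j x))) + tp 2 j (vm 2 j x)) - x = dp 2 j y))
    (rowid2 : ∀ i, (∀ x : Xm i 2, dm i 2 x = 0 →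
      ∃ y, ((id (α := Xm i 2) (hp i (2 + 2) (rm i (2 + 2) x))) + rp i 2 (hm i 2 x)) - x = dp i 2 y))
    (bit12 : ∀ j, (∀ x : Xp 2 j, dp 2 j x = 0 →
      ∃ y, (id (α := Xp (2 + 2) (j + 1)) (vm (2 + 1) (j + 1) (sp 2 j x))) +
        (id (α := Xp (2 + 2) (j + 1)) (sm (2 + 1) j (vp 2 j x))) +
        tm (2 + 2) (j + 1) (hp 2 j x) + hm (2 + 2) j (tp (2 + 2) j x) =
        dm (2 + 2) (j + 1) y))
    (bit22 : ∀ i, (∀ x : Xm i 2, dm i 2 x = 0 →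
      ∃ y, (id (α := Xm (i + 1) (2 + 2)) (hp (i + 1) (2 + 1) (sm i 2 x))) +
        (id (α := Xm (i + 1) (2 + 2)) (sp i (2 + 1) (hm i 2 x))) +
        rp (i + 1) (2 + 2) (vm i 2 x) + vp i (2 + 2) (rm i (2 + 2) x) =
        dp (i + 1) (2 + 2) y))
    (vHp : ∀ i j, Hgen F (dp (i + 2) j) (dm (i + 2) j) →ₗ[F] Hgen F (dm i j) (dp i j))
    (hHp : ∀ i j, Hgen F (dp i (j + 2)) (dm i (j + 2)) →ₗ[F] Hgen F (dm i j) (dp i j))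
    (hHm : ∀ i j, Hgen F (dm i (j + 2)) (dp i (j + 2)) →ₗ[F] Hgen F (dp i j) (dm i j))
    (eV0 : ∀ j x hx hy, vHp 0 j (mkHgen F (dp (0 + 2) j) (dm (0 + 2) j) x hx) =
      mkHgen F (dm 0 j) (dp 0 j) (vp (0 + 2) j x) hy)
    (eHp0 : ∀ i x hx hy, hHp i 0 (mkHgen F (dp i (0 + 2)) (dm i (0 + 2)) x hx) =
      mkHgen F (dm i 0) (dp i 0) (hp i (0 + 2) x) hy)
    (eHm0 : ∀ i x hx hy, hHm i 0 (mkHgen F (dm i (0 + 2)) (dp i (0 + 2)) x hx) =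
      mkHgen F (dp i 0) (dm i 0) (hm i (0 + 2) x) hy)
    (eV1 : ∀ j x hx hy, vHp 1 j (mkHgen F (dp (1 + 2) j) (dm (1 + 2) j) x hx) =
      mkHgen F (dm 1 j) (dp 1 j) (vp (1 + 2) j x) hy)
    (eHp1 : ∀ i x hx hy, hHp i 1 (mkHgen F (dp i (1 + 2)) (dm i (1 + 2)) x hx) =
      mkHgen F (dm i 1) (dp i 1) (hp i (1 + 2) x) hy)
    (eHm1 : ∀ i x hx hy, hHm i 1 (mkHgen F (dm i (1 + 2)) (dp i (1 + 2)) x hx) =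
      mkHgen F (dp i 1) (dm i 1) (hm i (1 + 2) x) hy)
    (eV2 : ∀ j x hx hy, vHp 2 j (mkHgen F (dp (2 + 2) j) (dm (2 + 2) j) x hx) =
      mkHgen F (dm 2 j) (dp 2 j) (vp (2 + 2) j x) hy)
    (eHp2 : ∀ i x hx hy, hHp i 2 (mkHgen F (dp i (2 + 2)) (dm i (2 + 2)) x hx) =
      mkHgen F (dm i 2) (dp i 2) (hp i (2 + 2) x) hy)
    (eHm2 : ∀ i x hx hy, hHm i 2 (mkHgen F (dm i (2 + 2)) (dp i (2 + 2)) x hx) =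
      mkHgen F (dp i 2) (dm i 2) (hm i (2 + 2) x) hy)
    (i j : Fin 3) (x : P9p F Xp Xm dp dm)
    (hx : ∀ a b, hHm a b (vHp a (b + 2) (x (a + 2, b + 2))) = 0) :
    ∃ z : ∀ p : {p : Fin 3 × Fin 3 // p.1 + p.2 = i + j}, Hgen F (dp p.1.1 p.1.2) (dm p.1.1 p.1.2),
      z ⟨(i, j), rfl⟩ = x (i, j) ∧
      ∀ (a b : Fin 3) (pfv : (a + 2) + b = i + j) (pfh : a + (b + 2) = i + j),
        vHp a b (z ⟨(a + 2, b), pfv⟩) = hHp a b (z ⟨(a, b + 2), pfh⟩) := by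
  have key : ∃ (η : Hgen F (dp (i + 1) (j + 2)) (dm (i + 1) (j + 2)))
      (ω : Hgen F (dp (i + 2) (j + 1)) (dm (i + 2) (j + 1))),
      ∀ z : ∀ p : {p : Fin 3 × Fin 3 // p.1 + p.2 = i + j},
        Hgen F (dp p.1.1 p.1.2) (dm p.1.1 p.1.2),
      z ⟨(i, j), rfl⟩ = x (i, j) → (∀ pf, z ⟨(i + 1, j + 2), pf⟩ = η) →
      (∀ pf, z ⟨(i + 2, j + 1), pf⟩ = ω) →
      ∀ (a b : Fin 3) (pfv : (a + 2) + b = i + j) (pfh : a + (b + 2) = i + j),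
        vHp a b (z ⟨(a + 2, b), pfv⟩) = hHp a b (z ⟨(a, b + 2), pfh⟩) := by
    rcases fin3_cases i with rfl | rfl | rfl <;> rcases fin3_cases j with rfl | rfl | rfl
    · obtain ⟨η, ω, e1, e2, e3⟩ := bit_core F Xp Xm dp dm 0 1 2 0 1 2
        (vp 0) (vm 0) (vp 1) (vm 1) (vp 2) (vm 2 1)
        (tp 0) (tm 0) (tp 2) (tm 2)
        (fun i => hp i 0) (fun i => hm i 0) (fun i => hp i 1) (fun i => hm i 1) (fun i => hp i 2) (hm 1 2)
        (fun i => rp i 0) (fun i => rm i 0) (fun i => rp i 2) (fun i => rm i 2)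
        (sp 0 0) (sm 0 0) (sm 1 0) (sp 1 1) (sm 1 1)
        (cvp 0 0) (cvm 1 1) (cvp 1 2)
        (chp 0 0) (chm 1 0) (chm 1 1) (chp 2 1) (chm 2 1)
        (sqp 0 0) (sqm 1 1) (colm0 1) (colp2 0) (colm2 1)
        (rowm0 1) (rowm2 1) (rowm2 2)
        (colid0 1) (rowid0 1) (bit10 0) (bit20 1)
        (vHp 1 0) (vHp 2 2) (vHp 0 1) (hHp 0 1) (hHp 1 0) (hHp 2 2)
        (hHm 1 1) (eV1 0) (eV2 2) (eV0 1) (eHp1 0) (eHp0 1) (eHp2 2)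
        (eHm1 1) (cvp 2 1) (chp 1 2) (x (0, 0)) (hx 1 1)
      refine ⟨η, ω, fun z h0 h1 h2 a b pfv pfh => ?_⟩
      have g1 := (congrArg (vHp 1 0) h0).trans (e1.trans (congrArg (hHp 1 0) (h1 rfl)).symm)
      have g2 := (congrArg (vHp 0 1) (h2 rfl)).trans (e2.trans (congrArg (hHp 0 1) h0).symm)
      have g3 := (congrArg (vHp 2 2) (h1 rfl)).trans (e3.trans (congrArg (hHp 2 2) (h2 rfl)).symm)
      obtain ⟨rfl, rfl⟩ | ⟨rfl, rfl⟩ | ⟨rfl, rfl⟩ :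
          (a = 1 ∧ b = 0) ∨ (a = 0 ∧ b = 1) ∨ (a = 2 ∧ b = 2) := by
        clear * - pfv; revert a b; decide
      exacts [g1, g2, g3]
    · obtain ⟨η, ω, e1, e2, e3⟩ := bit_core F Xp Xm dp dm 0 1 2 1 2 0
        (vp 0) (vm 0) (vp 1) (vm 1) (vp 2) (vm 2 2)
        (tp 0) (tm 0) (tp 2) (tm 2)
        (fun i => hp i 1) (fun i => hm i 1) (fun i => hp i 2) (fun i => hm i 2) (fun i => hp i 0) (hm 1 0)
        (fun i => rp i 1) (fun i => rm i 1) (fun i => rp i 0) (fun i => rm i 0)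
        (sp 0 1) (sm 0 1) (sm 1 1) (sp 1 2) (sm 1 2)
        (cvp 0 1) (cvm 1 2) (cvp 1 0)
        (chp 0 1) (chm 1 1) (chm 1 2) (chp 2 2) (chm 2 2)
        (sqp 0 1) (sqm 1 2) (colm0 2) (colp2 1) (colm2 2)
        (rowm1 1) (rowm0 1) (rowm0 2)
        (colid0 2) (rowid1 1) (bit10 1) (bit21 1)
        (vHp 1 1) (vHp 2 0) (vHp 0 2) (hHp 0 2) (hHp 1 1) (hHp 2 0)
        (hHm 1 2) (eV1 1) (eV2 0) (eV0 2) (eHp2 0) (eHp1 1) (eHp0 2)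
        (eHm2 1) (cvp 2 2) (chp 1 0) (x (0, 1)) (hx 1 2)
      refine ⟨η, ω, fun z h0 h1 h2 a b pfv pfh => ?_⟩
      have g1 := (congrArg (vHp 1 1) h0).trans (e1.trans (congrArg (hHp 1 1) (h1 rfl)).symm)
      have g2 := (congrArg (vHp 0 2) (h2 rfl)).trans (e2.trans (congrArg (hHp 0 2) h0).symm)
      have g3 := (congrArg (vHp 2 0) (h1 rfl)).trans (e3.trans (congrArg (hHp 2 0) (h2 rfl)).symm)
      obtain ⟨rfl, rfl⟩ | ⟨rfl, rfl⟩ | ⟨rfl, rfl⟩ :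
          (a = 1 ∧ b = 1) ∨ (a = 0 ∧ b = 2) ∨ (a = 2 ∧ b = 0) := by
        clear * - pfv; revert a b; decide
      exacts [g1, g2, g3]
    · obtain ⟨η, ω, e1, e2, e3⟩ := bit_core F Xp Xm dp dm 0 1 2 2 0 1
        (vp 0) (vm 0) (vp 1) (vm 1) (vp 2) (vm 2 0)
        (tp 0) (tm 0) (tp 2) (tm 2)
        (fun i => hp i 2) (fun i => hm i 2) (fun i => hp i 0) (fun i => hm i 0) (fun i => hp i 1) (hm 1 1)
        (fun i => rp i 2) (fun i => rm i 2) (fun i => rp i 1) (fun i => rm i 1)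
        (sp 0 2) (sm 0 2) (sm 1 2) (sp 1 0) (sm 1 0)
        (cvp 0 2) (cvm 1 0) (cvp 1 1)
        (chp 0 2) (chm 1 2) (chm 1 0) (chp 2 0) (chm 2 0)
        (sqp 0 2) (sqm 1 0) (colm0 0) (colp2 2) (colm2 0)
        (rowm2 1) (rowm1 1) (rowm1 2)
        (colid0 0) (rowid2 1) (bit10 2) (bit22 1)
        (vHp 1 2) (vHp 2 1) (vHp 0 0) (hHp 0 0) (hHp 1 2) (hHp 2 1)
        (hHm 1 0) (eV1 2) (eV2 1) (eV0 0) (eHp0 0) (eHp2 1) (eHp1 2)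
        (eHm0 1) (cvp 2 0) (chp 1 1) (x (0, 2)) (hx 1 0)
      refine ⟨η, ω, fun z h0 h1 h2 a b pfv pfh => ?_⟩
      have g1 := (congrArg (vHp 1 2) h0).trans (e1.trans (congrArg (hHp 1 2) (h1 rfl)).symm)
      have g2 := (congrArg (vHp 0 0) (h2 rfl)).trans (e2.trans (congrArg (hHp 0 0) h0).symm)
      have g3 := (congrArg (vHp 2 1) (h1 rfl)).trans (e3.trans (congrArg (hHp 2 1) (h2 rfl)).symm)
      obtain ⟨rfl, rfl⟩ | ⟨rfl, rfl⟩ | ⟨rfl, rfl⟩ :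
          (a = 1 ∧ b = 2) ∨ (a = 0 ∧ b = 0) ∨ (a = 2 ∧ b = 1) := by
        clear * - pfv; revert a b; decide
      exacts [g1, g2, g3]
    · obtain ⟨η, ω, e1, e2, e3⟩ := bit_core F Xp Xm dp dm 1 2 0 0 1 2
        (vp 1) (vm 1) (vp 2) (vm 2) (vp 0) (vm 0 1)
        (tp 1) (tm 1) (tp 0) (tm 0)
        (fun i => hp i 0) (fun i => hm i 0) (fun i => hp i 1) (fun i => hm i 1) (fun i => hp i 2) (hm 2 2)
        (fun i => rp i 0) (fun i => rm i 0) (fun i => rp i 2) (fun i => rm i 2)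
        (sp 1 0) (sm 1 0) (sm 2 0) (sp 2 1) (sm 2 1)
        (cvp 1 0) (cvm 2 1) (cvp 2 2)
        (chp 1 0) (chm 2 0) (chm 2 1) (chp 0 1) (chm 0 1)
        (sqp 1 0) (sqm 2 1) (colm1 1) (colp0 0) (colm0 1)
        (rowm0 2) (rowm2 2) (rowm2 0)
        (colid1 1) (rowid0 2) (bit11 0) (bit20 2)
        (vHp 2 0) (vHp 0 2) (vHp 1 1) (hHp 1 1) (hHp 2 0) (hHp 0 2)
        (hHm 2 1) (eV2 0) (eV0 2) (eV1 1) (eHp1 1) (eHp0 2) (eHp2 0)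
        (eHm1 2) (cvp 0 1) (chp 2 2) (x (1, 0)) (hx 2 1)
      refine ⟨η, ω, fun z h0 h1 h2 a b pfv pfh => ?_⟩
      have g1 := (congrArg (vHp 2 0) h0).trans (e1.trans (congrArg (hHp 2 0) (h1 rfl)).symm)
      have g2 := (congrArg (vHp 1 1) (h2 rfl)).trans (e2.trans (congrArg (hHp 1 1) h0).symm)
      have g3 := (congrArg (vHp 0 2) (h1 rfl)).trans (e3.trans (congrArg (hHp 0 2) (h2 rfl)).symm)
      obtain ⟨rfl, rfl⟩ | ⟨rfl, rfl⟩ | ⟨rfl, rfl⟩ :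
          (a = 2 ∧ b = 0) ∨ (a = 1 ∧ b = 1) ∨ (a = 0 ∧ b = 2) := by
        clear * - pfv; revert a b; decide
      exacts [g1, g2, g3]
    · obtain ⟨η, ω, e1, e2, e3⟩ := bit_core F Xp Xm dp dm 1 2 0 1 2 0
        (vp 1) (vm 1) (vp 2) (vm 2) (vp 0) (vm 0 2)
        (tp 1) (tm 1) (tp 0) (tm 0)
        (fun i => hp i 1) (fun i => hm i 1) (fun i => hp i 2) (fun i => hm i 2) (fun i => hp i 0) (hm 2 0)
        (fun i => rp i 1) (fun i => rm i 1) (fun i => rp i 0) (fun i => rm i 0)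
        (sp 1 1) (sm 1 1) (sm 2 1) (sp 2 2) (sm 2 2)
        (cvp 1 1) (cvm 2 2) (cvp 2 0)
        (chp 1 1) (chm 2 1) (chm 2 2) (chp 0 2) (chm 0 2)
        (sqp 1 1) (sqm 2 2) (colm1 2) (colp0 1) (colm0 2)
        (rowm1 2) (rowm0 2) (rowm0 0)
        (colid1 2) (rowid1 2) (bit11 1) (bit21 2)
        (vHp 2 1) (vHp 0 0) (vHp 1 2) (hHp 1 2) (hHp 2 1) (hHp 0 0)
        (hHm 2 2) (eV2 1) (eV0 0) (eV1 2) (eHp2 1) (eHp1 2) (eHp0 0)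
        (eHm2 2) (cvp 0 2) (chp 2 0) (x (1, 1)) (hx 2 2)
      refine ⟨η, ω, fun z h0 h1 h2 a b pfv pfh => ?_⟩
      have g1 := (congrArg (vHp 2 1) h0).trans (e1.trans (congrArg (hHp 2 1) (h1 rfl)).symm)
      have g2 := (congrArg (vHp 1 2) (h2 rfl)).trans (e2.trans (congrArg (hHp 1 2) h0).symm)
      have g3 := (congrArg (vHp 0 0) (h1 rfl)).trans (e3.trans (congrArg (hHp 0 0) (h2 rfl)).symm)
      obtain ⟨rfl, rfl⟩ | ⟨rfl, rfl⟩ | ⟨rfl, rfl⟩ :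
          (a = 2 ∧ b = 1) ∨ (a = 1 ∧ b = 2) ∨ (a = 0 ∧ b = 0) := by
        clear * - pfv; revert a b; decide
      exacts [g1, g2, g3]
    · obtain ⟨η, ω, e1, e2, e3⟩ := bit_core F Xp Xm dp dm 1 2 0 2 0 1
        (vp 1) (vm 1) (vp 2) (vm 2) (vp 0) (vm 0 0)
        (tp 1) (tm 1) (tp 0) (tm 0)
        (fun i => hp i 2) (fun i => hm i 2) (fun i => hp i 0) (fun i => hm i 0) (fun i => hp i 1) (hm 2 1)
        (fun i => rp i 2) (fun i => rm i 2) (fun i => rp i 1) (fun i => rm i 1)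
        (sp 1 2) (sm 1 2) (sm 2 2) (sp 2 0) (sm 2 0)
        (cvp 1 2) (cvm 2 0) (cvp 2 1)
        (chp 1 2) (chm 2 2) (chm 2 0) (chp 0 0) (chm 0 0)
        (sqp 1 2) (sqm 2 0) (colm1 0) (colp0 2) (colm0 0)
        (rowm2 2) (rowm1 2) (rowm1 0)
        (colid1 0) (rowid2 2) (bit11 2) (bit22 2)
        (vHp 2 2) (vHp 0 1) (vHp 1 0) (hHp 1 0) (hHp 2 2) (hHp 0 1)
        (hHm 2 0) (eV2 2) (eV0 1) (eV1 0) (eHp0 1) (eHp2 2) (eHp1 0)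
        (eHm0 2) (cvp 0 0) (chp 2 1) (x (1, 2)) (hx 2 0)
      refine ⟨η, ω, fun z h0 h1 h2 a b pfv pfh => ?_⟩
      have g1 := (congrArg (vHp 2 2) h0).trans (e1.trans (congrArg (hHp 2 2) (h1 rfl)).symm)
      have g2 := (congrArg (vHp 1 0) (h2 rfl)).trans (e2.trans (congrArg (hHp 1 0) h0).symm)
      have g3 := (congrArg (vHp 0 1) (h1 rfl)).trans (e3.trans (congrArg (hHp 0 1) (h2 rfl)).symm)
      obtain ⟨rfl, rfl⟩ | ⟨rfl, rfl⟩ | ⟨rfl, rfl⟩ :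
          (a = 2 ∧ b = 2) ∨ (a = 1 ∧ b = 0) ∨ (a = 0 ∧ b = 1) := by
        clear * - pfv; revert a b; decide
      exacts [g1, g2, g3]
    · obtain ⟨η, ω, e1, e2, e3⟩ := bit_core F Xp Xm dp dm 2 0 1 0 1 2
        (vp 2) (vm 2) (vp 0) (vm 0) (vp 1) (vm 1 1)
        (tp 2) (tm 2) (tp 1) (tm 1)
        (fun i => hp i 0) (fun i => hm i 0) (fun i => hp i 1) (fun i => hm i 1) (fun i => hp i 2) (hm 0 2)
        (fun i => rp i 0) (fun i => rm i 0) (fun i => rp i 2) (fun i => rm i 2)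
        (sp 2 0) (sm 2 0) (sm 0 0) (sp 0 1) (sm 0 1)
        (cvp 2 0) (cvm 0 1) (cvp 0 2)
        (chp 2 0) (chm 0 0) (chm 0 1) (chp 1 1) (chm 1 1)
        (sqp 2 0) (sqm 0 1) (colm2 1) (colp1 0) (colm1 1)
        (rowm0 0) (rowm2 0) (rowm2 1)
        (colid2 1) (rowid0 0) (bit12 0) (bit20 0)
        (vHp 0 0) (vHp 1 2) (vHp 2 1) (hHp 2 1) (hHp 0 0) (hHp 1 2)
        (hHm 0 1) (eV0 0) (eV1 2) (eV2 1) (eHp1 2) (eHp0 0) (eHp2 1)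
        (eHm1 0) (cvp 1 1) (chp 0 2) (x (2, 0)) (hx 0 1)
      refine ⟨η, ω, fun z h0 h1 h2 a b pfv pfh => ?_⟩
      have g1 := (congrArg (vHp 0 0) h0).trans (e1.trans (congrArg (hHp 0 0) (h1 rfl)).symm)
      have g2 := (congrArg (vHp 2 1) (h2 rfl)).trans (e2.trans (congrArg (hHp 2 1) h0).symm)
      have g3 := (congrArg (vHp 1 2) (h1 rfl)).trans (e3.trans (congrArg (hHp 1 2) (h2 rfl)).symm)
      obtain ⟨rfl, rfl⟩ | ⟨rfl, rfl⟩ | ⟨rfl, rfl⟩ :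
          (a = 0 ∧ b = 0) ∨ (a = 2 ∧ b = 1) ∨ (a = 1 ∧ b = 2) := by
        clear * - pfv; revert a b; decide
      exacts [g1, g2, g3]
    · obtain ⟨η, ω, e1, e2, e3⟩ := bit_core F Xp Xm dp dm 2 0 1 1 2 0
        (vp 2) (vm 2) (vp 0) (vm 0) (vp 1) (vm 1 2)
        (tp 2) (tm 2) (tp 1) (tm 1)
        (fun i => hp i 1) (fun i => hm i 1) (fun i => hp i 2) (fun i => hm i 2) (fun i => hp i 0) (hm 0 0)
        (fun i => rp i 1) (fun i => rm i 1) (fun i => rp i 0) (fun i => rm i 0)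
        (sp 2 1) (sm 2 1) (sm 0 1) (sp 0 2) (sm 0 2)
        (cvp 2 1) (cvm 0 2) (cvp 0 0)
        (chp 2 1) (chm 0 1) (chm 0 2) (chp 1 2) (chm 1 2)
        (sqp 2 1) (sqm 0 2) (colm2 2) (colp1 1) (colm1 2)
        (rowm1 0) (rowm0 0) (rowm0 1)
        (colid2 2) (rowid1 0) (bit12 1) (bit21 0)
        (vHp 0 1) (vHp 1 0) (vHp 2 2) (hHp 2 2) (hHp 0 1) (hHp 1 0)
        (hHm 0 2) (eV0 1) (eV1 0) (eV2 2) (eHp2 2) (eHp1 0) (eHp0 1)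
        (eHm2 0) (cvp 1 2) (chp 0 0) (x (2, 1)) (hx 0 2)
      refine ⟨η, ω, fun z h0 h1 h2 a b pfv pfh => ?_⟩
      have g1 := (congrArg (vHp 0 1) h0).trans (e1.trans (congrArg (hHp 0 1) (h1 rfl)).symm)
      have g2 := (congrArg (vHp 2 2) (h2 rfl)).trans (e2.trans (congrArg (hHp 2 2) h0).symm)
      have g3 := (congrArg (vHp 1 0) (h1 rfl)).trans (e3.trans (congrArg (hHp 1 0) (h2 rfl)).symm)
      obtain ⟨rfl, rfl⟩ | ⟨rfl, rfl⟩ | ⟨rfl, rfl⟩ :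
          (a = 0 ∧ b = 1) ∨ (a = 2 ∧ b = 2) ∨ (a = 1 ∧ b = 0) := by
        clear * - pfv; revert a b; decide
      exacts [g1, g2, g3]
    · obtain ⟨η, ω, e1, e2, e3⟩ := bit_core F Xp Xm dp dm 2 0 1 2 0 1
        (vp 2) (vm 2) (vp 0) (vm 0) (vp 1) (vm 1 0)
        (tp 2) (tm 2) (tp 1) (tm 1)
        (fun i => hp i 2) (fun i => hm i 2) (fun i => hp i 0) (fun i => hm i 0) (fun i => hp i 1) (hm 0 1)
        (fun i => rp i 2) (fun i => rm i 2) (fun i => rp i 1) (fun i => rm i 1)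
        (sp 2 2) (sm 2 2) (sm 0 2) (sp 0 0) (sm 0 0)
        (cvp 2 2) (cvm 0 0) (cvp 0 1)
        (chp 2 2) (chm 0 2) (chm 0 0) (chp 1 0) (chm 1 0)
        (sqp 2 2) (sqm 0 0) (colm2 0) (colp1 2) (colm1 0)
        (rowm2 0) (rowm1 0) (rowm1 1)
        (colid2 0) (rowid2 0) (bit12 2) (bit22 0)
        (vHp 0 2) (vHp 1 1) (vHp 2 0) (hHp 2 0) (hHp 0 2) (hHp 1 1)
        (hHm 0 0) (eV0 2) (eV1 1) (eV2 0) (eHp0 2) (eHp2 0) (eHp1 1)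
        (eHm0 0) (cvp 1 0) (chp 0 1) (x (2, 2)) (hx 0 0)
      refine ⟨η, ω, fun z h0 h1 h2 a b pfv pfh => ?_⟩
      have g1 := (congrArg (vHp 0 2) h0).trans (e1.trans (congrArg (hHp 0 2) (h1 rfl)).symm)
      have g2 := (congrArg (vHp 2 0) (h2 rfl)).trans (e2.trans (congrArg (hHp 2 0) h0).symm)
      have g3 := (congrArg (vHp 1 1) (h1 rfl)).trans (e3.trans (congrArg (hHp 1 1) (h2 rfl)).symm)
      obtain ⟨rfl, rfl⟩ | ⟨rfl, rfl⟩ | ⟨rfl, rfl⟩ :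
          (a = 0 ∧ b = 2) ∨ (a = 2 ∧ b = 0) ∨ (a = 1 ∧ b = 1) := by
        clear * - pfv; revert a b; decide
      exacts [g1, g2, g3]
  obtain ⟨η, ω, h⟩ := key
  have q1 : (i + 1) + (j + 2) = i + j := by clear * -; revert i j; decide
  have q2 : (i + 2) + (j + 1) = i + j := by clear * -; revert i j; decide
  have n01 : i ≠ i + 1 := by clear * -; revert i; decide
  have n02 : i ≠ i + 2 := by clear * -; revert i; decide
  have n12 : i + 1 ≠ i + 2 := by clear * -; revert i; decide
  obtain ⟨z, hz0, hz1, hz2⟩ := diag_exists i j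
    (fun p => Hgen F (dp p.1.1 p.1.2) (dm p.1.1 p.1.2)) ⟨(i, j), rfl⟩ ⟨(i + 1, j + 2), q1⟩
    ⟨(i + 2, j + 1), q2⟩
    (fun e => n01 (congrArg (fun p => p.1.1) e)) (fun e => n02 (congrArg (fun p => p.1.1) e))
    (fun e => n12 (congrArg (fun p => p.1.1) e)) (x (i, j)) η ω
  exact ⟨z, hz0, h z hz0 (fun _ => hz1) (fun _ => hz2)⟩

set_option maxHeartbeats 2000000 in
/-- For a homotopy exact odd bitriangle `(X, v, h)` with finite
dimensional homology and `δ = v − h` on the diagonal complexes `D_k`, the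
projection `P_{ij}` (for `i + j ≡ k`) induces a surjective map from
`H_δ(H(D_k))` onto `P_{ij}(Ker(vh)/(Ker v + Ker h))`, expressed elementwise. -/
theorem bitriangle_diagonal_projection_surjective
    (vp : ∀ i j, Xp i j →ₗ[F] Xm (i + 1) j) (vm : ∀ i j, Xm i j →ₗ[F] Xp (i + 1) j)
    (hp : ∀ i j, Xp i j →ₗ[F] Xm i (j + 1)) (hm : ∀ i j, Xm i j →ₗ[F] Xp i (j + 1))
    (sp : ∀ i j, Xp i j →ₗ[F] Xm (i + 1) (j + 1)) (sm : ∀ i j, Xm i j →ₗ[F] Xp (i + 1) (j + 1))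
    (tp : ∀ i j, Xp (i + 1) j →ₗ[F] Xm i j) (tm : ∀ i j, Xm (i + 1) j →ₗ[F] Xp i j)
    (rp : ∀ i j, Xp i (j + 1) →ₗ[F] Xm i j) (rm : ∀ i j, Xm i (j + 1) →ₗ[F] Xp i j)
    (hd : ∀ i j, dm i j ∘ₗ dp i j = 0 ∧ dp i j ∘ₗ dm i j = 0)
    (hvchain : ∀ i j, dm (i + 1) j ∘ₗ vp i j + vm i j ∘ₗ dp i j = 0 ∧ dp (i + 1) j ∘ₗ vm i j + vp i j ∘ₗ dm i j = 0)
    (hhchain : ∀ i j, dm i (j + 1) ∘ₗ hp i j + hm i j ∘ₗ dp i j = 0 ∧ dp i (j + 1) ∘ₗ hm i j + hp i j ∘ₗ dm i j = 0)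
    (hsq : ∀ i j, dm (i + 1) (j + 1) ∘ₗ sp i j + sm i j ∘ₗ dp i j =
      hm (i + 1) j ∘ₗ vp i j + vm i (j + 1) ∘ₗ hp i j ∧
      dp (i + 1) (j + 1) ∘ₗ sm i j + sp i j ∘ₗ dm i j =
      hp (i + 1) j ∘ₗ vm i j + vp i (j + 1) ∘ₗ hm i j)
    (hcol0 : ∀ j, dm 0 j ∘ₗ tp 0 j + tm 0 j ∘ₗ dp (0 + 1) j =
      (vm (0 + 2) j ∘ₗ vp (0 + 1) j : Xp (0 + 1) j →ₗ[F] Xp 0 j) ∧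
      dp 0 j ∘ₗ tm 0 j + tp 0 j ∘ₗ dm (0 + 1) j =
      (vp (0 + 2) j ∘ₗ vm (0 + 1) j : Xm (0 + 1) j →ₗ[F] Xm 0 j))
    (hcol1 : ∀ j, dm 1 j ∘ₗ tp 1 j + tm 1 j ∘ₗ dp (1 + 1) j =
      (vm (1 + 2) j ∘ₗ vp (1 + 1) j : Xp (1 + 1) j →ₗ[F] Xp 1 j) ∧
      dp 1 j ∘ₗ tm 1 j + tp 1 j ∘ₗ dm (1 + 1) j =
      (vp (1 + 2) j ∘ₗ vm (1 + 1) j : Xm (1 + 1) j →ₗ[F] Xm 1 j))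
    (hcol2 : ∀ j, dm 2 j ∘ₗ tp 2 j + tm 2 j ∘ₗ dp (2 + 1) j =
      (vm (2 + 2) j ∘ₗ vp (2 + 1) j : Xp (2 + 1) j →ₗ[F] Xp 2 j) ∧
      dp 2 j ∘ₗ tm 2 j + tp 2 j ∘ₗ dm (2 + 1) j =
      (vp (2 + 2) j ∘ₗ vm (2 + 1) j : Xm (2 + 1) j →ₗ[F] Xm 2 j))
    (hcolid0 : ∀ j, (∀ x : Xp 0 j, dp 0 j x = 0 →
      ∃ y, ((id (α := Xp 0 j) (vm (0 + 2) j (tp (0 + 2) j x))) + tm 0 j (vp 0 j x)) - x = dm 0 j y) ∧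
      (∀ x : Xm 0 j, dm 0 j x = 0 →
      ∃ y, ((id (α := Xm 0 j) (vp (0 + 2) j (tm (0 + 2) j x))) + tp 0 j (vm 0 j x)) - x = dp 0 j y))
    (hcolid1 : ∀ j, (∀ x : Xp 1 j, dp 1 j x = 0 →
      ∃ y, ((id (α := Xp 1 j) (vm (1 + 2) j (tp (1 + 2) j x))) + tm 1 j (vp 1 j x)) - x = dm 1 j y) ∧
      (∀ x : Xm 1 j, dm 1 j x = 0 →
      ∃ y, ((id (α := Xm 1 j) (vp (1 + 2) j (tm (1 + 2) j x))) + tp 1 j (vm 1 j x)) - x = dp 1 j y))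
    (hcolid2 : ∀ j, (∀ x : Xp 2 j, dp 2 j x = 0 →
      ∃ y, ((id (α := Xp 2 j) (vm (2 + 2) j (tp (2 + 2) j x))) + tm 2 j (vp 2 j x)) - x = dm 2 j y) ∧
      (∀ x : Xm 2 j, dm 2 j x = 0 →
      ∃ y, ((id (α := Xm 2 j) (vp (2 + 2) j (tm (2 + 2) j x))) + tp 2 j (vm 2 j x)) - x = dp 2 j y))
    (hrow0 : ∀ i, dm i 0 ∘ₗ rp i 0 + rm i 0 ∘ₗ dp i (0 + 1) =
      (hm i (0 + 2) ∘ₗ hp i (0 + 1) : Xp i (0 + 1) →ₗ[F] Xp i 0) ∧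
      dp i 0 ∘ₗ rm i 0 + rp i 0 ∘ₗ dm i (0 + 1) =
      (hp i (0 + 2) ∘ₗ hm i (0 + 1) : Xm i (0 + 1) →ₗ[F] Xm i 0))
    (hrow1 : ∀ i, dm i 1 ∘ₗ rp i 1 + rm i 1 ∘ₗ dp i (1 + 1) =
      (hm i (1 + 2) ∘ₗ hp i (1 + 1) : Xp i (1 + 1) →ₗ[F] Xp i 1) ∧
      dp i 1 ∘ₗ rm i 1 + rp i 1 ∘ₗ dm i (1 + 1) =
      (hp i (1 + 2) ∘ₗ hm i (1 + 1) : Xm i (1 + 1) →ₗ[F] Xm i 1))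
    (hrow2 : ∀ i, dm i 2 ∘ₗ rp i 2 + rm i 2 ∘ₗ dp i (2 + 1) =
      (hm i (2 + 2) ∘ₗ hp i (2 + 1) : Xp i (2 + 1) →ₗ[F] Xp i 2) ∧
      dp i 2 ∘ₗ rm i 2 + rp i 2 ∘ₗ dm i (2 + 1) =
      (hp i (2 + 2) ∘ₗ hm i (2 + 1) : Xm i (2 + 1) →ₗ[F] Xm i 2))
    (hrowid0 : ∀ i, (∀ x : Xp i 0, dp i 0 x = 0 →
      ∃ y, ((id (α := Xp i 0) (hm i (0 + 2) (rp i (0 + 2) x))) + rm i 0 (hp i 0 x)) - x = dm i 0 y) ∧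
      (∀ x : Xm i 0, dm i 0 x = 0 →
      ∃ y, ((id (α := Xm i 0) (hp i (0 + 2) (rm i (0 + 2) x))) + rp i 0 (hm i 0 x)) - x = dp i 0 y))
    (hrowid1 : ∀ i, (∀ x : Xp i 1, dp i 1 x = 0 →
      ∃ y, ((id (α := Xp i 1) (hm i (1 + 2) (rp i (1 + 2) x))) + rm i 1 (hp i 1 x)) - x = dm i 1 y) ∧
      (∀ x : Xm i 1, dm i 1 x = 0 →
      ∃ y, ((id (α := Xm i 1) (hp i (1 + 2) (rm i (1 + 2) x))) + rp i 1 (hm i 1 x)) - x = dp i 1 y))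
    (hrowid2 : ∀ i, (∀ x : Xp i 2, dp i 2 x = 0 →
      ∃ y, ((id (α := Xp i 2) (hm i (2 + 2) (rp i (2 + 2) x))) + rm i 2 (hp i 2 x)) - x = dm i 2 y) ∧
      (∀ x : Xm i 2, dm i 2 x = 0 →
      ∃ y, ((id (α := Xm i 2) (hp i (2 + 2) (rm i (2 + 2) x))) + rp i 2 (hm i 2 x)) - x = dp i 2 y))
    (hbit10 : ∀ j, (∀ x : Xp 0 j, dp 0 j x = 0 →
      ∃ y, (id (α := Xp (0 + 2) (j + 1)) (vm (0 + 1) (j + 1) (sp 0 j x))) +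
        (id (α := Xp (0 + 2) (j + 1)) (sm (0 + 1) j (vp 0 j x))) +
        tm (0 + 2) (j + 1) (hp 0 j x) + hm (0 + 2) j (tp (0 + 2) j x) =
        dm (0 + 2) (j + 1) y) ∧
      (∀ x : Xm 0 j, dm 0 j x = 0 →
      ∃ y, (id (α := Xm (0 + 2) (j + 1)) (vp (0 + 1) (j + 1) (sm 0 j x))) +
        (id (α := Xm (0 + 2) (j + 1)) (sp (0 + 1) j (vm 0 j x))) +
        tp (0 + 2) (j + 1) (hm 0 j x) + hp (0 + 2) j (tm (0 + 2) j x) =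
        dp (0 + 2) (j + 1) y))
    (hbit11 : ∀ j, (∀ x : Xp 1 j, dp 1 j x = 0 →
      ∃ y, (id (α := Xp (1 + 2) (j + 1)) (vm (1 + 1) (j + 1) (sp 1 j x))) +
        (id (α := Xp (1 + 2) (j + 1)) (sm (1 + 1) j (vp 1 j x))) +
        tm (1 + 2) (j + 1) (hp 1 j x) + hm (1 + 2) j (tp (1 + 2) j x) =
        dm (1 + 2) (j + 1) y) ∧
      (∀ x : Xm 1 j, dm 1 j x = 0 →
      ∃ y, (id (α := Xm (1 + 2) (j + 1)) (vp (1 + 1) (j + 1) (sm 1 j x))) +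
        (id (α := Xm (1 + 2) (j + 1)) (sp (1 + 1) j (vm 1 j x))) +
        tp (1 + 2) (j + 1) (hm 1 j x) + hp (1 + 2) j (tm (1 + 2) j x) =
        dp (1 + 2) (j + 1) y))
    (hbit12 : ∀ j, (∀ x : Xp 2 j, dp 2 j x = 0 →
      ∃ y, (id (α := Xp (2 + 2) (j + 1)) (vm (2 + 1) (j + 1) (sp 2 j x))) +
        (id (α := Xp (2 + 2) (j + 1)) (sm (2 + 1) j (vp 2 j x))) +
        tm (2 + 2) (j + 1) (hp 2 j x) + hm (2 + 2) j (tp (2 + 2) j x) =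
        dm (2 + 2) (j + 1) y) ∧
      (∀ x : Xm 2 j, dm 2 j x = 0 →
      ∃ y, (id (α := Xm (2 + 2) (j + 1)) (vp (2 + 1) (j + 1) (sm 2 j x))) +
        (id (α := Xm (2 + 2) (j + 1)) (sp (2 + 1) j (vm 2 j x))) +
        tp (2 + 2) (j + 1) (hm 2 j x) + hp (2 + 2) j (tm (2 + 2) j x) =
        dp (2 + 2) (j + 1) y))
    (hbit20 : ∀ i, (∀ x : Xp i 0, dp i 0 x = 0 →
      ∃ y, (id (α := Xp (i + 1) (0 + 2)) (hm (i + 1) (0 + 1) (sp i 0 x))) +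
        (id (α := Xp (i + 1) (0 + 2)) (sm i (0 + 1) (hp i 0 x))) +
        rm (i + 1) (0 + 2) (vp i 0 x) + vm i (0 + 2) (rp i (0 + 2) x) =
        dm (i + 1) (0 + 2) y) ∧
      (∀ x : Xm i 0, dm i 0 x = 0 →
      ∃ y, (id (α := Xm (i + 1) (0 + 2)) (hp (i + 1) (0 + 1) (sm i 0 x))) +
        (id (α := Xm (i + 1) (0 + 2)) (sp i (0 + 1) (hm i 0 x))) +
        rp (i + 1) (0 + 2) (vm i 0 x) + vp i (0 + 2) (rm i (0 + 2) x) =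
        dp (i + 1) (0 + 2) y))
    (hbit21 : ∀ i, (∀ x : Xp i 1, dp i 1 x = 0 →
      ∃ y, (id (α := Xp (i + 1) (1 + 2)) (hm (i + 1) (1 + 1) (sp i 1 x))) +
        (id (α := Xp (i + 1) (1 + 2)) (sm i (1 + 1) (hp i 1 x))) +
        rm (i + 1) (1 + 2) (vp i 1 x) + vm i (1 + 2) (rp i (1 + 2) x) =
        dm (i + 1) (1 + 2) y) ∧
      (∀ x : Xm i 1, dm i 1 x = 0 →
      ∃ y, (id (α := Xm (i + 1) (1 + 2)) (hp (i + 1) (1 + 1) (sm i 1 x))) +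
        (id (α := Xm (i + 1) (1 + 2)) (sp i (1 + 1) (hm i 1 x))) +
        rp (i + 1) (1 + 2) (vm i 1 x) + vp i (1 + 2) (rm i (1 + 2) x) =
        dp (i + 1) (1 + 2) y))
    (hbit22 : ∀ i, (∀ x : Xp i 2, dp i 2 x = 0 →
      ∃ y, (id (α := Xp (i + 1) (2 + 2)) (hm (i + 1) (2 + 1) (sp i 2 x))) +
        (id (α := Xp (i + 1) (2 + 2)) (sm i (2 + 1) (hp i 2 x))) +
        rm (i + 1) (2 + 2) (vp i 2 x) + vm i (2 + 2) (rp i (2 + 2) x) =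
        dm (i + 1) (2 + 2) y) ∧
      (∀ x : Xm i 2, dm i 2 x = 0 →
      ∃ y, (id (α := Xm (i + 1) (2 + 2)) (hp (i + 1) (2 + 1) (sm i 2 x))) +
        (id (α := Xm (i + 1) (2 + 2)) (sp i (2 + 1) (hm i 2 x))) +
        rp (i + 1) (2 + 2) (vm i 2 x) + vp i (2 + 2) (rm i (2 + 2) x) =
        dp (i + 1) (2 + 2) y))
    (hfin : ∀ i j, FiniteDimensional F (Hgen F (dp i j) (dm i j)) ∧
      FiniteDimensional F (Hgen F (dm i j) (dp i j))) :
    ∀ (vHp : ∀ i j, Hgen F (dp (i + 2) j) (dm (i + 2) j) →ₗ[F] Hgen F (dm i j) (dp i j))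
      (vHm : ∀ i j, Hgen F (dm (i + 2) j) (dp (i + 2) j) →ₗ[F] Hgen F (dp i j) (dm i j))
      (hHp : ∀ i j, Hgen F (dp i (j + 2)) (dm i (j + 2)) →ₗ[F] Hgen F (dm i j) (dp i j))
      (hHm : ∀ i j, Hgen F (dm i (j + 2)) (dp i (j + 2)) →ₗ[F] Hgen F (dp i j) (dm i j)),
      (∀ j x hx hy, vHp 0 j (mkHgen F (dp (0 + 2) j) (dm (0 + 2) j) x hx) =
        mkHgen F (dm 0 j) (dp 0 j) (vp (0 + 2) j x) hy) →
      (∀ j x hx hy, vHm 0 j (mkHgen F (dm (0 + 2) j) (dp (0 + 2) j) x hx) =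
        mkHgen F (dp 0 j) (dm 0 j) (vm (0 + 2) j x) hy) →
      (∀ j x hx hy, vHp 1 j (mkHgen F (dp (1 + 2) j) (dm (1 + 2) j) x hx) =
        mkHgen F (dm 1 j) (dp 1 j) (vp (1 + 2) j x) hy) →
      (∀ j x hx hy, vHm 1 j (mkHgen F (dm (1 + 2) j) (dp (1 + 2) j) x hx) =
        mkHgen F (dp 1 j) (dm 1 j) (vm (1 + 2) j x) hy) →
      (∀ j x hx hy, vHp 2 j (mkHgen F (dp (2 + 2) j) (dm (2 + 2) j) x hx) =
        mkHgen F (dm 2 j) (dp 2 j) (vp (2 + 2) j x) hy) →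
      (∀ j x hx hy, vHm 2 j (mkHgen F (dm (2 + 2) j) (dp (2 + 2) j) x hx) =
        mkHgen F (dp 2 j) (dm 2 j) (vm (2 + 2) j x) hy) →
      (∀ i x hx hy, hHp i 0 (mkHgen F (dp i (0 + 2)) (dm i (0 + 2)) x hx) =
        mkHgen F (dm i 0) (dp i 0) (hp i (0 + 2) x) hy) →
      (∀ i x hx hy, hHm i 0 (mkHgen F (dm i (0 + 2)) (dp i (0 + 2)) x hx) =
        mkHgen F (dp i 0) (dm i 0) (hm i (0 + 2) x) hy) →
      (∀ i x hx hy, hHp i 1 (mkHgen F (dp i (1 + 2)) (dm i (1 + 2)) x hx) =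
        mkHgen F (dm i 1) (dp i 1) (hp i (1 + 2) x) hy) →
      (∀ i x hx hy, hHm i 1 (mkHgen F (dm i (1 + 2)) (dp i (1 + 2)) x hx) =
        mkHgen F (dp i 1) (dm i 1) (hm i (1 + 2) x) hy) →
      (∀ i x hx hy, hHp i 2 (mkHgen F (dp i (2 + 2)) (dm i (2 + 2)) x hx) =
        mkHgen F (dm i 2) (dp i 2) (hp i (2 + 2) x) hy) →
      (∀ i x hx hy, hHm i 2 (mkHgen F (dm i (2 + 2)) (dp i (2 + 2)) x hx) =
        mkHgen F (dp i 2) (dm i 2) (hm i (2 + 2) x) hy) →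
      ∀ (delta : ∀ k : Fin 3, Dtot F Xp Xm dp dm k →ₗ[F] Dtot F Xp Xm dp dm (k + 1)),
      (∀ (k : Fin 3) (q : {p : Fin 3 × Fin 3 // p.1 + p.2 = k + 1})
        (z : Dtot F Xp Xm dp dm k)
        (pfv : (q.1.1 + 2) + q.1.2 = k) (pfh : q.1.1 + (q.1.2 + 2) = k),
        (delta k z) q =
          (vHm q.1.1 q.1.2 ((z ⟨(q.1.1 + 2, q.1.2), pfv⟩).2) -
            hHm q.1.1 q.1.2 ((z ⟨(q.1.1, q.1.2 + 2), pfh⟩).2),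
           vHp q.1.1 q.1.2 ((z ⟨(q.1.1 + 2, q.1.2), pfv⟩).1) -
            hHp q.1.1 q.1.2 ((z ⟨(q.1.1, q.1.2 + 2), pfh⟩).1))) →
      ∀ (k : Fin 3) (pos : {p : Fin 3 × Fin 3 // p.1 + p.2 = k})
        (x : P9p F Xp Xm dp dm × P9m F Xp Xm dp dm),
        totOdd F Xp Xm dp dm (alphaVp F Xp Xm dp dm vHp) (alphaVm F Xp Xm dp dm vHm)
          (totOdd F Xp Xm dp dm (alphaHp F Xp Xm dp dm hHp) (alphaHm F Xp Xm dp dm hHm) x) = 0 →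
        totOdd F Xp Xm dp dm (alphaHp F Xp Xm dp dm hHp) (alphaHm F Xp Xm dp dm hHm)
          (totOdd F Xp Xm dp dm (alphaVp F Xp Xm dp dm vHp) (alphaVm F Xp Xm dp dm vHm) x) = 0 →
        ∃ z : Dtot F Xp Xm dp dm k, delta k z = 0 ∧
          ∃ a b : P9p F Xp Xm dp dm × P9m F Xp Xm dp dm,
            totOdd F Xp Xm dp dm (alphaVp F Xp Xm dp dm vHp) (alphaVm F Xp Xm dp dm vHm) a = 0 ∧
            totOdd F Xp Xm dp dm (alphaHp F Xp Xm dp dm hHp) (alphaHm F Xp Xm dp dm hHm) b = 0 ∧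
            z pos = ((x.1 + a.1 + b.1) pos.1, (x.2 + a.2 + b.2) pos.1) := by
  intro vHp vHm hHp hHm eVp0 eVm0 eVp1 eVm1 eVp2 eVm2 eHp0 eHm0 eHp1 eHm1 eHp2 eHm2 delta hdelta
  rintro k ⟨⟨i, j⟩, rfl⟩ x _ hx
  obtain ⟨z1, hz1, hz1'⟩ := bit_parity F Xp Xm dp dm vp vm hp hm sp sm tp tm rp rm
    (fun i j => (hvchain i j).1)
    (fun i j => (hvchain i j).2)
    (fun i j => (hhchain i j).1)
    (fun i j => (hhchain i j).2)
    (fun i j => (hsq i j).1)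
    (fun i j => (hsq i j).2)
    (fun i => (hcol0 i).1)
    (fun i => (hcol0 i).2)
    (fun i => (hrow0 i).2)
    (fun i => (hcolid0 i).2)
    (fun i => (hrowid0 i).2)
    (fun i => (hbit10 i).1)
    (fun i => (hbit20 i).2)
    (fun i => (hcol1 i).1)
    (fun i => (hcol1 i).2)
    (fun i => (hrow1 i).2)
    (fun i => (hcolid1 i).2)
    (fun i => (hrowid1 i).2)
    (fun i => (hbit11 i).1)
    (fun i => (hbit21 i).2)
    (fun i => (hcol2 i).1)
    (fun i => (hcol2 i).2)
    (fun i => (hrow2 i).2)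
    (fun i => (hcolid2 i).2)
    (fun i => (hrowid2 i).2)
    (fun i => (hbit12 i).1)
    (fun i => (hbit22 i).2)
    vHp hHp hHm eVp0 eHp0 eHm0 eVp1 eHp1 eHm1 eVp2 eHp2 eHm2 i j x.1
    (fun a b => congrFun (congrArg Prod.fst hx) (a, b))
  obtain ⟨z2, hz2, hz2'⟩ := bit_parity F Xm Xp dm dp vm vp hm hp sm sp tm tp rm rp
    (fun i j => (hvchain i j).2)
    (fun i j => (hvchain i j).1)
    (fun i j => (hhchain i j).2)
    (fun i j => (hhchain i j).1)
    (fun i j => (hsq i j).2)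
    (fun i j => (hsq i j).1)
    (fun i => (hcol0 i).2)
    (fun i => (hcol0 i).1)
    (fun i => (hrow0 i).1)
    (fun i => (hcolid0 i).1)
    (fun i => (hrowid0 i).1)
    (fun i => (hbit10 i).2)
    (fun i => (hbit20 i).1)
    (fun i => (hcol1 i).2)
    (fun i => (hcol1 i).1)
    (fun i => (hrow1 i).1)
    (fun i => (hcolid1 i).1)
    (fun i => (hrowid1 i).1)
    (fun i => (hbit11 i).2)
    (fun i => (hbit21 i).1)
    (fun i => (hcol2 i).2)
    (fun i => (hcol2 i).1)
    (fun i => (hrow2 i).1)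
    (fun i => (hcolid2 i).1)
    (fun i => (hrowid2 i).1)
    (fun i => (hbit12 i).2)
    (fun i => (hbit22 i).1)
    vHm hHm hHp eVm0 eHm0 eHp0 eVm1 eHm1 eHp1 eVm2 eHm2 eHp2 i j x.2
    (fun a b => congrFun (congrArg Prod.snd hx) (a, b))
  refine ⟨fun p => (z1 p, z2 p), ?_, 0, 0, map_zero _, map_zero _, ?_⟩
  · funext q
    have pfv : (q.1.1 + 2) + q.1.2 = i + j := by
      obtain ⟨⟨a, b⟩, hq⟩ := q
      clear * - hq
      revert a b i j
      decide
    have pfh : q.1.1 + (q.1.2 + 2) = i + j := by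
      refine Eq.trans ?_ pfv; abel
    rw [hdelta _ q _ pfv pfh]
    refine Prod.ext ?_ ?_
    · exact sub_eq_zero.mpr (hz2' _ _ pfv pfh)
    · exact sub_eq_zero.mpr (hz1' _ _ pfv pfh)
  · refine Prod.ext ?_ ?_
    · simpa using hz1
    · simpa using hz2

end Bitriangle
end
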